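/- Let α, β > −1 and suppose (p_k)_{k≥0} is a sequence of real polynomials on [−1,1] with deg p_k = k that is orthonormal in L²([−1,1], μ), where dμ(x) = (1−x)^α (1+x)^β dx. Define the Jacobi heat kernel e^{tL}(x,y) := Σ_{k≥0} e^{−λ_k t} p_k(x) p_k(y) with λ_k = k(k+α+β+1). Then there exist constants c₁, c₂, c₃, c₄ > 0 such that for all x, y ∈ [−1,1] and t > 0: c₁ exp(−ρ(x,y)²/(c₂ t)) / √(V(x,√t) V(y,√t)) ≤ e^{tL}(x,y) ≤ c₃ exp(−ρ(x,y)²/(c₄ t)) / √(V(x,√t) V(y,√t)). -/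

import Mathlib

open MeasureTheory Real

noncomputable section

/-- The Jacobi measure `dμ(x) = (1-x)^α (1+x)^β dx` on `[-1,1]`. -/
def jacobiMeasure (α β : ℝ) : Measure ℝ :=
  (volume.restrict (Set.Icc (-1 : ℝ) 1)).withDensity fun x =>
    ENNReal.ofReal ((1 - x) ^ α * (1 + x) ^ β)

/-- The distance `ρ(x,y) = |arccos x − arccos y|` on `[-1,1]`. -/
def jacobiDist (x y : ℝ) : ℝ := |Real.arccos x - Real.arccos y|

/-- `V(x,r) = μ(B(x,r))` where `B(x,r) = {y ∈ [-1,1] : ρ(x,y) < r}`. -/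
def jacobiVol (α β : ℝ) (x r : ℝ) : ℝ :=
  (jacobiMeasure α β {y | jacobiDist x y < r}).toReal

/-- The Jacobi eigenvalues `λ_k = k(k+α+β+1)`. -/
def jacobiEig (α β : ℝ) (k : ℕ) : ℝ := k * (k + α + β + 1)

/-- The Jacobi heat kernel `e^{tL}(x,y) = Σ_k e^{-λ_k t} p_k(x) p_k(y)`. -/
def jacobiHeat (α β : ℝ) (p : ℕ → Polynomial ℝ) (t x y : ℝ) : ℝ :=
  ∑' k : ℕ, Real.exp (-(jacobiEig α β k) * t) * ((p k).eval x * (p k).eval y)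

section HeatKernel

open Polynomial Set

/-- The density of the Jacobi measure. -/
def jacobiWeight (α β x : ℝ) : ℝ := (1 - x) ^ α * (1 + x) ^ β

lemma measurable_jacobiWeight (α β : ℝ) : Measurable (jacobiWeight α β) := by
  unfold jacobiWeight; fun_prop

lemma jacobiWeight_nonneg {α β x : ℝ} (hx : x ∈ Icc (-1 : ℝ) 1) : 0 ≤ jacobiWeight α β x :=
  mul_nonneg (rpow_nonneg (by linarith [hx.2]) _) (rpow_nonneg (by linarith [hx.1]) _)

lemma jacobiWeight_neg (α β x : ℝ) : jacobiWeight α β (-x) = jacobiWeight β α x := by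
  unfold jacobiWeight
  rw [sub_neg_eq_add, ← sub_eq_add_neg, mul_comm]

/-- Real powers of a base in `[c⁻¹, c]` are bounded by `c ^ |a|`. -/
lemma rpow_le_rpow_abs {c s : ℝ} (a : ℝ) (hc : 1 ≤ c) (hs : c⁻¹ ≤ s) (hs' : s ≤ c) :
    s ^ a ≤ c ^ |a| := by
  have hc0 : 0 < c := by linarith
  have hs0 : 0 < s := lt_of_lt_of_le (inv_pos.2 hc0) hs
  rcases le_total 0 a with ha | ha
  · rw [abs_of_nonneg ha]; exact rpow_le_rpow hs0.le hs' ha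
  · rw [abs_of_nonpos ha, rpow_neg hc0.le, ← inv_rpow hc0.le]
    exact rpow_le_rpow_of_nonpos (inv_pos.2 hc0) hs ha

lemma intervalIntegrable_one_sub_rpow {α : ℝ} (hα : -1 < α) (a b : ℝ) :
    IntervalIntegrable (fun x => (1 - x) ^ α) volume a b := by
  have := (intervalIntegral.intervalIntegrable_rpow' hα (a := 1 - a) (b := 1 - b)).comp_sub_left 1
  simpa using this

lemma jacobiWeight_le_of_nonneg {α β x : ℝ} (hx : x ∈ Icc (0 : ℝ) 1) :
    jacobiWeight α β x ≤ 2 ^ |β| * (1 - x) ^ α := by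
  unfold jacobiWeight
  rw [mul_comm]
  refine mul_le_mul_of_nonneg_right ?_ (rpow_nonneg (by linarith [hx.2]) _)
  exact rpow_le_rpow_abs β (by norm_num) (by linarith [hx.1]) (by linarith [hx.2])

lemma intervalIntegrable_jacobiWeight_zero_one {α : ℝ} (β : ℝ) (hα : -1 < α) :
    IntervalIntegrable (jacobiWeight α β) volume 0 1 := by
  refine ((intervalIntegrable_one_sub_rpow hα 0 1).const_mul (2 ^ |β|)).mono_fun
    (measurable_jacobiWeight α β).aestronglyMeasurable ?_
  refine (ae_restrict_mem measurableSet_uIoc).mono fun x hx => ?_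
  rw [uIoc_of_le zero_le_one] at hx
  have hx' : x ∈ Icc (0 : ℝ) 1 := ⟨hx.1.le, hx.2⟩
  have := jacobiWeight_le_of_nonneg (α := α) (β := β) hx'
  simp only [norm_of_nonneg (jacobiWeight_nonneg (α := α) (β := β)
    (x := x) ⟨by linarith [hx.1], hx.2⟩)]
  exact this.trans (le_abs_self _)

lemma intervalIntegrable_jacobiWeight {α β : ℝ} (hα : -1 < α) (hβ : -1 < β) :
    IntervalIntegrable (jacobiWeight α β) volume (-1) 1 := by
  refine IntervalIntegrable.trans (b := 0) ?_ (intervalIntegrable_jacobiWeight_zero_one β hα)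
  have := (intervalIntegrable_jacobiWeight_zero_one α hβ).comp_sub_left 0
  simp only [zero_sub, jacobiWeight_neg, sub_zero] at this
  exact this.symm

lemma jacobiMeasure_eq (α β : ℝ) : jacobiMeasure α β =
    (volume.restrict (Icc (-1 : ℝ) 1)).withDensity fun x => ENNReal.ofReal (jacobiWeight α β x) :=
  rfl

lemma isFiniteMeasure_jacobiMeasure {α β : ℝ} (hα : -1 < α) (hβ : -1 < β) :
    IsFiniteMeasure (jacobiMeasure α β) := by
  rw [jacobiMeasure_eq]
  refine isFiniteMeasure_withDensity_ofReal ?_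
  have := (intervalIntegrable_iff_integrableOn_Icc_of_le (by norm_num)).1
    (intervalIntegrable_jacobiWeight hα hβ)
  exact this.2

lemma ae_jacobiMeasure_mem (α β : ℝ) : ∀ᵐ x ∂(jacobiMeasure α β), x ∈ Icc (-1 : ℝ) 1 :=
  (withDensity_absolutelyContinuous _ _).ae_le (ae_restrict_mem measurableSet_Icc)

lemma integral_jacobiMeasure (α β : ℝ) (f : ℝ → ℝ) :
    ∫ x, f x ∂(jacobiMeasure α β) = ∫ x in (-1 : ℝ)..1, jacobiWeight α β x * f x := by
  rw [jacobiMeasure_eq, integral_withDensity_eq_integral_toReal_smul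
    (measurable_jacobiWeight α β).ennreal_ofReal (by simp),
    intervalIntegral.integral_of_le (by norm_num), ← integral_Icc_eq_integral_Ioc]
  refine setIntegral_congr_fun measurableSet_Icc fun x hx => ?_
  simp [ENNReal.toReal_ofReal (jacobiWeight_nonneg hx)]

lemma restrict_jacobiMeasure (α β : ℝ) :
    (jacobiMeasure α β).restrict (Icc (-1 : ℝ) 1) = jacobiMeasure α β :=
  Measure.restrict_eq_self_of_ae_mem (ae_jacobiMeasure_mem α β)

lemma integrable_jacobiMeasure {α β : ℝ} (hα : -1 < α) (hβ : -1 < β) {f : ℝ → ℝ}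
    (hf : ContinuousOn f (Icc (-1) 1)) : Integrable f (jacobiMeasure α β) := by
  have := isFiniteMeasure_jacobiMeasure hα hβ
  rw [← restrict_jacobiMeasure]
  exact hf.integrableOn_compact isCompact_Icc

lemma intervalIntegrable_jacobiWeight_mul {α β : ℝ} (hα : -1 < α) (hβ : -1 < β) {f : ℝ → ℝ}
    (hf : ContinuousOn f (Icc (-1) 1)) :
    IntervalIntegrable (fun x => jacobiWeight α β x * f x) volume (-1) 1 :=
  (intervalIntegrable_jacobiWeight hα hβ).mul_continuousOn
    (by rwa [uIcc_of_le (by norm_num)])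

/-- The Jacobi operator `(1 - x²) f'' + (β - α - (α + β + 2) x) f'` on polynomials. -/
def jacobiOp (α β : ℝ) : ℝ[X] →ₗ[ℝ] ℝ[X] :=
  LinearMap.mulLeft ℝ (1 - X ^ 2) ∘ₗ derivative ∘ₗ derivative +
    LinearMap.mulLeft ℝ (C (β - α) - C (α + β + 2) * X) ∘ₗ derivative

lemma jacobiOp_apply (α β : ℝ) (f : ℝ[X]) : jacobiOp α β f =
    (1 - X ^ 2) * derivative (derivative f) + (C (β - α) - C (α + β + 2) * X) * derivative f :=
  rfl

lemma eval_jacobiOp (α β : ℝ) (f : ℝ[X]) (x : ℝ) : (jacobiOp α β f).eval x =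
    (1 - x ^ 2) * (derivative (derivative f)).eval x +
      (β - α - (α + β + 2) * x) * (derivative f).eval x := by
  simp [jacobiOp_apply]

lemma coeff_jacobiOp (α β : ℝ) (f : ℝ[X]) {N : ℕ} (hN : f.natDegree ≤ N) :
    (jacobiOp α β f).coeff N = -jacobiEig α β N * f.coeff N := by
  have h2 : f.coeff (N + 1) = 0 := coeff_eq_zero_of_natDegree_lt (by omega)
  have h3 : f.coeff (N + 1 + 1) = 0 := coeff_eq_zero_of_natDegree_lt (by omega)
  rw [jacobiOp_apply, jacobiEig]
  generalize hc : α + β + 2 = c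
  have hc' : α + β + 1 = c - 1 := by linarith
  rw [add_assoc, add_assoc, ← add_assoc α, hc']
  rcases N with _ | _ | N
  · simp [sub_mul, mul_assoc, coeff_derivative, h2, h3]
  · simp [sub_mul, mul_assoc, coeff_X_pow_mul', coeff_derivative, h2, h3]
  · simp [sub_mul, mul_assoc, coeff_X_pow_mul', coeff_derivative, h2, h3]
    ring

lemma natDegree_jacobiOp_le (α β : ℝ) (f : ℝ[X]) :
    (jacobiOp α β f).natDegree ≤ f.natDegree := by
  rw [natDegree_le_iff_coeff_eq_zero]
  intro N hN
  rw [coeff_jacobiOp α β f hN.le, coeff_eq_zero_of_natDegree_lt hN, mul_zero]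

/-- The flux `(1 - x) ^ (α + 1) (1 + x) ^ (β + 1) f'(x)`. -/
def jacobiFlux (α β : ℝ) (f : ℝ[X]) (x : ℝ) : ℝ :=
  jacobiWeight (α + 1) (β + 1) x * (derivative f).eval x

lemma jacobiWeight_add_one {α β x : ℝ} (hx : x ∈ Ioo (-1 : ℝ) 1) :
    jacobiWeight (α + 1) (β + 1) x = jacobiWeight α β x * (1 - x ^ 2) := by
  unfold jacobiWeight
  rw [rpow_add_one (by linarith [hx.2]), rpow_add_one (by linarith [hx.1])]
  ring

lemma continuous_jacobiWeight {α β : ℝ} (hα : 0 ≤ α) (hβ : 0 ≤ β) :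
    Continuous (jacobiWeight α β) :=
  ((continuous_const.sub continuous_id).rpow_const fun _ => Or.inr hα).mul
    ((continuous_const.add continuous_id).rpow_const fun _ => Or.inr hβ)

lemma continuous_jacobiFlux {α β : ℝ} (hα : -1 < α) (hβ : -1 < β) (f : ℝ[X]) :
    Continuous (jacobiFlux α β f) :=
  (continuous_jacobiWeight (by linarith) (by linarith)).mul (derivative f).continuous

lemma hasDerivAt_jacobiFlux (α β : ℝ) (f : ℝ[X]) {x : ℝ} (hx : x ∈ Ioo (-1 : ℝ) 1) :
    HasDerivAt (jacobiFlux α β f) (jacobiWeight α β x * (jacobiOp α β f).eval x) x := by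
  have h1 : (0 : ℝ) < 1 - x := by linarith [hx.2]
  have h2 : (0 : ℝ) < 1 + x := by linarith [hx.1]
  have e1 := ((hasDerivAt_id x).const_sub 1).rpow_const (p := α + 1) (Or.inl h1.ne')
  have e2 := ((hasDerivAt_id x).const_add 1).rpow_const (p := β + 1) (Or.inl h2.ne')
  refine ((e1.mul e2).mul (Polynomial.hasDerivAt (derivative f) x)).congr_deriv ?_
  simp only [id, eval_jacobiOp, jacobiWeight, add_sub_cancel_right, Pi.mul_apply]
  rw [rpow_add_one h1.ne', rpow_add_one h2.ne']
  ring

lemma jacobiFlux_one {α : ℝ} (β : ℝ) (hα : -1 < α) (f : ℝ[X]) : jacobiFlux α β f 1 = 0 := by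
  simp [jacobiFlux, jacobiWeight, zero_rpow (by linarith : α + 1 ≠ 0)]

lemma jacobiFlux_neg_one (α : ℝ) {β : ℝ} (hβ : -1 < β) (f : ℝ[X]) :
    jacobiFlux α β f (-1) = 0 := by
  simp [jacobiFlux, jacobiWeight, zero_rpow (by linarith : β + 1 ≠ 0)]

/-- Integration by parts against the Jacobi operator. -/
lemma integral_mul_jacobiOp {α β : ℝ} (hα : -1 < α) (hβ : -1 < β) (f : ℝ[X]) {h k : ℝ → ℝ}
    (hh : ContinuousOn h (Icc (-1) 1)) (hk : ContinuousOn k (Icc (-1) 1))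
    (hd : ∀ x ∈ Ioo (-1 : ℝ) 1, HasDerivAt h (k x / (1 - x ^ 2)) x) :
    ∫ x, h x * (jacobiOp α β f).eval x ∂(jacobiMeasure α β) =
      -∫ x, (derivative f).eval x * k x ∂(jacobiMeasure α β) := by
  have hc1 : ContinuousOn (fun x => h x * (jacobiOp α β f).eval x) (Icc (-1) 1) :=
    hh.mul (Polynomial.continuous _).continuousOn
  have hc2 : ContinuousOn (fun x => (derivative f).eval x * k x) (Icc (-1) 1) :=
    (Polynomial.continuous _).continuousOn.mul hk
  rw [eq_neg_iff_add_eq_zero, ← integral_add (integrable_jacobiMeasure hα hβ hc1)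
    (integrable_jacobiMeasure hα hβ hc2), integral_jacobiMeasure]
  have key := intervalIntegral.integral_eq_sub_of_hasDerivAt_of_le
    (f := fun x => jacobiFlux α β f x * h x)
    (f' := fun x => jacobiWeight α β x *
      (h x * (jacobiOp α β f).eval x + (derivative f).eval x * k x))
    (by norm_num : (-1 : ℝ) ≤ 1) ((continuous_jacobiFlux hα hβ f).continuousOn.mul hh)
    (fun x hx => ?_) (intervalIntegrable_jacobiWeight_mul hα hβ (hc1.add hc2))
  · rw [key, jacobiFlux_one β hα, jacobiFlux_neg_one α hβ]; simp
  · refine ((hasDerivAt_jacobiFlux α β f hx).mul (hd x hx)).congr_deriv ?_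
    have : (1 - x ^ 2) ≠ 0 := by nlinarith [hx.1, hx.2]
    rw [jacobiFlux, jacobiWeight_add_one hx]
    field_simp

/-- A sequence of orthonormal polynomials for the Jacobi measure, ordered by degree. -/
structure JacobiSystem (α β : ℝ) (p : ℕ → ℝ[X]) : Prop where
  left_gt : -1 < α
  right_gt : -1 < β
  natDegree_eq : ∀ k, (p k).natDegree = k
  orthonormal : ∀ k l : ℕ,
    ∫ x, (p k).eval x * (p l).eval x ∂(jacobiMeasure α β) = if k = l then 1 else 0

/-- The bilinear form `∫ f g w dμ`. -/
def weightedForm {α β : ℝ} (hα : -1 < α) (hβ : -1 < β) {w : ℝ → ℝ}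
    (hw : ContinuousOn w (Icc (-1) 1)) : ℝ[X] →ₗ[ℝ] ℝ[X] →ₗ[ℝ] ℝ :=
  have hi (f g : ℝ[X]) : Integrable (fun x => f.eval x * g.eval x * w x) (jacobiMeasure α β) :=
    integrable_jacobiMeasure hα hβ ((f.continuous.mul g.continuous).continuousOn.mul hw)
  LinearMap.mk₂ ℝ (fun f g => ∫ x, f.eval x * g.eval x * w x ∂(jacobiMeasure α β))
    (fun f₁ f₂ g => by
      rw [← integral_add (hi _ _) (hi _ _)]; simp [add_mul])
    (fun c f g => by
      rw [smul_eq_mul, ← integral_const_mul]; simp [mul_assoc])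
    (fun f g₁ g₂ => by
      rw [← integral_add (hi _ _) (hi _ _)]; simp [mul_add, add_mul])
    (fun c f g => by
      rw [smul_eq_mul, ← integral_const_mul]; congr 1; ext x; simp; ring)

lemma weightedForm_apply {α β : ℝ} (hα : -1 < α) (hβ : -1 < β) {w : ℝ → ℝ}
    (hw : ContinuousOn w (Icc (-1) 1)) (f g : ℝ[X]) : weightedForm hα hβ hw f g =
      ∫ x, f.eval x * g.eval x * w x ∂(jacobiMeasure α β) := rfl

namespace JacobiSystem

variable {α β : ℝ} {p : ℕ → ℝ[X]}

/-- The Fourier–Jacobi coefficient `∫ f p_k dμ`. -/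
def coef (h : JacobiSystem α β p) (k : ℕ) : ℝ[X] →ₗ[ℝ] ℝ :=
  (weightedForm h.left_gt h.right_gt (w := fun _ => 1) continuousOn_const).flip (p k)

lemma coef_apply (h : JacobiSystem α β p) (k : ℕ) (f : ℝ[X]) :
    h.coef k f = ∫ x, f.eval x * (p k).eval x ∂(jacobiMeasure α β) := by
  simp [coef, weightedForm_apply]

lemma coef_self (h : JacobiSystem α β p) (k l : ℕ) :
    h.coef k (p l) = if l = k then 1 else 0 := by
  rw [coef_apply, h.orthonormal]

lemma ne_zero (h : JacobiSystem α β p) (k : ℕ) : p k ≠ 0 := by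
  intro h0
  have := h.orthonormal k k
  simp [h0] at this

lemma mem_degreeLT (h : JacobiSystem α β p) {k n : ℕ} (hk : k < n) : p k ∈ degreeLT ℝ n := by
  rw [Polynomial.mem_degreeLT, degree_eq_natDegree (h.ne_zero k), h.natDegree_eq]
  exact_mod_cast hk

lemma exists_eq_sum (h : JacobiSystem α β p) (n : ℕ) :
    ∀ f ∈ degreeLT ℝ n, ∃ a : ℕ → ℝ, f = ∑ k ∈ Finset.range n, a k • p k := by
  induction n with
  | zero =>
    intro f hf
    refine ⟨0, ?_⟩
    rw [Polynomial.mem_degreeLT] at hf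
    simpa using hf
  | succ n ih =>
    intro f hf
    have hlc : (p n).coeff n ≠ 0 := by
      have := leadingCoeff_ne_zero.2 (h.ne_zero n)
      rwa [leadingCoeff, h.natDegree_eq] at this
    set c := f.coeff n / (p n).coeff n with hc
    obtain ⟨a, ha⟩ := ih (f - c • p n) (by
      rw [Polynomial.mem_degreeLT, degree_lt_iff_coeff_zero]
      intro m hm
      rcases hm.eq_or_lt with rfl | hm
      · simp [hc, hlc]
      · rw [Polynomial.mem_degreeLT, degree_lt_iff_coeff_zero] at hf
        have : (p n).coeff m = 0 :=
          coeff_eq_zero_of_natDegree_lt (by rw [h.natDegree_eq]; exact hm)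
        simp [hf m hm, this])
    refine ⟨Function.update a n c, ?_⟩
    rw [Finset.sum_range_succ, Function.update_self, ← sub_eq_iff_eq_add, ha]
    refine Finset.sum_congr rfl fun k hk => ?_
    rw [Function.update_of_ne (Finset.mem_range.1 hk).ne]

lemma eq_sum_coef (h : JacobiSystem α β p) {n : ℕ} {f : ℝ[X]} (hf : f ∈ degreeLT ℝ n) :
    f = ∑ k ∈ Finset.range n, h.coef k f • p k := by
  obtain ⟨a, ha⟩ := h.exists_eq_sum n f hf
  have : ∀ k ∈ Finset.range n, h.coef k f = a k := by
    intro k hk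
    rw [ha, map_sum]
    simp only [map_smul, coef_self, smul_eq_mul, mul_ite, mul_one, mul_zero,
      Finset.sum_ite_eq', hk, if_true]
  rw [Finset.sum_congr rfl fun k hk => by rw [this k hk]]
  exact ha

lemma coef_eq_zero (h : JacobiSystem α β p) {n k : ℕ} {f : ℝ[X]} (hf : f ∈ degreeLT ℝ n)
    (hk : n ≤ k) : h.coef k f = 0 := by
  rw [h.eq_sum_coef hf, map_sum]
  refine Finset.sum_eq_zero fun l hl => ?_
  rw [map_smul, coef_self, if_neg (by have := Finset.mem_range.1 hl; omega), smul_zero]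

lemma mem_degreeLT_succ (f : ℝ[X]) : f ∈ degreeLT ℝ (f.natDegree + 1) := by
  rw [Polynomial.mem_degreeLT]
  exact lt_of_le_of_lt degree_le_natDegree (by exact_mod_cast Nat.lt_succ_self _)

lemma ext_coef (h : JacobiSystem α β p) {f g : ℝ[X]} (hfg : ∀ k, h.coef k f = h.coef k g) :
    f = g := by
  rw [← sub_eq_zero, h.eq_sum_coef (mem_degreeLT_succ (f - g))]
  refine Finset.sum_eq_zero fun k _ => ?_
  rw [map_sub, hfg, sub_self, zero_smul]

lemma integral_jacobiOp_comm (h : JacobiSystem α β p) (f g : ℝ[X]) :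
    ∫ x, (jacobiOp α β f).eval x * g.eval x ∂(jacobiMeasure α β) =
      ∫ x, f.eval x * (jacobiOp α β g).eval x ∂(jacobiMeasure α β) := by
  have key (f g : ℝ[X]) := integral_mul_jacobiOp h.left_gt h.right_gt f (h := g.eval)
    (k := fun x => (1 - x ^ 2) * (derivative g).eval x) g.continuous.continuousOn
    (by fun_prop) (fun x hx => by
      refine (Polynomial.hasDerivAt g x).congr_deriv ?_
      have : (1 - x ^ 2) ≠ 0 := by nlinarith [hx.1, hx.2]
      field_simp)
  rw [key g f]
  simp_rw [mul_comm (eval _ (jacobiOp α β f))]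
  rw [key f g]
  congr 2; ext x; ring

lemma jacobiOp_self (h : JacobiSystem α β p) (k : ℕ) :
    jacobiOp α β (p k) = (-jacobiEig α β k) • p k := by
  have hd {f : ℝ[X]} (hf : f ∈ degreeLT ℝ k) : jacobiOp α β f ∈ degreeLT ℝ k := by
    rcases eq_or_ne f 0 with rfl | hf0
    · simp
    rw [Polynomial.mem_degreeLT, degree_eq_natDegree hf0] at hf
    rw [Polynomial.mem_degreeLT]
    refine lt_of_le_of_lt degree_le_natDegree (lt_of_le_of_lt ?_ hf)
    exact_mod_cast natDegree_jacobiOp_le α β f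
  have hq : jacobiOp α β (p k) - (-jacobiEig α β k) • p k ∈ degreeLT ℝ k := by
    rw [Polynomial.mem_degreeLT, degree_lt_iff_coeff_zero]
    intro m hm
    rw [coeff_sub, coeff_jacobiOp α β _ ((h.natDegree_eq k).trans_le hm), coeff_smul, smul_eq_mul]
    rcases hm.eq_or_lt with rfl | hm
    · ring
    · rw [coeff_eq_zero_of_natDegree_lt (by rw [h.natDegree_eq]; exact hm)]; ring
  refine h.ext_coef fun l => ?_
  rw [← sub_eq_zero, ← map_sub]
  rcases lt_or_ge l k with hl | hl
  · rw [map_sub, map_smul, coef_self, if_neg hl.ne', smul_zero, sub_zero, coef_apply,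
      integral_jacobiOp_comm h]
    have := h.coef_eq_zero (hd (h.mem_degreeLT hl)) le_rfl
    rw [coef_apply] at this
    simpa only [mul_comm] using this
  · exact h.coef_eq_zero hq hl

lemma coef_jacobiOp (h : JacobiSystem α β p) (k : ℕ) (f : ℝ[X]) :
    h.coef k (jacobiOp α β f) = -jacobiEig α β k * h.coef k f := by
  rw [coef_apply, coef_apply, integral_jacobiOp_comm h, jacobiOp_self h, ← integral_const_mul]
  congr 1; ext x; simp; ring

/-- The Jacobi heat semigroup on polynomials. -/
def heat (h : JacobiSystem α β p) (t : ℝ) (f : ℝ[X]) : ℝ[X] :=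
  ∑ k ∈ Finset.range (f.natDegree + 1), (exp (-jacobiEig α β k * t) * h.coef k f) • p k

lemma heat_eq_sum (h : JacobiSystem α β p) (t : ℝ) {n : ℕ} {f : ℝ[X]}
    (hf : f ∈ degreeLT ℝ n) :
    h.heat t f = ∑ k ∈ Finset.range n, (exp (-jacobiEig α β k * t) * h.coef k f) • p k := by
  have key (m : ℕ) (hm : f ∈ degreeLT ℝ m) (N : ℕ) (hN : m ≤ N) :
      ∑ k ∈ Finset.range m, (exp (-jacobiEig α β k * t) * h.coef k f) • p k =
      ∑ k ∈ Finset.range N, (exp (-jacobiEig α β k * t) * h.coef k f) • p k := by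
    refine Finset.sum_subset (Finset.range_mono hN) fun k _ hk => ?_
    rw [h.coef_eq_zero hm (by simpa using hk), mul_zero, zero_smul]
  rw [heat, key _ (mem_degreeLT_succ f) _ (le_max_left _ n), key n hf _ (le_max_right _ n)]

lemma coef_sum (h : JacobiSystem α β p) (a : ℕ → ℝ) (n k : ℕ) :
    h.coef k (∑ l ∈ Finset.range n, a l • p l) = if k < n then a k else 0 := by
  simp only [map_sum, map_smul, coef_self, smul_eq_mul, mul_ite, mul_one, mul_zero,
      Finset.sum_ite_eq', Finset.mem_range]

lemma coef_heat (h : JacobiSystem α β p) (t : ℝ) (f : ℝ[X]) (k : ℕ) :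
    h.coef k (h.heat t f) = exp (-jacobiEig α β k * t) * h.coef k f := by
  rw [heat, h.coef_sum]
  split_ifs with hk
  · rfl
  · rw [h.coef_eq_zero (mem_degreeLT_succ f) (not_lt.1 hk), mul_zero]

lemma heat_sub (h : JacobiSystem α β p) (t : ℝ) (f g : ℝ[X]) :
    h.heat t (f - g) = h.heat t f - h.heat t g :=
  h.ext_coef fun k => by simp [coef_heat, mul_sub]

lemma heat_zero (h : JacobiSystem α β p) (f : ℝ[X]) : h.heat 0 f = f :=
  h.ext_coef fun k => by simp [coef_heat]

lemma heat_heat (h : JacobiSystem α β p) (s t : ℝ) (f : ℝ[X]) :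
    h.heat s (h.heat t f) = h.heat (s + t) f :=
  h.ext_coef fun k => by rw [coef_heat, coef_heat, coef_heat, mul_add, exp_add, mul_assoc]

lemma jacobiOp_heat (h : JacobiSystem α β p) (t : ℝ) (f : ℝ[X]) :
    jacobiOp α β (h.heat t f) = h.heat t (jacobiOp α β f) :=
  h.ext_coef fun k => by simp only [coef_heat, coef_jacobiOp]; ring

lemma heat_C (h : JacobiSystem α β p) (t c : ℝ) : h.heat t (C c) = C c := by
  have hc (k : ℕ) (hk : 1 ≤ k) : h.coef k (C c) = 0 :=
    h.coef_eq_zero (n := 1) (by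
      simpa using mem_degreeLT_succ (C c)) hk
  refine h.ext_coef fun k => ?_
  rw [coef_heat]
  rcases Nat.eq_zero_or_pos k with rfl | hk
  · simp [jacobiEig]
  · rw [hc k hk, mul_zero]

lemma heat_mem_degreeLT (h : JacobiSystem α β p) (t : ℝ) {n : ℕ} {f : ℝ[X]}
    (hf : f ∈ degreeLT ℝ n) : h.heat t f ∈ degreeLT ℝ n := by
  rw [h.heat_eq_sum t hf]
  exact Submodule.sum_mem _ fun k hk =>
    Submodule.smul_mem _ _ (h.mem_degreeLT (Finset.mem_range.1 hk))

lemma jacobiOp_mem_degreeLT (h : JacobiSystem α β p) {n : ℕ} {f : ℝ[X]}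
    (hf : f ∈ degreeLT ℝ n) : jacobiOp α β f ∈ degreeLT ℝ n := by
  rw [h.eq_sum_coef hf, map_sum]
  refine Submodule.sum_mem _ fun k hk => ?_
  rw [map_smul, h.jacobiOp_self]
  exact Submodule.smul_mem _ _
    (Submodule.smul_mem _ _ (h.mem_degreeLT (Finset.mem_range.1 hk)))

lemma hasDerivAt_linear_heat (h : JacobiSystem α β p) (A : ℝ[X] →ₗ[ℝ] ℝ) (t : ℝ) (f : ℝ[X]) :
    HasDerivAt (fun s => A (h.heat s f)) (A (h.heat t (jacobiOp α β f))) t := by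
  have hf := mem_degreeLT_succ f
  simp only [h.heat_eq_sum _ hf, h.heat_eq_sum _ (h.jacobiOp_mem_degreeLT hf), map_sum, map_smul,
    smul_eq_mul]
  refine HasDerivAt.fun_sum fun k _ => ?_
  rw [coef_jacobiOp]
  have := ((((hasDerivAt_id t).const_mul (-jacobiEig α β k)).exp).mul_const
    (h.coef k f)).mul_const (A (p k))
  refine this.congr_deriv ?_
  simp only [id]; ring

lemma hasDerivAt_eval_heat (h : JacobiSystem α β p) (t x : ℝ) (f : ℝ[X]) :
    HasDerivAt (fun s => (h.heat s f).eval x) ((h.heat t (jacobiOp α β f)).eval x) t :=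
  h.hasDerivAt_linear_heat (Polynomial.leval x) t f

lemma hasDerivAt_bilin_heat (h : JacobiSystem α β p) (B : ℝ[X] →ₗ[ℝ] ℝ[X] →ₗ[ℝ] ℝ) (t : ℝ)
    (f : ℝ[X]) :
    HasDerivAt (fun s => B (h.heat s f) (h.heat s f))
      (B (h.heat t (jacobiOp α β f)) (h.heat t f) +
        B (h.heat t f) (h.heat t (jacobiOp α β f))) t := by
  have hf := mem_degreeLT_succ f
  have e (g₁ g₂ : ℝ[X]) (s s' : ℝ) (hg₁ : g₁ ∈ degreeLT ℝ (f.natDegree + 1)) :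
      B (h.heat s g₁) (h.heat s' g₂) = ∑ k ∈ Finset.range (f.natDegree + 1),
        (exp (-jacobiEig α β k * s) * h.coef k g₁) * B (p k) (h.heat s' g₂) := by
    rw [h.heat_eq_sum s hg₁, map_sum, LinearMap.sum_apply]
    simp only [map_smul, LinearMap.smul_apply, smul_eq_mul]
  simp only [e f f _ _ hf, e _ _ _ _ (h.jacobiOp_mem_degreeLT hf),
    e f (jacobiOp α β f) _ _ hf]
  rw [← Finset.sum_add_distrib]
  refine HasDerivAt.fun_sum fun k _ => ?_
  have := ((((hasDerivAt_id t).const_mul (-jacobiEig α β k)).exp).mul_const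
    (h.coef k f)).mul (h.hasDerivAt_linear_heat (B (p k)) t f)
  refine this.congr_deriv ?_
  rw [coef_jacobiOp]
  simp only [id]; ring

end JacobiSystem

lemma deriv_mul_sub_nonneg_of_isMinOn {g : ℝ → ℝ} {a b x d : ℝ} (hg : HasDerivAt g d x)
    (hx : x ∈ Icc a b) (hmin : ∀ y ∈ Icc a b, g x ≤ g y) {y : ℝ} (hy : y ∈ Icc a b) :
    0 ≤ d * (y - x) := by
  have h1 : IsLocalMinOn g (Icc a b) x := IsMinOn.localize hmin
  have h2 := sub_mem_posTangentConeAt_of_segment_subset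
    ((convex_Icc a b).segment_subset hx hy)
  have := h1.hasFDerivWithinAt_nonneg hg.hasFDerivAt.hasFDerivWithinAt h2
  simpa [mul_comm] using this

lemma eval_derivative_derivative_nonneg_of_isMinOn {f : ℝ[X]} {a b x : ℝ} (hx : x ∈ Ioo a b)
    (hmin : ∀ y ∈ Icc a b, f.eval x ≤ f.eval y) :
    (derivative f).eval x = 0 ∧ 0 ≤ (derivative (derivative f)).eval x := by
  have hloc : IsLocalMin (fun y => f.eval y) x := by
    filter_upwards [Icc_mem_nhds hx.1 hx.2] with y hy using hmin y hy
  have h1 : (derivative f).eval x = 0 := by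
    simpa using hloc.deriv_eq_zero
  refine ⟨h1, ?_⟩
  by_contra! hneg
  have hd : deriv (fun y => f.eval y) = fun y => (derivative f).eval y := by
    ext y; simp
  have hmax : IsLocalMax (fun y => f.eval y) x := by
    refine isLocalMax_of_deriv_deriv_neg ?_ ?_ f.continuous.continuousAt
    · rw [hd]; simpa using hneg
    · rw [hd]; exact h1
  have hc : (fun y => f.eval y) =ᶠ[nhds x] fun _ => f.eval x := by
    filter_upwards [hloc, hmax] with y h1 h2 using le_antisymm h2 h1
  have hc' := hc.deriv.deriv_eq
  rw [hd] at hc'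
  simp at hc'
  exact hneg.ne hc'

/-- The Jacobi operator satisfies the minimum principle on `[-1, 1]`, endpoints included. -/
lemma eval_jacobiOp_nonneg_of_isMinOn {α β : ℝ} (hα : -1 < α) (hβ : -1 < β) {f : ℝ[X]} {x : ℝ}
    (hx : x ∈ Icc (-1 : ℝ) 1) (hmin : ∀ y ∈ Icc (-1 : ℝ) 1, f.eval x ≤ f.eval y) :
    0 ≤ (jacobiOp α β f).eval x := by
  have hs {y : ℝ} (hy : y ∈ Icc (-1 : ℝ) 1) := deriv_mul_sub_nonneg_of_isMinOn
    (Polynomial.hasDerivAt f x) hx hmin hy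
  rw [eval_jacobiOp]
  rcases hx.1.eq_or_lt with rfl | h1
  · have := hs (y := 1) (by simp)
    nlinarith
  rcases hx.2.eq_or_lt with rfl | h2
  · have := hs (y := -1) (by simp)
    nlinarith
  · obtain ⟨e1, e2⟩ := eval_derivative_derivative_nonneg_of_isMinOn ⟨h1, h2⟩ hmin
    rw [e1, mul_zero, add_zero]
    exact mul_nonneg (by nlinarith) e2

/-- The exponential weight `exp (-κ arccos x)`. -/
def expWeight (κ x : ℝ) : ℝ := exp (-κ * arccos x)

lemma continuous_expWeight (κ : ℝ) : Continuous (expWeight κ) :=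
  continuous_exp.comp (continuous_const.mul continuous_arccos)

lemma expWeight_pos (κ x : ℝ) : 0 < expWeight κ x := exp_pos _

lemma hasDerivAt_expWeight (κ : ℝ) {x : ℝ} (hx : x ∈ Ioo (-1 : ℝ) 1) :
    HasDerivAt (expWeight κ) (κ * √(1 - x ^ 2) * expWeight κ x / (1 - x ^ 2)) x := by
  have := ((hasDerivAt_arccos hx.1.ne' hx.2.ne).const_mul (-κ)).exp
  refine this.congr_deriv ?_
  have h0 : 0 < 1 - x ^ 2 := by nlinarith [hx.1, hx.2]
  have h1 : √(1 - x ^ 2) ≠ 0 := (sqrt_pos.2 h0).ne'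
  rw [expWeight]
  have h2 := sq_sqrt h0.le
  set s := √(1 - x ^ 2)
  rw [← h2]
  field_simp

section Energy

variable {α β : ℝ}

lemma integral_mul_jacobiOp_mul_expWeight (hα : -1 < α) (hβ : -1 < β) (κ : ℝ) (f g : ℝ[X]) :
    ∫ x, g.eval x * (jacobiOp α β f).eval x * expWeight κ x ∂(jacobiMeasure α β) =
      -∫ x, (derivative f).eval x * ((1 - x ^ 2) * (derivative g).eval x * expWeight κ x +
        κ * √(1 - x ^ 2) * g.eval x * expWeight κ x) ∂(jacobiMeasure α β) := by
  have hw := continuous_expWeight κ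
  rw [← integral_mul_jacobiOp hα hβ f (h := fun x => g.eval x * expWeight κ x)
    (by fun_prop) (by fun_prop)]
  · congr 1; ext x; ring
  · intro x hx
    refine ((Polynomial.hasDerivAt g x).mul (hasDerivAt_expWeight κ hx)).congr_deriv ?_
    have : (1 - x ^ 2) ≠ 0 := by nlinarith [hx.1, hx.2]
    field_simp

lemma energy_inequality (hα : -1 < α) (hβ : -1 < β) (κ : ℝ) (f : ℝ[X]) :
    2 * ∫ x, f.eval x * (jacobiOp α β f).eval x * expWeight κ x ∂(jacobiMeasure α β) ≤
      -(∫ x, (derivative f).eval x * (derivative f).eval x * ((1 - x ^ 2) * expWeight κ x)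
        ∂(jacobiMeasure α β)) +
      κ ^ 2 * ∫ x, f.eval x * f.eval x * expWeight κ x ∂(jacobiMeasure α β) := by
  have hw := continuous_expWeight κ
  rw [integral_mul_jacobiOp_mul_expWeight hα hβ, ← integral_neg, ← integral_neg,
    ← integral_const_mul, ← integral_const_mul, ← integral_add
    (integrable_jacobiMeasure hα hβ (by fun_prop)) (integrable_jacobiMeasure hα hβ (by fun_prop))]
  refine integral_mono_ae (integrable_jacobiMeasure hα hβ (by fun_prop))
    (integrable_jacobiMeasure hα hβ (by fun_prop)) ?_
  filter_upwards [ae_jacobiMeasure_mem α β] with x hx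
  have h2 := sq_sqrt (show 0 ≤ 1 - x ^ 2 by nlinarith [hx.1, hx.2])
  set s := √(1 - x ^ 2)
  have := mul_nonneg (sq_nonneg (s * (derivative f).eval x + κ * f.eval x))
    (expWeight_pos κ x).le
  simp only [← h2]
  nlinarith

lemma energy_derivative_inequality (hα : -1 < α) (hβ : -1 < β) (κ : ℝ) (f : ℝ[X]) :
    2 * ∫ x, (derivative f).eval x * (derivative (jacobiOp α β f)).eval x *
        ((1 - x ^ 2) * expWeight κ x) ∂(jacobiMeasure α β) ≤
      -(∫ x, (jacobiOp α β f).eval x * (jacobiOp α β f).eval x * expWeight κ x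
        ∂(jacobiMeasure α β)) +
      κ ^ 2 * ∫ x, (derivative f).eval x * (derivative f).eval x *
        ((1 - x ^ 2) * expWeight κ x) ∂(jacobiMeasure α β) := by
  have hw := continuous_expWeight κ
  have key := integral_mul_jacobiOp_mul_expWeight hα hβ κ f (jacobiOp α β f)
  set g := jacobiOp α β f
  have : 2 * ∫ x, (derivative f).eval x * (derivative g).eval x *
        ((1 - x ^ 2) * expWeight κ x) ∂(jacobiMeasure α β) =
      -2 * (∫ x, g.eval x * g.eval x * expWeight κ x ∂(jacobiMeasure α β)) +
      ∫ x, -2 * κ * √(1 - x ^ 2) * (derivative f).eval x * g.eval x * expWeight κ x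
        ∂(jacobiMeasure α β) := by
    rw [key, ← integral_neg, ← integral_const_mul, ← integral_const_mul, ← integral_add
      (integrable_jacobiMeasure hα hβ (by fun_prop)) (integrable_jacobiMeasure hα hβ (by fun_prop))]
    congr 1; ext x; ring
  rw [this, ← integral_neg, ← integral_const_mul, ← integral_const_mul, ← integral_add
    (integrable_jacobiMeasure hα hβ (by fun_prop)) (integrable_jacobiMeasure hα hβ (by fun_prop)),
    ← integral_add
    (integrable_jacobiMeasure hα hβ (by fun_prop)) (integrable_jacobiMeasure hα hβ (by fun_prop))]
  refine integral_mono_ae (integrable_jacobiMeasure hα hβ (by fun_prop))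
    (integrable_jacobiMeasure hα hβ (by fun_prop)) ?_
  filter_upwards [ae_jacobiMeasure_mem α β] with x hx
  have h2 := sq_sqrt (show 0 ≤ 1 - x ^ 2 by nlinarith [hx.1, hx.2])
  set s := √(1 - x ^ 2)
  have := mul_nonneg (sq_nonneg (κ * s * (derivative f).eval x + g.eval x))
    (expWeight_pos κ x).le
  simp only [← h2]
  nlinarith

end Energy

namespace JacobiSystem

variable {α β : ℝ} {p : ℕ → ℝ[X]}

/-- The squared `L²` norm of a polynomial with respect to the exponential weight. -/
def expNormSq (α β κ : ℝ) (f : ℝ[X]) : ℝ :=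
  ∫ x, f.eval x * f.eval x * expWeight κ x ∂(jacobiMeasure α β)

lemma expNormSq_nonneg (α β κ : ℝ) (f : ℝ[X]) : 0 ≤ expNormSq α β κ f :=
  integral_nonneg fun x => mul_nonneg (mul_self_nonneg _) (expWeight_pos κ x).le

lemma expNormSq_heat_add_le (h : JacobiSystem α β p) (κ : ℝ) {t : ℝ} (ht : 0 ≤ t) (f : ℝ[X]) :
    expNormSq α β κ (h.heat t f) +
      t ^ 2 / 2 * expNormSq α β κ (h.heat t (jacobiOp α β f)) ≤
      exp (κ ^ 2 * t) * expNormSq α β κ f := by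
  have hw := continuous_expWeight κ
  have hw2 : ContinuousOn (fun x => (1 - x ^ 2) * expWeight κ x) (Icc (-1) 1) := by fun_prop
  set B := weightedForm h.left_gt h.right_gt hw.continuousOn with hB
  set B' := (weightedForm h.left_gt h.right_gt hw2).compl₁₂ derivative derivative with hB'
  have hE (g : ℝ[X]) : B g g = expNormSq α β κ g := rfl
  have hcomm (g₁ g₂ : ℝ[X]) : B g₁ g₂ = B g₂ g₁ := by
    simp only [hB, weightedForm_apply]; congr 1; ext x; ring
  have hcomm' (g₁ g₂ : ℝ[X]) : B' g₁ g₂ = B' g₂ g₁ := by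
    simp only [hB', LinearMap.compl₁₂_apply, weightedForm_apply]; congr 1; ext x; ring
  have i1 (g : ℝ[X]) : 2 * B g (jacobiOp α β g) ≤ -B' g g + κ ^ 2 * B g g :=
    energy_inequality h.left_gt h.right_gt κ g
  have i2 (g : ℝ[X]) : 2 * B' g (jacobiOp α β g) ≤
      -B (jacobiOp α β g) (jacobiOp α β g) + κ ^ 2 * B' g g :=
    energy_derivative_inequality h.left_gt h.right_gt κ g
  have hB'0 (g : ℝ[X]) : 0 ≤ B' g g := by
    refine integral_nonneg_of_ae ?_
    filter_upwards [ae_jacobiMeasure_mem α β] with x hx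
    exact mul_nonneg (mul_self_nonneg _)
      (mul_nonneg (by nlinarith [hx.1, hx.2]) (expWeight_pos κ x).le)
  set L := jacobiOp α β with hL
  set G : ℝ → ℝ := fun s => exp (-κ ^ 2 * s) * (B (h.heat s f) (h.heat s f) +
    s * B' (h.heat s f) (h.heat s f) + s ^ 2 / 2 * B (h.heat s (L f)) (h.heat s (L f))) with hG
  have hder (s : ℝ) : ∃ d, HasDerivAt G d s ∧ (0 ≤ s → d ≤ 0) := by
    refine ⟨_, (((hasDerivAt_id s).const_mul (-κ ^ 2)).exp).mul
      (((h.hasDerivAt_bilin_heat B s f).add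
        ((hasDerivAt_id s).mul (h.hasDerivAt_bilin_heat B' s f))).add
        ((((hasDerivAt_id s).pow 2).div_const 2).mul (h.hasDerivAt_bilin_heat B s (L f)))),
      fun hs => ?_⟩
    have j1 := i1 (h.heat s f)
    have j2 := i2 (h.heat s f)
    have j3 := i1 (h.heat s (L f))
    have j4 := hB'0 (h.heat s (L f))
    rw [h.jacobiOp_heat] at j1 j2 j3
    simp only [id, hcomm _ (h.heat s f), hcomm' _ (h.heat s f),
      hcomm (h.heat s (jacobiOp α β (L f)))]
    have hexp := exp_pos (-κ ^ 2 * s)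
    set e := exp (-κ ^ 2 * s)
    set b1 := B (h.heat s f) (h.heat s f)
    set b2 := B (h.heat s f) (h.heat s (L f))
    set b3 := B' (h.heat s f) (h.heat s f)
    set b4 := B' (h.heat s f) (h.heat s (L f))
    set b5 := B (h.heat s (L f)) (h.heat s (L f))
    set b6 := B (h.heat s (L f)) (h.heat s (L (L f)))
    have k : -κ ^ 2 * (b1 + s * b3 + s ^ 2 / 2 * b5) +
      (2 * b2 + b3 + s * (2 * b4) + s * b5 + s ^ 2 / 2 * (2 * b6)) ≤ 0 := by
      have m2 := mul_le_mul_of_nonneg_left j2 hs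
      have m3 := mul_le_mul_of_nonneg_left j3 (by positivity : 0 ≤ s ^ 2 / 2)
      have m4 := mul_nonneg (by positivity : 0 ≤ s ^ 2 / 2) j4
      nlinarith
    have := mul_nonpos_of_nonneg_of_nonpos hexp.le k
    norm_num
    nlinarith
  have hanti : AntitoneOn G (Ici 0) := by
    refine antitoneOn_of_deriv_nonpos (convex_Ici 0)
      (fun s _ => (hder s).choose_spec.1.continuousAt.continuousWithinAt)
      (fun s _ => (hder s).choose_spec.1.differentiableAt.differentiableWithinAt) fun s hs => ?_
    rw [interior_Ici] at hs
    rw [(hder s).choose_spec.1.deriv]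
    exact (hder s).choose_spec.2 hs.le
  have hfin := hanti (mem_Ici.2 le_rfl) (mem_Ici.2 ht) ht
  simp only [hG, h.heat_zero, mul_zero, exp_zero, zero_mul, add_zero, one_mul, hE] at hfin
  norm_num at hfin
  have h3 := mul_le_mul_of_nonneg_left hfin (exp_pos (κ ^ 2 * t)).le
  rw [← mul_assoc, ← exp_add, add_neg_cancel, exp_zero, one_mul] at h3
  have := mul_nonneg ht (hB'0 (h.heat t f))
  linarith

lemma expNormSq_heat_le (h : JacobiSystem α β p) (κ : ℝ) {t : ℝ} (ht : 0 ≤ t) (f : ℝ[X]) :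
    expNormSq α β κ (h.heat t f) ≤ exp (κ ^ 2 * t) * expNormSq α β κ f := by
  have h1 := h.expNormSq_heat_add_le κ ht f
  have := mul_nonneg (by positivity : 0 ≤ t ^ 2 / 2)
    (expNormSq_nonneg α β κ (h.heat t (jacobiOp α β f)))
  linarith

lemma expNormSq_jacobiOp_heat_le (h : JacobiSystem α β p) (κ : ℝ) {t : ℝ} (ht : 0 < t)
    (f : ℝ[X]) : expNormSq α β κ (h.heat t (jacobiOp α β f)) ≤
      2 / t ^ 2 * exp (κ ^ 2 * t) * expNormSq α β κ f := by
  have h1 := h.expNormSq_heat_add_le κ ht.le f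
  have h2 := expNormSq_nonneg α β κ (h.heat t f)
  rw [div_mul_eq_mul_div, div_mul_eq_mul_div, le_div_iff₀ (by positivity)]
  linarith

/-- The heat semigroup preserves positivity on `[-1, 1]`. -/
lemma heat_nonneg (h : JacobiSystem α β p) {f : ℝ[X]} (hf : ∀ x ∈ Icc (-1 : ℝ) 1, 0 ≤ f.eval x)
    {t x : ℝ} (ht : 0 ≤ t) (hx : x ∈ Icc (-1 : ℝ) 1) : 0 ≤ (h.heat t f).eval x := by
  by_contra! hneg
  set ε := -(h.heat t f).eval x / (2 * (t + 1)) with hε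
  have hε0 : 0 < ε := div_pos (by linarith) (by linarith)
  have hcont : Continuous fun q : ℝ × ℝ => (h.heat q.1 f).eval q.2 + ε * q.1 := by
    simp only [heat, eval_finsetSum, eval_smul]
    have (k : ℕ) : Continuous fun q : ℝ × ℝ => (p k).eval q.2 :=
      (p k).continuous.comp continuous_snd
    fun_prop
  obtain ⟨⟨s, y⟩, ⟨hs, hy⟩, hmin⟩ := (isCompact_Icc.prod isCompact_Icc).exists_isMinOn
    (s := Icc 0 t ×ˢ Icc (-1 : ℝ) 1) ⟨(t, x), ⟨⟨ht, le_rfl⟩, hx⟩⟩ hcont.continuousOn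
  have hm {s' y' : ℝ} (hs' : s' ∈ Icc 0 t) (hy' : y' ∈ Icc (-1 : ℝ) 1) :
    (h.heat s f).eval y + ε * s ≤ (h.heat s' f).eval y' + ε * s' :=
    (isMinOn_iff.1 hmin) (s', y') ⟨hs', hy'⟩
  have hval : (h.heat t f).eval x + ε * t < 0 := by
    have : ε * (2 * (t + 1)) = -(h.heat t f).eval x := div_mul_cancel₀ _ (by linarith)
    nlinarith
  have hs0 : 0 < s := by
    refine hs.1.lt_of_ne ?_
    rintro rfl
    have h1 := hm ⟨ht, le_rfl⟩ hx
    have h2 := hf y hy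
    rw [h.heat_zero] at h1
    linarith
  have h1 := deriv_mul_sub_nonneg_of_isMinOn
    ((h.hasDerivAt_eval_heat s y f).add ((hasDerivAt_id s).const_mul ε)) hs
    (fun s' hs' => by simpa using hm hs' hy) (y := 0) ⟨le_rfl, ht⟩
  have h2 := eval_jacobiOp_nonneg_of_isMinOn h.left_gt h.right_gt hy (f := h.heat s f)
    (fun y' hy' => by simpa using hm hs hy')
  rw [h.jacobiOp_heat] at h2
  nlinarith

lemma heat_mono (h : JacobiSystem α β p) {f g : ℝ[X]}
    (hfg : ∀ x ∈ Icc (-1 : ℝ) 1, f.eval x ≤ g.eval x) {t x : ℝ} (ht : 0 ≤ t)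
    (hx : x ∈ Icc (-1 : ℝ) 1) : (h.heat t f).eval x ≤ (h.heat t g).eval x := by
  have := h.heat_nonneg (f := g - f) (fun y hy => by simpa using hfg y hy) ht hx
  rwa [h.heat_sub, eval_sub, sub_nonneg] at this

end JacobiSystem

section Gradient

lemma abs_jacobiFlux_le {α β G x : ℝ} (hα : -1 < α) (hβ : -1 < β) (f : ℝ[X])
    (hx : x ∈ Icc (0 : ℝ) 1) (hG : ∀ s ∈ Icc x 1, |(jacobiOp α β f).eval s| ≤ G) :
    |jacobiFlux α β f x| ≤ 2 ^ |β| / (α + 1) * G * (1 - x) ^ (α + 1) := by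
  have hα' : 0 < α + 1 := by linarith
  have main (σ : ℝ) (hσ : |σ| = 1) :
      0 ≤ 2 ^ |β| / (α + 1) * G * (1 - x) ^ (α + 1) + σ * jacobiFlux α β f x := by
    set H : ℝ → ℝ := fun s =>
      2 ^ |β| / (α + 1) * G * (1 - s) ^ (α + 1) + σ * jacobiFlux α β f s with hH
    have hder (s : ℝ) (hs : s ∈ Ioo x 1) : HasDerivAt H (2 ^ |β| / (α + 1) * G *
        (-1 * (α + 1) * (1 - s) ^ (α + 1 - 1)) +
        σ * (jacobiWeight α β s * (jacobiOp α β f).eval s)) s := by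
      have h1 : (0 : ℝ) < 1 - s := by linarith [hs.2]
      exact ((((hasDerivAt_id s).const_sub 1).rpow_const (p := α + 1)
        (Or.inl h1.ne')).const_mul _).add
        ((hasDerivAt_jacobiFlux α β f ⟨by linarith [hs.1, hx.1], hs.2⟩).const_mul σ)
    have hanti : AntitoneOn H (Icc x 1) := by
      refine antitoneOn_of_deriv_nonpos (convex_Icc x 1) ?_ ?_ fun s hs => ?_
      · exact ((continuous_const.mul ((continuous_const.sub continuous_id).rpow_const
          fun _ => Or.inr hα'.le)).add (continuous_const.mul
            (continuous_jacobiFlux hα hβ f))).continuousOn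
      · rw [interior_Icc]
        exact fun s hs => (hder s hs).differentiableAt.differentiableWithinAt
      · rw [interior_Icc] at hs
        rw [(hder s hs).deriv]
        have h1 : (0 : ℝ) < 1 - s := by linarith [hs.2]
        have h2 := jacobiWeight_le_of_nonneg (α := α) (β := β) (x := s)
          ⟨by linarith [hs.1, hx.1], hs.2.le⟩
        have h3 : σ * (jacobiWeight α β s * (jacobiOp α β f).eval s) ≤
            2 ^ |β| * (1 - s) ^ α * G := by
          refine (le_abs_self _).trans ?_
          rw [abs_mul, hσ, one_mul, abs_mul, abs_of_nonneg (jacobiWeight_nonneg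
            ⟨by linarith [hs.1, hx.1], hs.2.le⟩)]
          exact mul_le_mul h2 (hG s ⟨hs.1.le, hs.2.le⟩) (abs_nonneg _) (by positivity)
        have h4 : 2 ^ |β| / (α + 1) * G * (-1 * (α + 1) * (1 - s) ^ (α + 1 - 1)) =
            -(2 ^ |β| * (1 - s) ^ α * G) := by
          rw [add_sub_cancel_right]; field_simp
        rw [h4]; linarith
    have := hanti ⟨le_rfl, hx.2⟩ ⟨hx.2, le_rfl⟩ hx.2
    simpa [hH, jacobiFlux_one β hα f, zero_rpow hα'.ne'] using this
  have h1 := main 1 (by simp)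
  have h2 := main (-1) (by simp)
  rw [abs_le]
  constructor <;> linarith

lemma abs_eval_derivative_le {α β G x : ℝ} (hα : -1 < α) (hβ : -1 < β) (f : ℝ[X])
    (hx : x ∈ Ico (0 : ℝ) 1) (hG : ∀ s ∈ Icc x 1, |(jacobiOp α β f).eval s| ≤ G) :
    |(derivative f).eval x| ≤ 2 ^ |β| / (α + 1) * G := by
  have h1 := abs_jacobiFlux_le hα hβ f ⟨hx.1, hx.2.le⟩ hG
  have hpos : (0 : ℝ) < (1 - x) ^ (α + 1) := rpow_pos_of_pos (by linarith [hx.2]) _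
  refine le_of_mul_le_mul_right (le_trans ?_ h1) hpos
  unfold jacobiFlux jacobiWeight
  have h2 : (1 : ℝ) ≤ (1 + x) ^ (β + 1) := one_le_rpow (by linarith [hx.1]) (by linarith)
  rw [abs_mul, abs_mul, abs_of_pos hpos, abs_of_pos (one_pos.trans_le h2)]
  nlinarith [mul_nonneg (sub_nonneg.2 h2) (mul_nonneg hpos.le
    (abs_nonneg ((derivative f).eval x)))]

/-- The density of the Jacobi measure in the angular variable. -/
def angularWeight (α β θ : ℝ) : ℝ := sin θ * jacobiWeight α β (cos θ)

lemma cos_mem_Ioo {θ : ℝ} (hθ : θ ∈ Ioo 0 π) : cos θ ∈ Ioo (-1 : ℝ) 1 := by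
  constructor
  · rw [← cos_pi]; exact cos_lt_cos_of_nonneg_of_le_pi hθ.1.le le_rfl hθ.2
  · rw [← cos_zero]; exact cos_lt_cos_of_nonneg_of_le_pi le_rfl hθ.2.le hθ.1

lemma angularWeight_pos (α β : ℝ) {θ : ℝ} (hθ : θ ∈ Ioo 0 π) : 0 < angularWeight α β θ := by
  have h := cos_mem_Ioo hθ
  exact mul_pos (sin_pos_of_pos_of_lt_pi hθ.1 hθ.2)
    (mul_pos (rpow_pos_of_pos (by linarith [h.2]) _) (rpow_pos_of_pos (by linarith [h.1]) _))

lemma rpow_le_mul_rpow {c u v : ℝ} (a : ℝ) (hc : 1 ≤ c) (hv : 0 < v) (h1 : v ≤ c * u)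
    (h2 : u ≤ c * v) : u ^ a ≤ c ^ |a| * v ^ a := by
  have hc0 : 0 < c := by linarith
  have hu : 0 < u := by
    by_contra! hu
    nlinarith
  have := rpow_le_rpow_abs a hc (s := u / v) (by rw [le_div_iff₀ hv, inv_mul_le_iff₀ hc0]; exact h1)
    (by rwa [div_le_iff₀ hv])
  rwa [div_rpow hu.le hv.le, div_le_iff₀ (rpow_pos_of_pos hv a)] at this

lemma one_sub_cos_le_four_mul {s θ : ℝ} (hs : θ / 2 ≤ s) (hθ : 0 ≤ θ) (hsθ : s ≤ π) :
    1 - cos θ ≤ 4 * (1 - cos s) := by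
  have h1 : cos s ≤ cos (θ / 2) := cos_le_cos_of_nonneg_of_le_pi (by linarith) hsθ hs
  have h2 : cos θ = 2 * cos (θ / 2) ^ 2 - 1 := by rw [← cos_two_mul]; ring_nf
  have := cos_le_one (θ / 2)
  nlinarith [neg_one_le_cos (θ / 2)]

lemma angularWeight_le_mul (α β : ℝ) {s θ : ℝ} (hθ : θ ∈ Ioc 0 (π / 2)) (hs : s ∈ Icc (θ / 2) θ) :
    angularWeight α β s ≤ 4 ^ |α| * 2 ^ |β| * angularWeight α β θ := by
  have hpi := pi_pos
  have hc := cos_mem_Ioo (θ := θ) ⟨hθ.1, by linarith [hθ.2]⟩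
  have hcs := cos_mem_Ioo (θ := s) ⟨by linarith [hθ.1, hs.1], by linarith [hθ.2, hs.2]⟩
  have h0 : 0 ≤ sin s := sin_nonneg_of_nonneg_of_le_pi (by linarith [hθ.1, hs.1])
    (by linarith [hθ.2, hs.2])
  have h1 : sin s ≤ sin θ := sin_le_sin_of_le_of_le_pi_div_two (by linarith [hθ.1, hs.1]) hθ.2 hs.2
  have h2 : cos θ ≤ cos s := cos_le_cos_of_nonneg_of_le_pi (by linarith [hθ.1, hs.1])
    (by linarith [hθ.2]) hs.2
  have h3 : 0 ≤ cos θ := cos_nonneg_of_mem_Icc ⟨by linarith [hθ.1], hθ.2⟩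
  have e1 := rpow_le_mul_rpow (c := 4) (u := 1 - cos s) (v := 1 - cos θ) α (by norm_num)
    (by linarith [hc.2]) (one_sub_cos_le_four_mul hs.1 hθ.1.le (by linarith [hθ.2, hs.2]))
    (by linarith [hc.2])
  have e2 := rpow_le_mul_rpow (c := 2) (u := 1 + cos s) (v := 1 + cos θ) β (by norm_num)
    (by linarith) (by linarith) (by linarith [hcs.2])
  have p1 : 0 ≤ (1 + cos s) ^ β := rpow_nonneg (by linarith) _
  have p2 : 0 ≤ (1 - cos θ) ^ α := rpow_nonneg (by linarith [hc.2]) _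
  have p3 : 0 ≤ (1 - cos s) ^ α := rpow_nonneg (by linarith [hcs.2]) _
  unfold angularWeight jacobiWeight
  calc _ ≤ sin θ * ((4 ^ |α| * (1 - cos θ) ^ α) * (2 ^ |β| * (1 + cos θ) ^ β)) :=
        mul_le_mul h1 (mul_le_mul e1 e2 p1 (by positivity)) (by positivity) (h0.trans h1)
    _ = _ := by ring

lemma jacobiFlux_cos (α β : ℝ) (f : ℝ[X]) {θ : ℝ} (hθ : θ ∈ Ioo 0 π) :
    jacobiFlux α β f (cos θ) =
      angularWeight α β θ * (sin θ * (derivative f).eval (cos θ)) := by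
  unfold jacobiFlux angularWeight
  rw [jacobiWeight_add_one (cos_mem_Ioo hθ), ← sin_sq]
  ring

lemma hasDerivAt_jacobiFlux_cos (α β : ℝ) (f : ℝ[X]) {θ : ℝ} (hθ : θ ∈ Ioo 0 π) :
    HasDerivAt (fun s => jacobiFlux α β f (cos s))
      (-(angularWeight α β θ * (jacobiOp α β f).eval (cos θ))) θ := by
  refine ((hasDerivAt_jacobiFlux α β f (cos_mem_Ioo hθ)).comp θ (hasDerivAt_cos θ)).congr_deriv ?_
  unfold angularWeight; ring

lemma hasDerivAt_eval_cos (f : ℝ[X]) (θ : ℝ) :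
    HasDerivAt (fun s => f.eval (cos s)) (-(sin θ * (derivative f).eval (cos θ))) θ := by
  refine ((f.hasDerivAt (cos θ)).comp θ (hasDerivAt_cos θ)).congr_deriv ?_
  ring

lemma abs_sin_mul_derivative_le {α β A G R θ : ℝ} (f : ℝ[X]) (hR : 0 < R)
    (hRθ : R < θ) (hθ : θ ≤ π / 2)
    (hA : ∀ φ ∈ Icc 0 π, |φ - θ| ≤ R → |f.eval (cos φ)| ≤ A)
    (hG : ∀ φ ∈ Icc 0 π, |φ - θ| ≤ R → |(jacobiOp α β f).eval (cos φ)| ≤ G) :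
    |sin θ * (derivative f).eval (cos θ)| ≤ 4 ^ |α| * 2 ^ |β| * (4 * A / R + R * G) := by
  have hpi := pi_pos
  have hθ0 : 0 < θ := hR.trans hRθ
  have habs {φ : ℝ} (h1 : θ - R / 2 ≤ φ) (h2 : φ ≤ θ) : |φ - θ| ≤ R :=
    abs_le.2 ⟨by linarith, by linarith⟩
  obtain ⟨s, hs, hds⟩ := exists_hasDerivAt_eq_slope (fun s => f.eval (cos s))
    (fun θ => -(sin θ * (derivative f).eval (cos θ))) (a := θ - R / 2) (b := θ) (by linarith)
    (by fun_prop) (fun s _ => hasDerivAt_eval_cos f s)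
  have hsl : |sin s * (derivative f).eval (cos s)| ≤ 4 * A / R := by
    rw [← abs_neg, hds, abs_div, abs_of_pos (by linarith : 0 < θ - (θ - R / 2)),
      div_le_div_iff₀ (by linarith) hR]
    have a1 := hA θ ⟨hθ0.le, by linarith⟩ (by simpa using hR.le)
    have a2 := hA (θ - R / 2) ⟨by linarith, by linarith⟩ (habs le_rfl (by linarith))
    have := abs_sub (f.eval (cos θ)) (f.eval (cos (θ - R / 2)))
    nlinarith
  have hw := angularWeight_pos α β (θ := θ) ⟨hθ0, by linarith⟩
  set K : ℝ := 4 ^ |α| * 2 ^ |β| with hK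
  have hK0 : 0 < K := by positivity
  have hG0 : 0 ≤ G := (abs_nonneg _).trans (hG θ ⟨hθ0.le, by linarith⟩ (by simpa using hR.le))
  have hmem {φ : ℝ} (h : φ ∈ Icc s θ) : φ ∈ Ioo 0 π ∧ φ ∈ Icc (θ / 2) θ :=
    ⟨⟨by linarith [h.1, hs.1], by linarith [h.2]⟩, by linarith [h.1, hs.1], h.2⟩
  have hdiff := (convex_Icc s θ).norm_image_sub_le_of_norm_hasDerivWithin_le
    (f := fun s => jacobiFlux α β f (cos s)) (C := K * angularWeight α β θ * G)
    (fun φ hφ => (hasDerivAt_jacobiFlux_cos α β f (hmem hφ).1).hasDerivWithinAt)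
    (fun φ hφ => by
      rw [norm_neg, norm_mul, norm_eq_abs, norm_eq_abs,
        abs_of_pos (angularWeight_pos α β (hmem hφ).1)]
      exact mul_le_mul (angularWeight_le_mul α β ⟨hθ0, hθ⟩ (hmem hφ).2)
        (hG φ ⟨(hmem hφ).1.1.le, (hmem hφ).1.2.le⟩ (habs (by linarith [hφ.1, hs.1]) hφ.2))
        (abs_nonneg _) (by positivity))
    (x := s) (y := θ) ⟨le_rfl, hs.2.le⟩ ⟨hs.2.le, le_rfl⟩
  have hs0 := (hmem (φ := s) ⟨le_rfl, hs.2.le⟩)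
  simp only [jacobiFlux_cos α β f hs0.1, jacobiFlux_cos α β f (θ := θ) ⟨hθ0, by linarith⟩,
    norm_eq_abs] at hdiff
  rw [abs_of_pos (by linarith [hs.2] : 0 < θ - s)] at hdiff
  have hws := angularWeight_le_mul α β ⟨hθ0, hθ⟩ hs0.2
  have t1 : angularWeight α β s * |sin s * (derivative f).eval (cos s)| ≤
      K * angularWeight α β θ * (4 * A / R) :=
    mul_le_mul hws hsl (abs_nonneg _) (by positivity)
  have t2 := abs_sub_abs_le_abs_sub
    (angularWeight α β θ * (sin θ * (derivative f).eval (cos θ)))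
    (angularWeight α β s * (sin s * (derivative f).eval (cos s)))
  rw [abs_mul, abs_of_pos hw, abs_mul (angularWeight α β s),
    abs_of_pos (angularWeight_pos α β hs0.1)] at t2
  have t3 : K * angularWeight α β θ * G * (θ - s) ≤ K * angularWeight α β θ * G * R :=
    mul_le_mul_of_nonneg_left (by linarith [hs.1]) (by positivity)
  refine le_of_mul_le_mul_left ?_ hw
  nlinarith

lemma jacobiOp_comp_neg (α β : ℝ) (f : ℝ[X]) :
    jacobiOp β α (f.comp (-X)) = (jacobiOp α β f).comp (-X) := by
  simp only [jacobiOp_apply, derivative_comp, derivative_neg, derivative_X, derivative_mul,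
    mul_comp, add_comp, sub_comp, one_comp, X_comp, C_comp, pow_comp, derivative_one]
  simp only [map_sub, map_add, map_ofNat]
  ring

/-- Interior gradient estimate for the Jacobi operator. -/
lemma exists_gradient_bound {α β : ℝ} (hα : -1 < α) (hβ : -1 < β) :
    ∃ K > 0, ∀ (f : ℝ[X]) (A G R θ : ℝ), 0 < R → θ ∈ Icc 0 π →
      (∀ φ ∈ Icc 0 π, |φ - θ| ≤ R → |f.eval (cos φ)| ≤ A) →
      (∀ φ ∈ Icc 0 π, |φ - θ| ≤ R → |(jacobiOp α β f).eval (cos φ)| ≤ G) →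
      |sin θ * (derivative f).eval (cos θ)| ≤ K * (A / R + R * G) := by
  have hpi := pi_pos
  have half {α β : ℝ} (hα : -1 < α) (hβ : -1 < β) : ∃ K > 0, ∀ (f : ℝ[X]) (A G R θ : ℝ),
      0 < R → θ ∈ Icc 0 (π / 2) →
      (∀ φ ∈ Icc 0 π, |φ - θ| ≤ R → |f.eval (cos φ)| ≤ A) →
      (∀ φ ∈ Icc 0 π, |φ - θ| ≤ R → |(jacobiOp α β f).eval (cos φ)| ≤ G) →
      |sin θ * (derivative f).eval (cos θ)| ≤ K * (A / R + R * G) := by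
    have hα' : 0 < α + 1 := by linarith
    refine ⟨2 ^ |β| / (α + 1) + 4 ^ |α| * 2 ^ |β| * 4, by positivity, ?_⟩
    intro f A G R θ hR hθ hA hG
    have hself : θ ∈ Icc 0 π := ⟨hθ.1, by linarith [hθ.2]⟩
    have hA0 : 0 ≤ A := (abs_nonneg _).trans (hA θ hself (by simpa using hR.le))
    have hG0 : 0 ≤ G := (abs_nonneg _).trans (hG θ hself (by simpa using hR.le))
    have hAR : 0 ≤ A / R := by positivity
    have hRG : 0 ≤ R * G := by positivity
    have hK1 : 0 ≤ 2 ^ |β| / (α + 1) := by positivity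
    have hK2 : (0 : ℝ) ≤ 4 ^ |α| * 2 ^ |β| := by positivity
    rcases lt_or_ge R θ with h | h
    · refine (abs_sin_mul_derivative_le f hR h hθ.2 hA hG).trans ?_
      rw [mul_div_assoc]
      have : 0 ≤ 2 ^ |β| / (α + 1) * (A / R + R * G) := by positivity
      nlinarith [mul_nonneg hK2 hRG]
    rcases hθ.1.eq_or_lt with rfl | hθ0
    · simp only [sin_zero, zero_mul, abs_zero]; positivity
    have hcos : cos θ ∈ Ico (0 : ℝ) 1 :=
      ⟨cos_nonneg_of_mem_Icc ⟨by linarith, hθ.2⟩, (cos_mem_Ioo ⟨hθ0, by linarith [hθ.2]⟩).2⟩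
    have h1 := abs_eval_derivative_le (G := G) hα hβ f hcos fun s hs => by
      have h1 : arccos s ≤ θ := by
        rw [← arccos_cos hself.1 hself.2]; exact arccos_le_arccos hs.1
      have := hG (arccos s) ⟨arccos_nonneg s, arccos_le_pi s⟩
        (abs_le.2 ⟨by linarith [arccos_nonneg s], by linarith⟩)
      rwa [cos_arccos (by linarith [hcos.1, hs.1]) hs.2] at this
    have h2 : |sin θ| ≤ R := by
      rw [abs_of_nonneg (sin_nonneg_of_nonneg_of_le_pi hself.1 hself.2)]
      exact (sin_le hθ.1).trans h
    rw [abs_mul]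
    have h3 := mul_le_mul h2 h1 (abs_nonneg _) hR.le
    have : 0 ≤ 4 ^ |α| * 2 ^ |β| * 4 * (A / R + R * G) := by positivity
    nlinarith [mul_nonneg hK1 hAR]
  obtain ⟨K₁, hK₁, H₁⟩ := half hα hβ
  obtain ⟨K₂, hK₂, H₂⟩ := half hβ hα
  refine ⟨K₁ + K₂, by positivity, fun f A G R θ hR hθ hA hG => ?_⟩
  have hA0 : 0 ≤ A := (abs_nonneg _).trans (hA θ hθ (by simpa using hR.le))
  have hG0 : 0 ≤ G := (abs_nonneg _).trans (hG θ hθ (by simpa using hR.le))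
  have hAR : 0 ≤ A / R + R * G := by positivity
  rcases le_total θ (π / 2) with h | h
  · refine (H₁ f A G R θ hR ⟨hθ.1, h⟩ hA hG).trans ?_
    nlinarith
  · have := H₂ (f.comp (-X)) A G R (π - θ) hR ⟨by linarith [hθ.2], by linarith⟩
      (fun φ hφ hd => by
        have := hA (π - φ) ⟨by linarith [hφ.2], by linarith [hφ.1]⟩
          (by rw [← abs_neg]; convert hd using 2; ring)
        simpa [cos_pi_sub] using this)
      (fun φ hφ hd => by
        have := hG (π - φ) ⟨by linarith [hφ.2], by linarith [hφ.1]⟩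
          (by rw [← abs_neg]; convert hd using 2; ring)
        rw [jacobiOp_comp_neg]
        simpa [cos_pi_sub] using this)
    simp only [sin_pi_sub, cos_pi_sub, derivative_comp, derivative_neg, derivative_X,
      eval_neg, eval_comp, eval_X, neg_neg, neg_one_mul, mul_neg, abs_neg] at this
    refine this.trans ?_
    nlinarith

/-- Oscillation estimate for the Jacobi operator. -/
lemma exists_oscillation_bound {α β : ℝ} (hα : -1 < α) (hβ : -1 < β) :
    ∃ K > 0, ∀ (f : ℝ[X]) (A G R x y : ℝ), 0 < R → x ∈ Icc (-1 : ℝ) 1 → y ∈ Icc (-1 : ℝ) 1 →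
      (∀ z ∈ Icc (-1 : ℝ) 1, jacobiDist x z ≤ 2 * R → |f.eval z| ≤ A) →
      (∀ z ∈ Icc (-1 : ℝ) 1, jacobiDist x z ≤ 2 * R → |(jacobiOp α β f).eval z| ≤ G) →
      jacobiDist x y ≤ R → |f.eval x - f.eval y| ≤ K * (A / R + R * G) * jacobiDist x y := by
  obtain ⟨K, hK, H⟩ := exists_gradient_bound hα hβ
  refine ⟨K, hK, fun f A G R x y hR hx hy hA hG hxy => ?_⟩
  have hdist {φ : ℝ} (hφ : φ ∈ Icc 0 π) : jacobiDist x (cos φ) = |φ - arccos x| := by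
    rw [jacobiDist, arccos_cos hφ.1 hφ.2, abs_sub_comm]
  have := ((convex_Icc 0 π).inter (convex_Icc (arccos x - R)
    (arccos x + R))).norm_image_sub_le_of_norm_hasDerivWithin_le
    (f := fun s => f.eval (cos s)) (C := K * (A / R + R * G))
    (fun φ hφ => (hasDerivAt_eval_cos f φ).hasDerivWithinAt)
    (fun φ hφ => by
      have hle {ψ : ℝ} (h : |ψ - φ| ≤ R) : |ψ - arccos x| ≤ 2 * R := by
        rw [abs_le] at h ⊢
        constructor <;> linarith [hφ.2.1, hφ.2.2]
      rw [norm_neg]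
      exact H f A G R φ hR hφ.1
        (fun ψ hψ hd => hA _ ⟨neg_one_le_cos ψ, cos_le_one ψ⟩ (by rw [hdist hψ]; exact hle hd))
        (fun ψ hψ hd => hG _ ⟨neg_one_le_cos ψ, cos_le_one ψ⟩ (by rw [hdist hψ]; exact hle hd)))
    (x := arccos y) (y := arccos x)
    ⟨⟨arccos_nonneg y, arccos_le_pi y⟩, by
      have := abs_le.1 hxy
      constructor <;> linarith⟩
    ⟨⟨arccos_nonneg x, arccos_le_pi x⟩, by constructor <;> linarith⟩
  simpa [cos_arccos hx.1 hx.2, cos_arccos hy.1 hy.2, jacobiDist] using this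

end Gradient

section Volume

lemma measureReal_jacobiMeasure_Icc {α β a b : ℝ} (hα : -1 < α) (hβ : -1 < β) (ha : -1 ≤ a)
    (hab : a ≤ b) (hb : b ≤ 1) :
    (jacobiMeasure α β).real (Icc a b) = ∫ s in a..b, jacobiWeight α β s := by
  have hsub : Icc a b ⊆ Icc (-1 : ℝ) 1 := Icc_subset_Icc ha hb
  have hint : IntegrableOn (jacobiWeight α β) (Icc a b) :=
    ((intervalIntegrable_iff_integrableOn_Icc_of_le (by norm_num)).1
      (intervalIntegrable_jacobiWeight hα hβ)).mono_set hsub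
  rw [Measure.real, jacobiMeasure_eq, withDensity_apply _ measurableSet_Icc,
    Measure.restrict_restrict measurableSet_Icc, inter_eq_left.2 hsub,
    ← ofReal_integral_eq_lintegral_ofReal hint, ENNReal.toReal_ofReal,
    intervalIntegral.integral_of_le hab, integral_Icc_eq_integral_Ioc]
  · exact setIntegral_nonneg measurableSet_Icc fun s hs => jacobiWeight_nonneg (hsub hs)
  · filter_upwards [ae_restrict_mem measurableSet_Icc] with s hs
    exact jacobiWeight_nonneg (hsub hs)

lemma measurable_jacobiDist (x : ℝ) : Measurable (jacobiDist x) := by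
  unfold jacobiDist
  exact (continuous_const.sub continuous_arccos).abs.measurable

lemma jacobiDist_comm (x y : ℝ) : jacobiDist x y = jacobiDist y x := abs_sub_comm _ _

lemma jacobiDist_self (x : ℝ) : jacobiDist x x = 0 := by simp [jacobiDist]

lemma jacobiDist_triangle (x y z : ℝ) : jacobiDist x z ≤ jacobiDist x y + jacobiDist y z :=
  abs_sub_le _ _ _

lemma jacobiDist_neg (x y : ℝ) : jacobiDist (-x) (-y) = jacobiDist x y := by
  rw [jacobiDist, jacobiDist, arccos_neg, arccos_neg, abs_sub_comm]
  congr 1; ring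

lemma measurableSet_jacobiBall (x r : ℝ) : MeasurableSet {y | jacobiDist x y < r} :=
  measurableSet_lt (measurable_jacobiDist x) measurable_const

lemma jacobiVol_eq (α β x r : ℝ) :
    jacobiVol α β x r = (jacobiMeasure α β).real {y | jacobiDist x y < r} := rfl

lemma jacobiVol_neg (α β x r : ℝ) : jacobiVol β α (-x) r = jacobiVol α β x r := by
  rw [jacobiVol, jacobiVol]
  congr 1
  rw [jacobiMeasure_eq, jacobiMeasure_eq, withDensity_apply _ (measurableSet_jacobiBall _ _),
    withDensity_apply _ (measurableSet_jacobiBall _ _),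
    Measure.restrict_restrict (measurableSet_jacobiBall _ _),
    Measure.restrict_restrict (measurableSet_jacobiBall _ _)]
  have := (Measure.measurePreserving_neg (volume : Measure ℝ)).setLIntegral_comp_preimage
    (s := {y | jacobiDist (-x) y < r} ∩ Icc (-1) 1) (f := fun y => ENNReal.ofReal
      (jacobiWeight β α y)) ((measurableSet_jacobiBall _ _).inter measurableSet_Icc)
    (measurable_jacobiWeight β α).ennreal_ofReal
  rw [← this]
  simp only [jacobiWeight_neg]
  congr 2
  ext y
  have hd : jacobiDist (-x) (-y) = jacobiDist x y := jacobiDist_neg x y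
  simp only [mem_preimage, mem_inter_iff, mem_ofPred_eq, mem_Icc, hd]
  constructor <;> rintro ⟨h1, h2, h3⟩ <;> exact ⟨h1, by linarith, by linarith⟩

variable {α β : ℝ}

lemma jacobiVol_mono (hα : -1 < α) (hβ : -1 < β) (x : ℝ) {r s : ℝ} (h : r ≤ s) :
    jacobiVol α β x r ≤ jacobiVol α β x s := by
  have := isFiniteMeasure_jacobiMeasure hα hβ
  exact measureReal_mono fun y hy => lt_of_lt_of_le hy h

lemma jacobiVol_le_of_subset (hα : -1 < α) (hβ : -1 < β) {x y r s : ℝ}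
    (h : jacobiDist x y + r ≤ s) : jacobiVol α β x r ≤ jacobiVol α β y s := by
  have := isFiniteMeasure_jacobiMeasure hα hβ
  refine measureReal_mono fun z hz => ?_
  have := jacobiDist_triangle y x z
  rw [jacobiDist_comm y x] at this
  simp only [mem_ofPred_eq] at hz ⊢
  linarith

lemma jacobiVol_le_measure_univ (hα : -1 < α) (hβ : -1 < β) (x r : ℝ) :
    jacobiVol α β x r ≤ (jacobiMeasure α β).real univ := by
  have := isFiniteMeasure_jacobiMeasure hα hβ
  exact measureReal_mono (subset_univ _)

lemma one_sub_cos_three_le (u : ℝ) : 1 - cos (3 * u) ≤ 9 * (1 - cos u) := by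
  rw [cos_three_mul]
  have h1 := cos_le_one u
  have h2 := neg_one_le_cos u
  nlinarith [mul_nonneg (sub_nonneg.2 h1) (sub_nonneg.2 h1),
    mul_nonneg (mul_nonneg (sub_nonneg.2 h1) (sub_nonneg.2 h1)) (by linarith : 0 ≤ cos u + 1)]

lemma sin_ge_div_eight {u : ℝ} (h0 : 0 ≤ u) (h1 : u ≤ 3 * π / 4) : u / 8 ≤ sin u := by
  have hpi := pi_pos
  have hpi4 := pi_le_four
  rcases le_total u (π / 2) with h | h
  · refine le_trans ?_ (mul_le_sin h0 h)
    have : 1 / 8 ≤ 2 / π := by rw [div_le_div_iff₀ (by norm_num) hpi]; linarith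
    nlinarith
  · rw [← sin_pi_sub]
    refine le_trans ?_ (mul_le_sin (by linarith) (by linarith))
    rw [div_mul_eq_mul_div, le_div_iff₀ hpi]
    nlinarith

lemma neg_three_quarters_le_cos {u : ℝ} (h0 : 0 ≤ u) (h1 : u ≤ 3 * π / 4) : -(3 / 4) ≤ cos u := by
  have hpi := pi_pos
  have h2 : cos (3 * π / 4) ≤ cos u := cos_le_cos_of_nonneg_of_le_pi h0 (by linarith) h1
  have h3 : cos (3 * π / 4) = -(√2 / 2) := by
    rw [show 3 * π / 4 = π - π / 4 by ring, cos_pi_sub, cos_pi_div_four]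
  have h4 : √2 ≤ 3 / 2 := by rw [sqrt_le_left (by norm_num)]; norm_num
  linarith

lemma mem_jacobiBall_iff {θ r s : ℝ} (hθ : θ ∈ Icc 0 π) :
    jacobiDist (cos θ) s < r ↔ θ - r < arccos s ∧ arccos s < θ + r := by
  rw [jacobiDist, arccos_cos hθ.1 hθ.2, abs_lt]
  constructor <;> rintro ⟨h1, h2⟩ <;> constructor <;> linarith

/-- A model for the volume of the ball of radius `r` about `cos θ`. -/
def volumeModel (α θ r : ℝ) : ℝ := r * (θ + r) * (1 - cos (θ + r)) ^ α

lemma one_sub_cos_pos {u : ℝ} (h0 : 0 < u) (h1 : u ≤ π) : 0 < 1 - cos u := by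
  have := cos_lt_cos_of_nonneg_of_le_pi le_rfl h1 h0
  rw [cos_zero] at this
  linarith

lemma jacobiVol_le_volumeModel (hα : -1 < α) (hβ : -1 < β) {θ r : ℝ} (hθ : θ ∈ Icc 0 (π / 2))
    (hr : r ∈ Ioc 0 (π / 4)) : jacobiVol α β (cos θ) r ≤
      4 ^ |β| * (2 * 9 ^ |α| + 3 / (α + 1)) * volumeModel α θ r := by
  have := isFiniteMeasure_jacobiMeasure hα hβ
  have hpi := pi_pos
  have hα' : 0 < α + 1 := by linarith
  have hθπ : θ ∈ Icc 0 π := ⟨hθ.1, by linarith [hθ.2]⟩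
  have hsum : θ + r ≤ 3 * π / 4 := by linarith [hθ.2, hr.2]
  have hsum0 : 0 < θ + r := by linarith [hθ.1, hr.1]
  have hQ := one_sub_cos_pos hsum0 (by linarith)
  have hball {s : ℝ} (hs : s ∈ Icc (-1 : ℝ) 1) (h : jacobiDist (cos θ) s < r) :
      cos (θ + r) ≤ s := by
    rw [mem_jacobiBall_iff hθπ] at h
    have := cos_le_cos_of_nonneg_of_le_pi (arccos_nonneg s) (by linarith) h.2.le
    rwa [cos_arccos hs.1 hs.2] at this
  have hweight {s : ℝ} (hs : s ∈ Icc (cos (θ + r)) 1) :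
      jacobiWeight α β s ≤ 4 ^ |β| * (1 - s) ^ α := by
    have := neg_three_quarters_le_cos hsum0.le hsum
    unfold jacobiWeight
    rw [mul_comm]
    exact mul_le_mul_of_nonneg_right (rpow_le_rpow_abs β (by norm_num)
      (by linarith [hs.1]) (by linarith [hs.2])) (rpow_nonneg (by linarith [hs.2]) _)
  have p1 : 0 ≤ volumeModel α θ r := by
    have := rpow_nonneg hQ.le α
    have := hr.1
    unfold volumeModel; positivity
  have p2 : 0 ≤ 4 ^ |β| * (2 * 9 ^ |α|) * volumeModel α θ r := by positivity
  have p3 : 0 ≤ 4 ^ |β| * (3 / (α + 1)) * volumeModel α θ r := by positivity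
  rw [mul_add, add_mul]
  rcases le_or_gt (2 * r) θ with h | h
  · have hab : cos (θ + r) ≤ cos (θ - r) :=
      cos_le_cos_of_nonneg_of_le_pi (by linarith [hr.1]) (by linarith) (by linarith [hr.1])
    have h1 : jacobiVol α β (cos θ) r ≤
        (jacobiMeasure α β).real (Icc (cos (θ + r)) (cos (θ - r))) := by
      refine ENNReal.toReal_mono (measure_ne_top _ _) (measure_mono_ae ?_)
      filter_upwards [ae_jacobiMeasure_mem α β] with s hs hsr
      refine ⟨hball hs hsr, ?_⟩
      have hsr' := (mem_jacobiBall_iff hθπ).1 hsr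
      have := cos_le_cos_of_nonneg_of_le_pi (by linarith [hr.1]) (arccos_le_pi s) hsr'.1.le
      rwa [cos_arccos hs.1 hs.2] at this
    rw [measureReal_jacobiMeasure_Icc hα hβ (neg_one_le_cos _) hab (cos_le_one _)] at h1
    have h2 : ∫ s in cos (θ + r)..cos (θ - r), jacobiWeight α β s ≤
        ∫ s in cos (θ + r)..cos (θ - r), 4 ^ |β| * (9 ^ |α| * (1 - cos (θ + r)) ^ α) := by
      refine intervalIntegral.integral_mono_on hab
        ((intervalIntegrable_jacobiWeight hα hβ).mono_set ?_) (by simp) fun s hs => ?_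
      · rw [uIcc_of_le hab, uIcc_of_le (by norm_num)]
        exact Icc_subset_Icc (neg_one_le_cos _) (cos_le_one _)
      · have h3 : 1 - cos (θ + r) ≤ 9 * (1 - cos (θ - r)) := by
          refine le_trans ?_ (one_sub_cos_three_le _)
          rcases le_total (3 * (θ - r)) π with h4 | h4
          · have := cos_le_cos_of_nonneg_of_le_pi hsum0.le h4 (by linarith : θ + r ≤ 3 * (θ - r))
            linarith
          · have h5 : cos (3 * (θ - r)) ≤ cos (θ + r) := by
              rw [← cos_two_pi_sub (3 * (θ - r))]
              exact cos_le_cos_of_nonneg_of_le_pi hsum0.le (by linarith) (by linarith [hθ.2, hr.1])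
            linarith
        refine (hweight ⟨hs.1, hs.2.trans (cos_le_one _)⟩).trans
          (mul_le_mul_of_nonneg_left ?_ (by positivity))
        exact rpow_le_mul_rpow α (by norm_num) hQ (by linarith [hs.2]) (by linarith [hs.1])
    have h3 : cos (θ - r) - cos (θ + r) ≤ 2 * (r * (θ + r)) := by
      have : cos (θ - r) - cos (θ + r) = 2 * (sin θ * sin r) := by rw [cos_sub, cos_add]; ring
      rw [this]
      have := mul_le_mul (sin_le hθ.1) (sin_le hr.1.le)
        (sin_nonneg_of_nonneg_of_le_pi hr.1.le (by linarith [hr.2])) hθ.1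
      nlinarith [hr.1]
    rw [intervalIntegral.integral_const, smul_eq_mul] at h2
    have h4 := mul_le_mul_of_nonneg_right h3
      (by positivity : 0 ≤ 4 ^ |β| * (9 ^ |α| * (1 - cos (θ + r)) ^ α))
    have : 2 * (r * (θ + r)) * (4 ^ |β| * (9 ^ |α| * (1 - cos (θ + r)) ^ α)) =
        4 ^ |β| * (2 * 9 ^ |α|) * volumeModel α θ r := by unfold volumeModel; ring
    linarith
  · have h1 : jacobiVol α β (cos θ) r ≤ (jacobiMeasure α β).real (Icc (cos (θ + r)) 1) := by
      refine ENNReal.toReal_mono (measure_ne_top _ _) (measure_mono_ae ?_)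
      filter_upwards [ae_jacobiMeasure_mem α β] with s hs hsr
      exact ⟨hball hs hsr, hs.2⟩
    rw [measureReal_jacobiMeasure_Icc hα hβ (neg_one_le_cos _) (cos_le_one _) le_rfl] at h1
    have h2 : ∫ s in cos (θ + r)..1, jacobiWeight α β s ≤
        ∫ s in cos (θ + r)..1, 4 ^ |β| * (1 - s) ^ α := by
      refine intervalIntegral.integral_mono_on (cos_le_one _)
        ((intervalIntegrable_jacobiWeight hα hβ).mono_set ?_)
        ((intervalIntegrable_one_sub_rpow hα _ _).const_mul _) fun s hs => hweight hs
      rw [uIcc_of_le (cos_le_one _), uIcc_of_le (by norm_num)]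
      exact Icc_subset_Icc (neg_one_le_cos _) le_rfl
    have h3 : ∫ s in cos (θ + r)..1, 4 ^ |β| * (1 - s) ^ α =
        4 ^ |β| * ((1 - cos (θ + r)) ^ (α + 1) / (α + 1)) := by
      rw [intervalIntegral.integral_const_mul,
        intervalIntegral.integral_comp_sub_left (fun s => s ^ α), sub_self,
        integral_rpow (Or.inl hα), zero_rpow hα'.ne', sub_zero]
    have h4 : 1 - cos (θ + r) ≤ 3 * (r * (θ + r)) := by
      have := one_sub_sq_div_two_le_cos (x := θ + r)
      nlinarith [hr.1]
    rw [rpow_add_one hQ.ne'] at h3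
    have h5 : 4 ^ |β| * ((1 - cos (θ + r)) ^ α * (1 - cos (θ + r)) / (α + 1)) ≤
        4 ^ |β| * (3 / (α + 1)) * volumeModel α θ r := by
      have : 4 ^ |β| * (3 / (α + 1)) * volumeModel α θ r =
        4 ^ |β| * ((1 - cos (θ + r)) ^ α * (3 * (r * (θ + r))) / (α + 1)) := by
        unfold volumeModel; ring
      rw [this]
      gcongr
    linarith

lemma volumeModel_le_jacobiVol (hα : -1 < α) (hβ : -1 < β) {θ r : ℝ} (hθ : θ ∈ Icc 0 (π / 2))
    (hr : r ∈ Ioc 0 (π / 4)) : volumeModel α θ r ≤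
      4 ^ |β| * 4 ^ |α| * 128 * jacobiVol α β (cos θ) r := by
  have := isFiniteMeasure_jacobiMeasure hα hβ
  have hpi := pi_pos
  have hθπ : θ ∈ Icc 0 π := ⟨hθ.1, by linarith [hθ.2]⟩
  have hsum : θ + r ≤ 3 * π / 4 := by linarith [hθ.2, hr.2]
  have hsum0 : 0 < θ + r := by linarith [hθ.1, hr.1]
  have hQ := one_sub_cos_pos hsum0 (by linarith)
  have hab : cos (θ + r) ≤ cos (θ + r / 2) :=
    cos_le_cos_of_nonneg_of_le_pi (by linarith [hθ.1, hr.1]) (by linarith) (by linarith [hr.1])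
  have hIoc : (jacobiMeasure α β).real (Ioc (cos (θ + r)) (cos (θ + r / 2))) =
      (jacobiMeasure α β).real (Icc (cos (θ + r)) (cos (θ + r / 2))) := by
    refine measureReal_congr ?_
    rw [jacobiMeasure_eq]
    exact (withDensity_absolutelyContinuous _ _).ae_le
      (Measure.absolutelyContinuous_of_le Measure.restrict_le_self |>.ae_le Ioc_ae_eq_Icc)
  have h1 : (jacobiMeasure α β).real (Icc (cos (θ + r)) (cos (θ + r / 2))) ≤
      jacobiVol α β (cos θ) r := by
    rw [← hIoc]
    refine measureReal_mono fun s hs => ?_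
    have hs1 : s ∈ Icc (-1 : ℝ) 1 :=
      ⟨(neg_one_le_cos _).trans hs.1.le, hs.2.trans (cos_le_one _)⟩
    refine (mem_jacobiBall_iff hθπ).2 ⟨?_, ?_⟩
    · have := arccos_le_arccos hs.2
      rw [arccos_cos (by linarith [hθ.1, hr.1]) (by linarith [hr.1])] at this
      linarith [hr.1]
    · have := arccos_lt_arccos (neg_one_le_cos _) hs.1 hs1.2
      rwa [arccos_cos hsum0.le (by linarith)] at this
  rw [measureReal_jacobiMeasure_Icc hα hβ (neg_one_le_cos _) hab (cos_le_one _)] at h1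
  have h2 : ∫ s in cos (θ + r)..cos (θ + r / 2), (1 - cos (θ + r)) ^ α ≤
      ∫ s in cos (θ + r)..cos (θ + r / 2), 4 ^ |β| * 4 ^ |α| * jacobiWeight α β s := by
    refine intervalIntegral.integral_mono_on hab (by simp)
      (((intervalIntegrable_jacobiWeight hα hβ).mono_set ?_).const_mul _) fun s hs => ?_
    · rw [uIcc_of_le hab, uIcc_of_le (by norm_num)]
      exact Icc_subset_Icc (neg_one_le_cos _) (cos_le_one _)
    · have h3 : 1 - cos (θ + r) ≤ 4 * (1 - cos (θ + r / 2)) :=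
        one_sub_cos_le_four_mul (by linarith [hθ.1]) hsum0.le (by linarith [hr.1])
      have h4 := neg_three_quarters_le_cos hsum0.le hsum
      have h5 : (1 - cos (θ + r)) ^ α ≤ 4 ^ |α| * (1 - s) ^ α :=
        rpow_le_mul_rpow α (by norm_num) (by linarith [hs.2]) (by linarith [hs.1])
          (by linarith [hs.2])
      have h6 : 1 ≤ 4 ^ |β| * (1 + s) ^ β := by
        have := rpow_le_mul_rpow (c := 4) (u := 1) (v := 1 + s) β (by norm_num)
          (by linarith [hs.1]) (by linarith [hs.2, cos_le_one (θ + r / 2)]) (by linarith [hs.1])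
        rwa [one_rpow] at this
      have p : 0 ≤ 4 ^ |α| * (1 - s) ^ α := (rpow_nonneg hQ.le _).trans h5
      unfold jacobiWeight
      nlinarith [mul_le_mul_of_nonneg_left h6 p]
  rw [intervalIntegral.integral_const, smul_eq_mul, intervalIntegral.integral_const_mul] at h2
  have h3 : r * (θ + r) ≤ 128 * (cos (θ + r / 2) - cos (θ + r)) := by
    have e : cos (θ + r / 2) - cos (θ + r) = 2 * (sin (θ + 3 * r / 4) * sin (r / 4)) := by
      have a1 : cos (θ + r / 2) = cos ((θ + 3 * r / 4) - r / 4) := by ring_nf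
      have a2 : cos (θ + r) = cos ((θ + 3 * r / 4) + r / 4) := by ring_nf
      rw [a1, a2, cos_sub (θ + 3 * r / 4), cos_add (θ + 3 * r / 4)]; ring
    have s1 := sin_ge_div_eight (u := θ + 3 * r / 4) (by linarith [hθ.1, hr.1]) (by linarith [hr.1])
    have s2 : r / 4 / 2 ≤ sin (r / 4) := by
      refine le_trans ?_ (mul_le_sin (by linarith [hr.1]) (by linarith [hr.2]))
      have : 1 / 2 ≤ 2 / π := by
        rw [div_le_div_iff₀ (by norm_num) hpi]; linarith [pi_le_four]
      nlinarith [hr.1]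
    have := mul_le_mul s1 s2 (by linarith [hr.1])
      (le_trans (by linarith [hθ.1, hr.1]) s1)
    rw [e]
    nlinarith [hr.1, hθ.1]
  have h4 := mul_le_mul_of_nonneg_right h3 (rpow_nonneg hQ.le α)
  have h5 := mul_le_mul_of_nonneg_left h1 (by positivity : (0 : ℝ) ≤ 4 ^ |β| * 4 ^ |α|)
  unfold volumeModel
  nlinarith

lemma volumeModel_two_mul_le {α θ r : ℝ} (hθ : θ ∈ Icc 0 (π / 2)) (hr : r ∈ Ioc 0 (π / 8)) :
    volumeModel α θ (2 * r) ≤ 4 * 4 ^ |α| * volumeModel α θ r := by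
  have hpi := pi_pos
  have hsum : θ + 2 * r ≤ π := by linarith [hθ.2, hr.2]
  have hr0 := hr.1
  have hθ0 := hθ.1
  have hQ : 0 < 1 - cos (θ + r) := one_sub_cos_pos (by linarith) (by linarith)
  have h1 := one_sub_cos_le_four_mul (s := θ + r) (θ := θ + 2 * r) (by linarith) (by linarith)
    (by linarith)
  have h2 : cos (θ + 2 * r) ≤ cos (θ + r) :=
    cos_le_cos_of_nonneg_of_le_pi (by linarith) hsum (by linarith)
  have h3 := rpow_le_mul_rpow (c := 4) (u := 1 - cos (θ + 2 * r)) (v := 1 - cos (θ + r)) α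
    (by norm_num) hQ (by linarith) h1
  have h4 : 0 ≤ (1 - cos (θ + 2 * r)) ^ α := rpow_nonneg (by linarith [cos_le_one (θ + 2 * r)]) _
  unfold volumeModel
  calc _ ≤ 2 * r * (2 * (θ + r)) * (4 ^ |α| * (1 - cos (θ + r)) ^ α) := by
        gcongr
        linarith
    _ = _ := by ring

lemma exists_doubling_aux (hα : -1 < α) (hβ : -1 < β) : ∃ D > 0, ∃ v > 0,
    ∀ x ∈ Icc (0 : ℝ) 1, (∀ r ∈ Ioc 0 (π / 8), jacobiVol α β x (2 * r) ≤ D * jacobiVol α β x r) ∧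
      (∀ r, 0 < r → 0 < jacobiVol α β x r) ∧ v ≤ jacobiVol α β x (π / 8) := by
  have hpi := pi_pos
  have hα' : 0 < α + 1 := by linarith
  have hc := one_sub_cos_pos (u := π / 8) (by linarith) (by linarith)
  set q : ℝ := max 2 (1 - cos (π / 8))⁻¹ with hq
  have hq0 : 0 < q := by positivity
  refine ⟨4 ^ |β| * (2 * 9 ^ |α| + 3 / (α + 1)) * (4 * 4 ^ |α| * (4 ^ |β| * 4 ^ |α| * 128)),
    by positivity, (π / 8) * (π / 8) * (q ^ |α|)⁻¹ / (4 ^ |β| * 4 ^ |α| * 128), by positivity,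
    fun x hx => ?_⟩
  obtain ⟨θ, hθ, rfl⟩ : ∃ θ ∈ Icc 0 (π / 2), cos θ = x :=
    ⟨arccos x, ⟨arccos_nonneg x, arccos_le_pi_div_two.2 hx.1⟩, cos_arccos (by linarith [hx.1]) hx.2⟩
  have hlow {r : ℝ} (hr : 0 < r) (hr' : r ≤ π / 4) :=
    volumeModel_le_jacobiVol hα hβ hθ ⟨hr, hr'⟩
  refine ⟨fun r hr => ?_, fun r hr => ?_, ?_⟩
  · have h1 := jacobiVol_le_volumeModel hα hβ hθ (r := 2 * r)
      ⟨by linarith [hr.1], by linarith [hr.2]⟩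
    have h2 := volumeModel_two_mul_le (α := α) hθ hr
    have h3 := hlow hr.1 (by linarith [hr.2])
    refine h1.trans ?_
    rw [mul_assoc (4 ^ |β| * (2 * 9 ^ |α| + 3 / (α + 1)))]
    refine mul_le_mul_of_nonneg_left (h2.trans ?_) (by positivity)
    rw [mul_assoc (4 * 4 ^ |α|)]
    exact mul_le_mul_of_nonneg_left h3 (by positivity)
  · have hm : 0 < min r (π / 4) := lt_min hr (by linarith)
    refine lt_of_lt_of_le ?_ (jacobiVol_mono hα hβ _ (min_le_left r (π / 4)))
    have h1 := hlow hm (min_le_right _ _)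
    have h2 : 0 < volumeModel α θ (min r (π / 4)) := by
      have hs : 0 < θ + min r (π / 4) := by linarith [hθ.1]
      have := rpow_pos_of_pos (one_sub_cos_pos hs
        (by linarith [hθ.2, min_le_right r (π / 4)])) α
      unfold volumeModel
      positivity
    exact pos_of_mul_pos_right (h2.trans_le h1) (by positivity)
  · rw [div_le_iff₀ (by positivity), mul_comm (jacobiVol _ _ _ _)]
    refine le_trans ?_ (hlow (by linarith) (by linarith))
    have h1 : cos (θ + π / 8) ≤ cos (π / 8) :=
      cos_le_cos_of_nonneg_of_le_pi (by linarith) (by linarith [hθ.2]) (by linarith [hθ.1])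
    have h2 : (1 - cos (π / 8)) * (1 - cos (π / 8))⁻¹ = 1 := mul_inv_cancel₀ hc.ne'
    have h5 : 1 ≤ q * (1 - cos (θ + π / 8)) := by
      have : (1 - cos (π / 8))⁻¹ ≤ q := le_max_right _ _
      nlinarith
    have h6 : (2 : ℝ) ≤ q := le_max_left _ _
    have h3 := rpow_le_mul_rpow (c := q) (u := 1) (v := 1 - cos (θ + π / 8)) α
      (by linarith) (by linarith) (by linarith [neg_one_le_cos (θ + π / 8)])
      h5
    rw [one_rpow] at h3
    have h4 : (q ^ |α|)⁻¹ ≤ (1 - cos (θ + π / 8)) ^ α := by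
      rwa [inv_le_iff_one_le_mul₀' (by positivity)]
    have h7 := hθ.1
    unfold volumeModel
    gcongr
    linarith

lemma jacobiVol_pos (hα : -1 < α) (hβ : -1 < β) {x r : ℝ} (hx : x ∈ Icc (-1 : ℝ) 1) (hr : 0 < r) :
    0 < jacobiVol α β x r := by
  rcases le_total 0 x with h | h
  · obtain ⟨_, _, _, _, H⟩ := exists_doubling_aux hα hβ
    exact (H x ⟨h, hx.2⟩).2.1 r hr
  · obtain ⟨_, _, _, _, H⟩ := exists_doubling_aux hβ hα
    rw [← jacobiVol_neg]
    exact (H (-x) ⟨by linarith, by linarith [hx.1]⟩).2.1 r hr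

/-- The Jacobi measure is doubling. -/
lemma exists_doubling (hα : -1 < α) (hβ : -1 < β) : ∃ D ≥ 1, ∀ x ∈ Icc (-1 : ℝ) 1, ∀ r > 0,
    jacobiVol α β x (2 * r) ≤ D * jacobiVol α β x r := by
  obtain ⟨D₁, hD₁, v₁, hv₁, H₁⟩ := exists_doubling_aux hα hβ
  obtain ⟨D₂, hD₂, v₂, hv₂, H₂⟩ := exists_doubling_aux hβ hα
  set M := (jacobiMeasure α β).real univ
  have hM : 0 ≤ M := measureReal_nonneg
  refine ⟨1 + (D₁ + D₂ + M / v₁ + M / v₂), le_add_of_nonneg_right (by positivity),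
    fun x hx r hr => ?_⟩
  have hV := jacobiVol_pos hα hβ hx hr
  suffices jacobiVol α β x (2 * r) ≤ (D₁ + D₂ + M / v₁ + M / v₂) * jacobiVol α β x r by linarith
  have q1 : 0 ≤ M / v₁ := by positivity
  have q2 : 0 ≤ M / v₂ := by positivity
  have hex : jacobiVol α β x (2 * r) ≤ D₁ * jacobiVol α β x r ∨
      jacobiVol α β x (2 * r) ≤ D₂ * jacobiVol α β x r ∨
      jacobiVol α β x (2 * r) ≤ M / v₁ * jacobiVol α β x r ∨
      jacobiVol α β x (2 * r) ≤ M / v₂ * jacobiVol α β x r := by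
    have hbig {v : ℝ} (hv : 0 < v) (h : v ≤ jacobiVol α β x r) :
        jacobiVol α β x (2 * r) ≤ M / v * jacobiVol α β x r := by
      refine (jacobiVol_le_measure_univ hα hβ x _).trans ?_
      rw [div_mul_eq_mul_div, le_div_iff₀ hv]
      exact mul_le_mul_of_nonneg_left h hM
    rcases le_total 0 x with h | h
    · obtain ⟨h1, -, h3⟩ := H₁ x ⟨h, hx.2⟩
      rcases le_total r (π / 8) with hr' | hr'
      · exact Or.inl (h1 r ⟨hr, hr'⟩)
      · exact Or.inr (Or.inr (Or.inl (hbig hv₁ (h3.trans (jacobiVol_mono hα hβ x hr')))))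
    · obtain ⟨h1, -, h3⟩ := H₂ (-x) ⟨by linarith, by linarith [hx.1]⟩
      simp only [jacobiVol_neg] at h1 h3
      rcases le_total r (π / 8) with hr' | hr'
      · exact Or.inr (Or.inl (h1 r ⟨hr, hr'⟩))
      · exact Or.inr (Or.inr (Or.inr (hbig hv₂ (h3.trans (jacobiVol_mono hα hβ x hr')))))
  rcases hex with h | h | h | h <;> refine h.trans (mul_le_mul_of_nonneg_right ?_ hV.le) <;>
    linarith

lemma exists_jacobiVol_mul_le (hα : -1 < α) (hβ : -1 < β) {ε : ℝ} (hε : 0 < ε) :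
    ∃ D > 0, ∀ x ∈ Icc (-1 : ℝ) 1, ∀ r > 0,
      jacobiVol α β x r ≤ D * jacobiVol α β x (ε * r) := by
  obtain ⟨D, hD, H⟩ := exists_doubling hα hβ
  obtain ⟨n, hn⟩ := pow_unbounded_of_one_lt (ε⁻¹) (by norm_num : (1 : ℝ) < 2)
  refine ⟨D ^ n, by positivity, fun x hx r hr => ?_⟩
  have key (m : ℕ) : jacobiVol α β x (2 ^ m * (ε * r)) ≤ D ^ m * jacobiVol α β x (ε * r) := by
    induction m with
    | zero => simp
    | succ m ih =>
      have := H x hx (2 ^ m * (ε * r)) (by positivity)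
      rw [pow_succ', pow_succ', mul_assoc, mul_assoc]
      exact this.trans (mul_le_mul_of_nonneg_left ih (by linarith))
  refine (jacobiVol_mono hα hβ x ?_).trans (key n)
  have : 1 ≤ 2 ^ n * ε := by
    rw [inv_lt_iff_one_lt_mul₀ hε] at hn; linarith
  nlinarith

end Volume

section KeyBound

variable {α β : ℝ}

lemma expWeight_le_mul (κ : ℝ) {x z r : ℝ} (h : jacobiDist x z ≤ r) :
    expWeight κ x ≤ exp (|κ| * r) * expWeight κ z := by
  rw [expWeight, expWeight, ← exp_add, exp_le_exp]
  have h1 : -κ * (arccos x - arccos z) ≤ |κ| * jacobiDist x z := by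
    rw [jacobiDist, ← abs_mul, neg_mul]
    exact neg_le_abs _
  have h2 := mul_le_mul_of_nonneg_left h (abs_nonneg κ)
  linarith

/-- Cauchy–Schwarz inequality for the Jacobi measure. -/
lemma sq_integral_mul_le (hα : -1 < α) (hβ : -1 < β) {f g : ℝ → ℝ}
    (hf : ContinuousOn f (Icc (-1) 1)) (hg : ContinuousOn g (Icc (-1) 1)) :
    (∫ x, f x * g x ∂(jacobiMeasure α β)) ^ 2 ≤
      (∫ x, f x ^ 2 ∂(jacobiMeasure α β)) * ∫ x, g x ^ 2 ∂(jacobiMeasure α β) := by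
  have key (s : ℝ) : 0 ≤ (∫ x, f x ^ 2 ∂(jacobiMeasure α β)) * (s * s) +
      2 * (∫ x, f x * g x ∂(jacobiMeasure α β)) * s + ∫ x, g x ^ 2 ∂(jacobiMeasure α β) := by
    have h0 : 0 ≤ ∫ x, (f x * s + g x) ^ 2 ∂(jacobiMeasure α β) :=
      integral_nonneg fun x => sq_nonneg _
    have h1 : ∫ x, (f x * s + g x) ^ 2 ∂(jacobiMeasure α β) =
        ∫ x, f x ^ 2 * (s * s) + f x * g x * (2 * s) + g x ^ 2 ∂(jacobiMeasure α β) := by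
      congr 1; ext x; ring
    rw [h1, integral_add (integrable_jacobiMeasure hα hβ (by fun_prop))
      (integrable_jacobiMeasure hα hβ (by fun_prop)),
      integral_add (integrable_jacobiMeasure hα hβ (by fun_prop))
      (integrable_jacobiMeasure hα hβ (by fun_prop)), integral_mul_const,
      integral_mul_const] at h0
    linarith
  have := discrim_le_zero key
  unfold discrim at this
  linarith

lemma abs_mul_sqrt_le (κ : ℝ) {t : ℝ} (ht : 0 ≤ t) : |κ| * √t ≤ 1 / 2 + κ ^ 2 * t / 2 := by
  have := sq_nonneg (|κ| * √t - 1)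
  have e : (|κ| * √t) ^ 2 = κ ^ 2 * t := by rw [mul_pow, sq_abs, sq_sqrt ht]
  nlinarith

/-- The square root of the volume of the ball of radius `√t` about `x` weighted by `expWeight`. -/
def ballWeight (α β κ t x : ℝ) : ℝ := √(jacobiVol α β x √t * expWeight κ x)

lemma ballWeight_sq (κ t x : ℝ) :
    ballWeight α β κ t x ^ 2 = jacobiVol α β x √t * expWeight κ x :=
  sq_sqrt (mul_nonneg measureReal_nonneg (expWeight_pos κ x).le)

lemma ballWeight_nonneg (κ t x : ℝ) : 0 ≤ ballWeight α β κ t x := sqrt_nonneg _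

lemma ballWeight_pos (hα : -1 < α) (hβ : -1 < β) (κ : ℝ) {t x : ℝ} (ht : 0 < t)
    (hx : x ∈ Icc (-1 : ℝ) 1) : 0 < ballWeight α β κ t x :=
  sqrt_pos.2 (mul_pos (jacobiVol_pos hα hβ hx (sqrt_pos.2 ht)) (expWeight_pos κ x))

lemma ballWeight_le (hα : -1 < α) (hβ : -1 < β) (κ : ℝ) {D t x z : ℝ} (hD0 : 0 ≤ D)
    (hD : ∀ x ∈ Icc (-1 : ℝ) 1, ∀ r > 0, jacobiVol α β x (2 * r) ≤ D * jacobiVol α β x r)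
    (ht : 0 < t) (hz : z ∈ Icc (-1 : ℝ) 1) (hxz : jacobiDist x z ≤ √t) :
    ballWeight α β κ t x ≤ D * exp (|κ| * √t / 2) * ballWeight α β κ (t / 4) z := by
  have hs := sqrt_pos.2 ht
  have h4 : √(t / 4) = √t / 2 := by
    rw [sqrt_div ht.le, show (4 : ℝ) = 2 ^ 2 by norm_num, sqrt_sq (by norm_num)]
  have h1 : jacobiVol α β x √t ≤ jacobiVol α β z (2 * √t) :=
    jacobiVol_le_of_subset hα hβ (by linarith)
  have h2 := hD z hz √t hs
  have h3 := hD z hz (√t / 2) (by positivity)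
  rw [show 2 * (√t / 2) = √t by ring] at h3
  have h5 : jacobiVol α β x √t ≤ D ^ 2 * jacobiVol α β z (√t / 2) := by
    have := mul_le_mul_of_nonneg_left h3 hD0
    linarith
  refine abs_le_of_sq_le_sq' (by
    rw [mul_pow, ballWeight_sq, ballWeight_sq, h4, mul_pow, ← exp_nat_mul]
    have h6 := mul_le_mul h5 (expWeight_le_mul κ hxz) (expWeight_pos κ x).le
      (mul_nonneg (by positivity) measureReal_nonneg)
    refine h6.trans (le_of_eq ?_)
    rw [show ((2 : ℕ) : ℝ) * (|κ| * √t / 2) = |κ| * √t by push_cast; ring]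
    ring) (mul_nonneg (mul_nonneg hD0 (exp_pos _).le) (ballWeight_nonneg _ _ _)) |>.2

namespace JacobiSystem

variable {p : ℕ → ℝ[X]}

/-- A weighted pointwise bound for the heat semigroup on polynomials of degree less than `n`. -/
def HeatBound (h : JacobiSystem α β p) (κ : ℝ) (n : ℕ) (N : ℝ) : Prop :=
  ∀ f ∈ degreeLT ℝ n, ∀ t > 0, ∀ x ∈ Icc (-1 : ℝ) 1,
    |(h.heat t f).eval x| * ballWeight α β κ t x ≤
      N * exp (2 * κ ^ 2 * t) * √(expNormSq α β κ f)

lemma jacobiEig_nonneg (h : JacobiSystem α β p) (k : ℕ) : 0 ≤ jacobiEig α β k := by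
  have := h.left_gt
  have := h.right_gt
  rcases Nat.eq_zero_or_pos k with rfl | hk
  · simp [jacobiEig]
  · have : (1 : ℝ) ≤ k := by exact_mod_cast hk
    exact mul_nonneg (by positivity) (by linarith)

lemma sq_coef_le (h : JacobiSystem α β p) (κ : ℝ) (k : ℕ) (f : ℝ[X]) :
    h.coef k f ^ 2 ≤ exp (|κ| * π) * expNormSq α β κ f := by
  have h1 := sq_integral_mul_le h.left_gt h.right_gt f.continuous.continuousOn
    (p k).continuous.continuousOn
  have h2 := h.orthonormal k k
  simp only [if_true, ← sq] at h2
  rw [h2, mul_one, ← coef_apply] at h1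
  refine h1.trans ?_
  rw [expNormSq, ← integral_const_mul]
  have hw := continuous_expWeight κ
  refine integral_mono (integrable_jacobiMeasure h.left_gt h.right_gt (by fun_prop))
    (integrable_jacobiMeasure h.left_gt h.right_gt (by fun_prop)) fun x => ?_
  have h3 : 1 ≤ exp (|κ| * π) * expWeight κ x := by
    rw [expWeight, ← exp_add]
    refine one_le_exp ?_
    have h5 := mul_le_mul (le_abs_self κ) (arccos_le_pi x) (arccos_nonneg x) (abs_nonneg κ)
    linarith
  change f.eval x ^ 2 ≤ exp (|κ| * π) * (f.eval x * f.eval x * expWeight κ x)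
  nlinarith [sq_nonneg (f.eval x)]

lemma exists_heatBound (h : JacobiSystem α β p) (κ : ℝ) (n : ℕ) :
    ∃ N ≥ 0, h.HeatBound κ n N := by
  have hα := h.left_gt
  have hβ := h.right_gt
  have hb (k : ℕ) : ∃ M, ∀ x ∈ Icc (-1 : ℝ) 1, |(p k).eval x| ≤ M := by
    obtain ⟨M, hM⟩ := isCompact_Icc.exists_bound_of_continuousOn
      ((p k).continuous.continuousOn (s := Icc (-1) 1))
    exact ⟨M, hM⟩
  choose M hM using hb
  have hM0 (k : ℕ) : 0 ≤ M k := (abs_nonneg _).trans (hM k 0 (by norm_num))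
  set T := (jacobiMeasure α β).real univ
  refine ⟨(∑ k ∈ Finset.range n, √(exp (|κ| * π)) * M k) * √(T * exp (|κ| * π)), by
    have : 0 ≤ ∑ k ∈ Finset.range n, √(exp (|κ| * π)) * M k :=
      Finset.sum_nonneg fun k _ => mul_nonneg (sqrt_nonneg _) (hM0 k)
    positivity, fun f hf t ht x hx => ?_⟩
  set S := √(expNormSq α β κ f)
  have h1 : |(h.heat t f).eval x| ≤ (∑ k ∈ Finset.range n, √(exp (|κ| * π)) * M k) * S := by
    rw [h.heat_eq_sum t hf, eval_finsetSum, Finset.sum_mul]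
    refine (Finset.abs_sum_le_sum_abs _ _).trans (Finset.sum_le_sum fun k _ => ?_)
    rw [eval_smul, smul_eq_mul, abs_mul, abs_mul, abs_exp]
    have e1 : exp (-jacobiEig α β k * t) ≤ 1 :=
      exp_le_one_iff.2 (by nlinarith [h.jacobiEig_nonneg k])
    have e2 : |h.coef k f| ≤ √(exp (|κ| * π)) * S := by
      rw [← sqrt_mul (exp_pos _).le]
      exact abs_le_sqrt (h.sq_coef_le κ k f)
    calc _ ≤ 1 * (√(exp (|κ| * π)) * S) * M k := by
          gcongr
          exact hM k x hx
      _ = _ := by ring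
  have h2 : ballWeight α β κ t x ≤ √(T * exp (|κ| * π)) := by
    refine sqrt_le_sqrt (mul_le_mul (jacobiVol_le_measure_univ hα hβ x _) ?_
      (expWeight_pos κ x).le measureReal_nonneg)
    rw [expWeight, exp_le_exp]
    have h5 := mul_le_mul (neg_abs_le κ |> neg_le.1) (arccos_le_pi x) (arccos_nonneg x)
      (abs_nonneg κ)
    linarith
  have h3 : 1 ≤ exp (2 * κ ^ 2 * t) := one_le_exp (by positivity)
  have p1 : 0 ≤ (∑ k ∈ Finset.range n, √(exp (|κ| * π)) * M k) * S := (abs_nonneg _).trans h1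
  calc _ ≤ (∑ k ∈ Finset.range n, √(exp (|κ| * π)) * M k) * S * √(T * exp (|κ| * π)) :=
        mul_le_mul h1 h2 (sqrt_nonneg _) p1
    _ ≤ (∑ k ∈ Finset.range n, √(exp (|κ| * π)) * M k) * S * √(T * exp (|κ| * π)) *
        exp (2 * κ ^ 2 * t) := le_mul_of_one_le_right (mul_nonneg p1 (sqrt_nonneg _)) h3
    _ = _ := by ring

lemma HeatBound.propagate {h : JacobiSystem α β p} {κ : ℝ} {n : ℕ} {N D : ℝ}
    (hN : h.HeatBound κ n N) (hN0 : 0 ≤ N) (hD0 : 0 ≤ D)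
    (hD : ∀ x ∈ Icc (-1 : ℝ) 1, ∀ r > 0, jacobiVol α β x (2 * r) ≤ D * jacobiVol α β x r)
    {f : ℝ[X]} (hf : f ∈ degreeLT ℝ n) {t : ℝ} (ht : 0 < t) {c M : ℝ} (hcM : 0 ≤ c * M)
    (hfM : √(expNormSq α β κ (h.heat (3 * t / 4) f)) ≤ c * M * exp (3 * κ ^ 2 * t / 8)) {x z : ℝ}
    (hz : z ∈ Icc (-1 : ℝ) 1) (hxz : jacobiDist x z ≤ √t) :
    |(h.heat t f).eval z| * ballWeight α β κ t x ≤
      c * (N * D * exp 1 * (exp (2 * κ ^ 2 * t) * M)) := by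
  have h1 := ballWeight_le h.left_gt h.right_gt κ hD0 hD ht hz hxz
  have h2 := hN _ (h.heat_mem_degreeLT (3 * t / 4) hf) (t / 4) (by positivity) z hz
  rw [h.heat_heat, show t / 4 + 3 * t / 4 = t by ring] at h2
  have h3 : exp (2 * κ ^ 2 * (t / 4)) * exp (3 * κ ^ 2 * t / 8) * exp (|κ| * √t / 2) ≤
      exp 1 * exp (2 * κ ^ 2 * t) := by
    rw [← exp_add, ← exp_add, ← exp_add, exp_le_exp]
    have := abs_mul_sqrt_le κ ht.le
    have : 0 ≤ κ ^ 2 * t := by positivity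
    linarith
  calc _ ≤ |(h.heat t f).eval z| *
        (D * exp (|κ| * √t / 2) * ballWeight α β κ (t / 4) z) := by gcongr
    _ = |(h.heat t f).eval z| * ballWeight α β κ (t / 4) z * (D * exp (|κ| * √t / 2)) := by ring
    _ ≤ N * exp (2 * κ ^ 2 * (t / 4)) * √(expNormSq α β κ (h.heat (3 * t / 4) f)) *
        (D * exp (|κ| * √t / 2)) := by gcongr
    _ ≤ N * exp (2 * κ ^ 2 * (t / 4)) * (c * M * exp (3 * κ ^ 2 * t / 8)) *
        (D * exp (|κ| * √t / 2)) := by gcongr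
    _ = c * M * N * D * (exp (2 * κ ^ 2 * (t / 4)) * exp (3 * κ ^ 2 * t / 8) *
        exp (|κ| * √t / 2)) := by ring
    _ ≤ c * M * N * D * (exp 1 * exp (2 * κ ^ 2 * t)) := by gcongr
    _ = _ := by ring

lemma mul_jacobiVol_le_expNormSq (hα : -1 < α) (hβ : -1 < β) (κ : ℝ) (f : ℝ[X]) {x r m : ℝ}
    (hf : ∀ y ∈ Icc (-1 : ℝ) 1, jacobiDist x y < r → m ≤ f.eval y ^ 2 * expWeight κ y) :
    m * jacobiVol α β x r ≤ expNormSq α β κ f := by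
  have := isFiniteMeasure_jacobiMeasure hα hβ
  have hw := continuous_expWeight κ
  have h1 : ∫ y in {y | jacobiDist x y < r}, m ∂(jacobiMeasure α β) = m * jacobiVol α β x r := by
    rw [setIntegral_const, smul_eq_mul, mul_comm]; rfl
  have hint : Integrable (fun y => f.eval y * f.eval y * expWeight κ y) (jacobiMeasure α β) :=
    integrable_jacobiMeasure hα hβ (by fun_prop)
  rw [← h1]
  refine (setIntegral_mono_on_ae (integrable_const m).integrableOn hint.integrableOn
    (measurableSet_jacobiBall x r) ?_).trans (setIntegral_le_integral hint ?_)
  · filter_upwards [ae_jacobiMeasure_mem α β] with y hy hyr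
    have := hf y hy hyr
    rwa [sq] at this
  · exact ae_of_all _ fun y => mul_nonneg (mul_self_nonneg _) (expWeight_pos κ y).le

lemma exists_heatBound_step (hα : -1 < α) (hβ : -1 < β) : ∃ a > 0,
    ∀ {p : ℕ → ℝ[X]} (h : JacobiSystem α β p) (κ : ℝ) (n : ℕ) (N : ℝ), 0 ≤ N →
      h.HeatBound κ n N → h.HeatBound κ n (a + N / 2) := by
  obtain ⟨D, hD1, hD⟩ := exists_doubling hα hβ
  have hD0 : 0 < D := by linarith
  obtain ⟨K, hK, hosc⟩ := exists_oscillation_bound hα hβ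
  set ε : ℝ := min (1 / 2) (1 / (6 * K * D * exp 1)) with hε
  have hε0 : 0 < ε := by positivity
  have hε1 : ε ≤ 1 / 2 := min_le_left _ _
  have hε2 : 3 * K * ε * (D * exp 1) ≤ 1 / 2 := by
    have : ε ≤ 1 / (6 * K * D * exp 1) := min_le_right _ _
    rw [le_div_iff₀ (by positivity)] at this
    linarith
  obtain ⟨D', hD'0, hD'⟩ := exists_jacobiVol_mul_le hα hβ hε0
  refine ⟨√(D' * exp 1), by positivity, fun {p} h κ n N hN0 hN f hf t ht x hx => ?_⟩
  set M := √(expNormSq α β κ f) with hM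
  have hM2 : M ^ 2 = expNormSq α β κ f := sq_sqrt (expNormSq_nonneg α β κ f)
  have hM0 : 0 ≤ M := sqrt_nonneg _
  have hs := sqrt_pos.2 ht
  have hss : √t * √t = t := mul_self_sqrt ht.le
  set w := ballWeight α β κ t x with hw
  have hw0 : 0 < w := ballWeight_pos hα hβ κ ht hx
  set E := exp (2 * κ ^ 2 * t) with hE
  have bound {c : ℝ} {g : ℝ[X]} (hg : g ∈ degreeLT ℝ n) (hc : 0 ≤ c)
      (hgM : expNormSq α β κ (h.heat (3 * t / 4) g) ≤ (c * M * exp (3 * κ ^ 2 * t / 8)) ^ 2)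
      {z : ℝ} (hz : z ∈ Icc (-1 : ℝ) 1) (hxz : jacobiDist x z ≤ √t) :
      |(h.heat t g).eval z| ≤ c * (N * D * exp 1 * (E * M) / w) := by
    rw [← mul_div_assoc, le_div_iff₀ hw0]
    exact hN.propagate hN0 hD0.le hD hg ht (by positivity)
      ((sqrt_le_left (by positivity)).2 hgM) hz hxz
  set A := N * D * exp 1 * (E * M) / w with hA
  have hexp (c : ℝ) : (c * M * exp (3 * κ ^ 2 * t / 8)) ^ 2 =
      c ^ 2 * exp (κ ^ 2 * (3 * t / 4)) * M ^ 2 := by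
    rw [mul_pow, mul_pow, ← exp_nat_mul]
    rw [show ((2 : ℕ) : ℝ) * (3 * κ ^ 2 * t / 8) = κ ^ 2 * (3 * t / 4) by push_cast; ring]
    ring
  have hb1 {z : ℝ} (hz : z ∈ Icc (-1 : ℝ) 1) (hxz : jacobiDist x z ≤ √t) :
      |(h.heat t f).eval z| ≤ A := by
    have := bound (c := 1) hf zero_le_one (by
      rw [hexp, hM2, one_pow, one_mul]
      exact h.expNormSq_heat_le κ (by positivity) f) hz hxz
    rwa [one_mul] at this
  have hb2 {z : ℝ} (hz : z ∈ Icc (-1 : ℝ) 1) (hxz : jacobiDist x z ≤ √t) :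
      |(jacobiOp α β (h.heat t f)).eval z| ≤ 2 / t * A := by
    rw [h.jacobiOp_heat]
    refine bound (c := 2 / t) (h.jacobiOp_mem_degreeLT hf) (by positivity) ?_ hz hxz
    rw [hexp, hM2]
    refine (h.expNormSq_jacobiOp_heat_le κ (by positivity) f).trans ?_
    have h0 := expNormSq_nonneg α β κ f
    have : 2 / (3 * t / 4) ^ 2 ≤ (2 / t) ^ 2 := by
      rw [div_pow 2 t, div_le_div_iff₀ (by positivity) (by positivity)]
      nlinarith [sq_nonneg t]
    gcongr
  have hb3 {y : ℝ} (hy : y ∈ Icc (-1 : ℝ) 1) (hxy : jacobiDist x y < ε * √t) :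
      |(h.heat t f).eval x| - 3 * K * ε * A ≤ |(h.heat t f).eval y| := by
    have hA0 : 0 ≤ A := by positivity
    have h1 := hosc (h.heat t f) A (2 / t * A) (√t / 2) x y (by positivity) hx hy
      (fun z hz hd => hb1 hz (by linarith)) (fun z hz hd => hb2 hz (by linarith)) (by nlinarith)
    have h2 : A / (√t / 2) + √t / 2 * (2 / t * A) = 3 * A / √t := by
      have key (s : ℝ) (hs : 0 < s) : A / (s / 2) + s / 2 * (2 / (s * s) * A) = 3 * A / s := by
        field_simp; ring
      have := key √t hs
      rwa [hss] at this
    rw [h2] at h1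
    have h3 : K * (3 * A / √t) * jacobiDist x y ≤ K * (3 * A / √t) * (ε * √t) :=
      mul_le_mul_of_nonneg_left hxy.le (by positivity)
    have h4 : K * (3 * A / √t) * (ε * √t) = 3 * K * ε * A := by field_simp
    have := abs_sub_abs_le_abs_sub ((h.heat t f).eval x) ((h.heat t f).eval y)
    linarith
  set m := |(h.heat t f).eval x| - 3 * K * ε * A with hm
  have hfin : m * w ≤ √(D' * exp 1) * E * M := by
    rcases le_or_gt m 0 with h0 | h0
    · have : 0 ≤ √(D' * exp 1) * E * M := by positivity
      nlinarith
    refine abs_le_of_sq_le_sq' ?_ (by positivity) |>.2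
    have h1 := mul_jacobiVol_le_expNormSq hα hβ κ (h.heat t f) (x := x) (r := ε * √t)
      (m := m ^ 2 * (exp (-(|κ| * √t)) * expWeight κ x)) fun y hy hxy => by
        have h2 := hb3 hy hxy
        have h3 : m ^ 2 ≤ (h.heat t f).eval y ^ 2 := by
          rw [← sq_abs ((h.heat t f).eval y)]
          exact pow_le_pow_left₀ h0.le h2 2
        have h4 := expWeight_le_mul κ (x := x) (z := y) (r := √t) (by nlinarith)
        have h5 := mul_le_mul_of_nonneg_left h4 (exp_pos (-(|κ| * √t))).le
        rw [← mul_assoc, ← exp_add, neg_add_cancel, exp_zero, one_mul] at h5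
        exact mul_le_mul h3 h5 (by have := expWeight_pos κ x; positivity) (sq_nonneg _)
    have h2 := h1.trans (h.expNormSq_heat_le κ ht.le f)
    have h3 := hD' x hx √t hs
    rw [mul_pow, hw, ballWeight_sq, mul_pow, mul_pow, sq_sqrt (by positivity), hM2]
    have hφ := expWeight_pos κ x
    have h4 : exp (|κ| * √t) * exp (κ ^ 2 * t) ≤ exp 1 * E ^ 2 := by
      rw [hE, ← exp_nat_mul, ← exp_add, ← exp_add, exp_le_exp]
      have := abs_mul_sqrt_le κ ht.le
      have : 0 ≤ κ ^ 2 * t := by positivity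
      push_cast
      linarith
    have hcancel : exp (|κ| * √t) * exp (-(|κ| * √t)) = 1 := by
      rw [← exp_add, add_neg_cancel, exp_zero]
    calc m ^ 2 * (jacobiVol α β x √t * expWeight κ x) ≤
        m ^ 2 * (D' * jacobiVol α β x (ε * √t) * expWeight κ x) := by gcongr
      _ = D' * exp (|κ| * √t) * (m ^ 2 * (exp (-(|κ| * √t)) * expWeight κ x) *
          jacobiVol α β x (ε * √t)) := by
        linear_combination (-(m ^ 2 * D' * jacobiVol α β x (ε * √t) * expWeight κ x)) * hcancel
      _ ≤ D' * exp (|κ| * √t) * (exp (κ ^ 2 * t) * expNormSq α β κ f) := by gcongr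
      _ = D' * (exp (|κ| * √t) * exp (κ ^ 2 * t)) * expNormSq α β κ f := by ring
      _ ≤ D' * (exp 1 * E ^ 2) * expNormSq α β κ f := by
        have := expNormSq_nonneg α β κ f
        gcongr
      _ = _ := by ring
  have hAw : A * w = N * D * exp 1 * (E * M) := div_mul_cancel₀ _ hw0.ne'
  have h6 : 3 * K * ε * (A * w) ≤ N / 2 * (E * M) := by
    rw [hAw]
    have : 0 ≤ N * (E * M) := by positivity
    nlinarith
  have h7 : m * w = |(h.heat t f).eval x| * w - 3 * K * ε * (A * w) := by rw [hm]; ring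
  linarith

/-- Weighted ultracontractivity of the Jacobi heat semigroup on polynomials. -/
lemma exists_heat_pointwise_bound (hα : -1 < α) (hβ : -1 < β) : ∃ Q > 0,
    ∀ {p : ℕ → ℝ[X]} (h : JacobiSystem α β p) (κ t x : ℝ) (f : ℝ[X]), 0 < t →
      x ∈ Icc (-1 : ℝ) 1 → (h.heat t f).eval x ^ 2 * (jacobiVol α β x √t * expWeight κ x) ≤
        Q * exp (4 * κ ^ 2 * t) * expNormSq α β κ f := by
  obtain ⟨a, ha, hstep⟩ := exists_heatBound_step hα hβ
  refine ⟨(2 * a) ^ 2, by positivity, fun {p} h κ t x f ht hx => ?_⟩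
  set n := f.natDegree + 1
  obtain ⟨N₀, hN₀, hb⟩ := h.exists_heatBound κ n
  have hiter (k : ℕ) : h.HeatBound κ n (2 * a + N₀ * (1 / 2) ^ k) := by
    induction k with
    | zero =>
      intro f hf t ht x hx
      refine (hb f hf t ht x hx).trans ?_
      rw [pow_zero, mul_one]
      gcongr
      linarith
    | succ k ih =>
      have := hstep h κ n _ (by positivity) ih
      rwa [show a + (2 * a + N₀ * (1 / 2) ^ k) / 2 = 2 * a + N₀ * (1 / 2) ^ (k + 1) by
        rw [pow_succ]; ring] at this
  have hlim : Filter.Tendsto (fun k : ℕ => (2 * a + N₀ * (1 / 2 : ℝ) ^ k) *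
      exp (2 * κ ^ 2 * t) * √(expNormSq α β κ f)) Filter.atTop
      (nhds ((2 * a + N₀ * 0) * exp (2 * κ ^ 2 * t) * √(expNormSq α β κ f))) :=
    ((((tendsto_pow_atTop_nhds_zero_of_lt_one (by norm_num) (by norm_num)).const_mul
      N₀).const_add _).mul_const _).mul_const _
  have h1 := ge_of_tendsto' hlim fun k => hiter k f (mem_degreeLT_succ f) t ht x hx
  rw [mul_zero, add_zero] at h1
  have h2 := pow_le_pow_left₀ (mul_nonneg (abs_nonneg _) (ballWeight_nonneg _ _ _)) h1 2
  rw [mul_pow, sq_abs, ballWeight_sq, mul_pow, mul_pow, sq_sqrt (expNormSq_nonneg α β κ f),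
    ← exp_nat_mul] at h2
  rwa [show ((2 : ℕ) : ℝ) * (2 * κ ^ 2 * t) = 4 * κ ^ 2 * t by push_cast; ring] at h2

end JacobiSystem

end KeyBound

section Kernel

open Filter Topology

variable {α β : ℝ}

lemma jacobiDist_le_pi (x y : ℝ) : jacobiDist x y ≤ π := by
  rw [jacobiDist, abs_le]
  constructor <;> linarith [arccos_nonneg x, arccos_nonneg y, arccos_le_pi x, arccos_le_pi y]

lemma jacobiVol_four (x : ℝ) : jacobiVol α β x 4 = (jacobiMeasure α β).real univ := by
  rw [jacobiVol_eq]
  congr 1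
  exact eq_univ_of_forall fun y => (jacobiDist_le_pi x y).trans_lt pi_lt_four

lemma measure_univ_pos (hα : -1 < α) (hβ : -1 < β) : 0 < (jacobiMeasure α β).real univ := by
  rw [← jacobiVol_four 0]
  exact jacobiVol_pos hα hβ (by norm_num) (by norm_num)

lemma exists_le_jacobiVol (hα : -1 < α) (hβ : -1 < β) {r : ℝ} (hr : 0 < r) :
    ∃ v > 0, ∀ x ∈ Icc (-1 : ℝ) 1, v ≤ jacobiVol α β x r := by
  obtain ⟨D, hD, H⟩ := exists_jacobiVol_mul_le hα hβ (ε := r / 4) (by positivity)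
  refine ⟨(jacobiMeasure α β).real univ / D, div_pos (measure_univ_pos hα hβ) hD,
    fun x hx => ?_⟩
  have := H x hx 4 (by norm_num)
  rw [jacobiVol_four, show r / 4 * 4 = r by ring] at this
  rw [div_le_iff₀ hD]
  linarith

/-- A continuous function on `[-1,1]` is approximated uniformly from above by polynomials. -/
lemma exists_polynomial_approx {g : ℝ → ℝ} (hg : ContinuousOn g (Icc (-1) 1)) :
    ∃ f : ℕ → ℝ[X], (∀ n, ∀ x ∈ Icc (-1 : ℝ) 1, g x ≤ (f n).eval x) ∧
      (∀ n, ∀ x ∈ Icc (-1 : ℝ) 1, (f n).eval x ≤ g x + 2) ∧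
      ∀ x ∈ Icc (-1 : ℝ) 1, Tendsto (fun n => (f n).eval x) atTop (𝓝 (g x)) := by
  have h (n : ℕ) := exists_polynomial_near_of_continuousOn (-1) 1 g hg (1 / ((n : ℝ) + 1))
    (by positivity)
  choose q hq using h
  have hn (n : ℕ) : 1 / ((n : ℝ) + 1) ≤ 1 := by
    rw [div_le_one (by positivity)]; linarith [n.cast_nonneg (α := ℝ)]
  have hlim := tendsto_one_div_add_atTop_nhds_zero_nat (𝕜 := ℝ)
  refine ⟨fun n => q n + C (1 / ((n : ℝ) + 1)), fun n x hx => ?_, fun n x hx => ?_,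
    fun x hx => ?_⟩
  · have := abs_lt.1 (hq n x hx)
    rw [eval_add, eval_C]; linarith
  · have := abs_lt.1 (hq n x hx)
    have := hn n
    rw [eval_add, eval_C]; linarith
  · have h1 : Tendsto (fun n => (q n).eval x - g x) atTop (𝓝 0) :=
      squeeze_zero_norm (fun n => (hq n x hx).le) hlim
    have h2 := (h1.add hlim).add_const (g x)
    simp only [add_zero, zero_add] at h2
    refine h2.congr fun n => ?_
    rw [eval_add, eval_C]; ring

lemma tendsto_integral_jacobiMeasure (hα : -1 < α) (hβ : -1 < β) {F : ℕ → ℝ → ℝ} {g : ℝ → ℝ}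
    {M : ℝ} (hF : ∀ n, ContinuousOn (F n) (Icc (-1) 1))
    (hM : ∀ n, ∀ x ∈ Icc (-1 : ℝ) 1, |F n x| ≤ M)
    (hg : ∀ x ∈ Icc (-1 : ℝ) 1, Tendsto (fun n => F n x) atTop (𝓝 (g x))) :
    Tendsto (fun n => ∫ x, F n x ∂(jacobiMeasure α β)) atTop
      (𝓝 (∫ x, g x ∂(jacobiMeasure α β))) := by
  have := isFiniteMeasure_jacobiMeasure hα hβ
  refine tendsto_integral_of_dominated_convergence (fun _ => M)
    (fun n => (integrable_jacobiMeasure hα hβ (hF n)).aestronglyMeasurable)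
    (integrable_const M) (fun n => ?_) ?_
  · filter_upwards [ae_jacobiMeasure_mem α β] with x hx using hM n x hx
  · filter_upwards [ae_jacobiMeasure_mem α β] with x hx using hg x hx

namespace JacobiSystem

variable {p : ℕ → ℝ[X]}

lemma mul_le_jacobiEig (k : ℕ) : min 1 (α + β + 2) * k ≤ jacobiEig α β k := by
  rcases Nat.eq_zero_or_pos k with rfl | hk
  · simp [jacobiEig]
  · have : (1 : ℝ) ≤ k := by exact_mod_cast hk
    rw [jacobiEig, mul_comm]
    refine mul_le_mul_of_nonneg_left ((min_le_right _ _).trans ?_) (by positivity)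
    linarith

lemma summable_exp_jacobiEig (hα : -1 < α) (hβ : -1 < β) {t : ℝ} (ht : 0 < t) :
    Summable fun k : ℕ => exp (-jacobiEig α β k * t) := by
  set c := min 1 (α + β + 2)
  have hc : 0 < c := lt_min one_pos (by linarith)
  refine Summable.of_nonneg_of_le (fun k => (exp_pos _).le) (fun k => ?_)
    (summable_geometric_of_lt_one (r := exp (-(c * t))) (exp_pos _).le
      (exp_lt_one_iff.2 (by have := mul_pos hc ht; linarith)))
  rw [← exp_nat_mul, exp_le_exp]
  have := mul_le_mul_of_nonneg_right (mul_le_jacobiEig (α := α) (β := β) k) ht.le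
  change c * k * t ≤ _ at this
  linarith

lemma expNormSq_zero (f : ℝ[X]) :
    expNormSq α β 0 f = ∫ x, f.eval x ^ 2 ∂(jacobiMeasure α β) := by
  simp [expNormSq, expWeight, sq]

lemma heat_self (h : JacobiSystem α β p) (t : ℝ) (k : ℕ) :
    h.heat t (p k) = exp (-jacobiEig α β k * t) • p k := by
  refine h.ext_coef fun l => ?_
  rw [coef_heat, map_smul, coef_self, smul_eq_mul]
  split_ifs with hkl
  · rw [hkl]
  · simp

lemma exists_abs_exp_mul_eval_le (h : JacobiSystem α β p) {t : ℝ} (ht : 0 < t) :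
    ∃ M, 0 ≤ M ∧ ∀ k, ∀ x ∈ Icc (-1 : ℝ) 1, |exp (-jacobiEig α β k * t) * (p k).eval x| ≤ M := by
  obtain ⟨Q, hQ, H⟩ := exists_heat_pointwise_bound h.left_gt h.right_gt
  obtain ⟨v, hv, hV⟩ := exists_le_jacobiVol h.left_gt h.right_gt (sqrt_pos.2 ht)
  refine ⟨√(Q / v), sqrt_nonneg _, fun k x hx => abs_le_sqrt ?_⟩
  have h1 := H h 0 t x (p k) ht hx
  have h2 := h.orthonormal k k
  simp only [if_true, ← sq] at h2
  rw [heat_self, eval_smul, smul_eq_mul, expNormSq_zero, h2] at h1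
  simp only [expWeight, neg_zero, zero_mul, exp_zero, mul_one, ne_eq, OfNat.ofNat_ne_zero,
    not_false_eq_true, zero_pow, mul_zero] at h1
  rw [le_div_iff₀ hv]
  exact (mul_le_mul_of_nonneg_left (hV x hx) (sq_nonneg _)).trans h1

lemma exists_summable_bound (h : JacobiSystem α β p) {t : ℝ} (ht : 0 < t) :
    ∃ u : ℕ → ℝ, Summable u ∧ ∀ k, ∀ x ∈ Icc (-1 : ℝ) 1, ∀ y ∈ Icc (-1 : ℝ) 1,
      |exp (-jacobiEig α β k * t) * ((p k).eval x * (p k).eval y)| ≤ u k := by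
  obtain ⟨M, hM0, hM⟩ := h.exists_abs_exp_mul_eval_le (t := t / 4) (by positivity)
  refine ⟨fun k => M * M * exp (-jacobiEig α β k * (t / 2)),
    (summable_exp_jacobiEig h.left_gt h.right_gt (by positivity)).mul_left _,
    fun k x hx y hy => ?_⟩
  have h1 := mul_le_mul (hM k x hx) (hM k y hy) (abs_nonneg _) hM0
  rw [← abs_mul] at h1
  have e : exp (-jacobiEig α β k * t) = exp (-jacobiEig α β k * (t / 4)) *
      exp (-jacobiEig α β k * (t / 4)) * exp (-jacobiEig α β k * (t / 2)) := by
    rw [← exp_add, ← exp_add]; ring_nf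
  rw [e]
  have h2 := mul_le_mul_of_nonneg_right h1 (exp_pos (-jacobiEig α β k * (t / 2))).le
  refine le_trans (le_of_eq ?_) h2
  rw [← abs_of_pos (exp_pos (-jacobiEig α β k * (t / 2))), ← abs_mul, abs_of_pos (exp_pos _)]
  ring_nf

lemma hasSum_jacobiHeat (h : JacobiSystem α β p) {t x y : ℝ} (ht : 0 < t)
    (hx : x ∈ Icc (-1 : ℝ) 1) (hy : y ∈ Icc (-1 : ℝ) 1) :
    HasSum (fun k => exp (-jacobiEig α β k * t) * ((p k).eval x * (p k).eval y))
      (jacobiHeat α β p t x y) := by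
  obtain ⟨u, hu, hb⟩ := h.exists_summable_bound ht
  exact (Summable.of_norm_bounded hu fun k => hb k x hx y hy).hasSum

lemma continuousOn_jacobiHeat (h : JacobiSystem α β p) {t x : ℝ} (ht : 0 < t)
    (hx : x ∈ Icc (-1 : ℝ) 1) : ContinuousOn (jacobiHeat α β p t x) (Icc (-1) 1) := by
  obtain ⟨u, hu, hb⟩ := h.exists_summable_bound ht
  exact continuousOn_tsum (fun k => by fun_prop) hu fun k y hy => hb k x hx y hy

lemma jacobiHeat_comm (α β : ℝ) (p : ℕ → ℝ[X]) (t x y : ℝ) :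
    jacobiHeat α β p t x y = jacobiHeat α β p t y x := by
  simp only [jacobiHeat, mul_comm ((p _).eval x)]

lemma hasSum_integral_jacobiHeat_mul (h : JacobiSystem α β p) {t x : ℝ} (ht : 0 < t)
    (hx : x ∈ Icc (-1 : ℝ) 1) {g : ℝ → ℝ} (hg : ContinuousOn g (Icc (-1) 1)) :
    HasSum (fun k => exp (-jacobiEig α β k * t) * (p k).eval x *
        ∫ y, g y * (p k).eval y ∂(jacobiMeasure α β))
      (∫ y, jacobiHeat α β p t x y * g y ∂(jacobiMeasure α β)) := by
  have := isFiniteMeasure_jacobiMeasure h.left_gt h.right_gt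
  obtain ⟨u, hu, hb⟩ := h.exists_summable_bound ht
  obtain ⟨G, hG⟩ := isCompact_Icc.exists_bound_of_continuousOn hg
  have key := hasSum_integral_of_dominated_convergence (μ := jacobiMeasure α β)
    (F := fun k y => exp (-jacobiEig α β k * t) * (p k).eval x * (g y * (p k).eval y))
    (f := fun y => jacobiHeat α β p t x y * g y) (fun k _ => u k * G)
    (fun k => (integrable_jacobiMeasure h.left_gt h.right_gt
      (by fun_prop)).aestronglyMeasurable)
    (fun k => by
      filter_upwards [ae_jacobiMeasure_mem α β] with y hy
      have := mul_le_mul (hb k x hx y hy) (hG y hy) (norm_nonneg _)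
        ((abs_nonneg _).trans (hb k x hx y hy))
      rw [← norm_eq_abs, ← norm_mul] at this
      refine le_trans (le_of_eq ?_) this
      ring_nf)
    (ae_of_all _ fun _ => hu.mul_right G) (integrable_const _)
    (by
      filter_upwards [ae_jacobiMeasure_mem α β] with y hy
      refine ((h.hasSum_jacobiHeat ht hx hy).mul_right (g y)).congr_fun ?_
      intro k; ring)
  simpa only [integral_const_mul] using key

lemma integral_jacobiHeat_mul_eval (h : JacobiSystem α β p) {t x : ℝ} (ht : 0 < t)
    (hx : x ∈ Icc (-1 : ℝ) 1) (f : ℝ[X]) :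
    ∫ y, jacobiHeat α β p t x y * f.eval y ∂(jacobiMeasure α β) = (h.heat t f).eval x := by
  refine (h.hasSum_integral_jacobiHeat_mul ht hx f.continuous.continuousOn).unique ?_
  have hf := mem_degreeLT_succ f
  rw [h.heat_eq_sum t hf, eval_finsetSum]
  simp only [← h.coef_apply]
  convert hasSum_sum_of_ne_finset_zero (L := .unconditional ℕ)
    (s := Finset.range (f.natDegree + 1)) ?_ using 1
  · refine Finset.sum_congr rfl fun k _ => ?_
    rw [eval_smul, smul_eq_mul]; ring
  · intro k hk
    rw [h.coef_eq_zero hf (by simpa using hk), mul_zero]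

lemma integral_jacobiHeat_mul_jacobiHeat (h : JacobiSystem α β p) {s t x y : ℝ} (hs : 0 < s)
    (ht : 0 < t) (hx : x ∈ Icc (-1 : ℝ) 1) (hy : y ∈ Icc (-1 : ℝ) 1) :
    ∫ z, jacobiHeat α β p s x z * jacobiHeat α β p t y z ∂(jacobiMeasure α β) =
      jacobiHeat α β p (s + t) x y := by
  refine (h.hasSum_integral_jacobiHeat_mul hs hx (h.continuousOn_jacobiHeat ht hy)).unique ?_
  convert h.hasSum_jacobiHeat (add_pos hs ht) hx hy using 2 with k
  rw [h.integral_jacobiHeat_mul_eval ht hy, heat_self, eval_smul, smul_eq_mul, mul_add, exp_add]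
  ring

lemma integral_jacobiHeat (h : JacobiSystem α β p) {t x : ℝ} (ht : 0 < t)
    (hx : x ∈ Icc (-1 : ℝ) 1) : ∫ y, jacobiHeat α β p t x y ∂(jacobiMeasure α β) = 1 := by
  have := h.integral_jacobiHeat_mul_eval ht hx (C 1)
  simpa only [h.heat_C, eval_C, mul_one] using this

lemma integral_jacobiHeat_mul_nonneg (h : JacobiSystem α β p) {t x : ℝ} (ht : 0 < t)
    (hx : x ∈ Icc (-1 : ℝ) 1) {g : ℝ → ℝ} (hg : ContinuousOn g (Icc (-1) 1))
    (hg0 : ∀ y ∈ Icc (-1 : ℝ) 1, 0 ≤ g y) :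
    0 ≤ ∫ y, jacobiHeat α β p t x y * g y ∂(jacobiMeasure α β) := by
  obtain ⟨f, hf1, hf2, hf3⟩ := exists_polynomial_approx hg
  have hK := h.continuousOn_jacobiHeat ht hx
  obtain ⟨A, hA⟩ := isCompact_Icc.exists_bound_of_continuousOn hK
  obtain ⟨G, hG⟩ := isCompact_Icc.exists_bound_of_continuousOn hg
  refine ge_of_tendsto' (tendsto_integral_jacobiMeasure h.left_gt h.right_gt
    (F := fun n y => jacobiHeat α β p t x y * (f n).eval y) (M := A * (G + 2))
    (fun n => by fun_prop) (fun n y hy => ?_) fun y hy => (hf3 y hy).const_mul _) fun n => ?_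
  · rw [abs_mul]
    refine mul_le_mul (hA y hy) ?_ (abs_nonneg _) ((norm_nonneg _).trans (hA y hy))
    have := hg0 y hy
    have := hf1 n y hy
    have := hf2 n y hy
    have := (le_abs_self _).trans (hG y hy)
    rw [abs_of_nonneg (by linarith)]; linarith
  · rw [h.integral_jacobiHeat_mul_eval ht hx]
    exact h.heat_nonneg (fun y hy => (hg0 y hy).trans (hf1 n y hy)) ht.le hx

lemma jacobiHeat_nonneg (h : JacobiSystem α β p) {t x y : ℝ} (ht : 0 < t)
    (hx : x ∈ Icc (-1 : ℝ) 1) (hy : y ∈ Icc (-1 : ℝ) 1) : 0 ≤ jacobiHeat α β p t x y := by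
  have key {x : ℝ} (hx : x ∈ Icc (-1 : ℝ) 1) :
      ∀ᵐ z ∂(jacobiMeasure α β), 0 ≤ jacobiHeat α β p (t / 2) x z := by
    have hK := h.continuousOn_jacobiHeat (half_pos ht) hx
    set K := jacobiHeat α β p (t / 2) x
    have hg : ContinuousOn (fun z => max (-K z) 0) (Icc (-1) 1) := by fun_prop
    have h1 := h.integral_jacobiHeat_mul_nonneg (half_pos ht) hx hg fun _ _ => le_max_right _ _
    have h2 (z : ℝ) : K z * max (-K z) 0 = -(max (-K z) 0) ^ 2 := by
      rcases le_total (-K z) 0 with hz | hz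
      · simp [max_eq_right hz]
      · rw [max_eq_left hz]; ring
    change 0 ≤ ∫ z, K z * max (-K z) 0 ∂(jacobiMeasure α β) at h1
    simp only [h2, integral_neg] at h1
    have h3 := (integral_eq_zero_iff_of_nonneg (fun z => sq_nonneg (max (-K z) 0))
      (integrable_jacobiMeasure h.left_gt h.right_gt (hg.pow 2))).1
      (le_antisymm (by linarith) (integral_nonneg fun z => sq_nonneg _))
    filter_upwards [h3] with z hz
    have : max (-K z) 0 = 0 := by simpa using hz
    have := le_max_left (-K z) 0
    linarith
  have h4 := h.integral_jacobiHeat_mul_jacobiHeat (half_pos ht) (half_pos ht) hx hy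
  rw [add_halves] at h4
  rw [← h4]
  refine integral_nonneg_of_ae ?_
  filter_upwards [key hx, key hy] with z h1 h2 using mul_nonneg h1 h2

end JacobiSystem

end Kernel

section UpperBound

open Filter Topology

variable {α β : ℝ}

lemma expWeight_mul_expWeight (κ κ' x : ℝ) :
    expWeight κ x * expWeight κ' x = expWeight (κ + κ') x := by
  rw [expWeight, expWeight, expWeight, ← exp_add]; ring_nf

lemma expWeight_zero (x : ℝ) : expWeight 0 x = 1 := by simp [expWeight]

lemma expWeight_sq (κ x : ℝ) : expWeight κ x ^ 2 = expWeight (2 * κ) x := by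
  rw [sq, expWeight_mul_expWeight, two_mul]

namespace JacobiSystem

variable {p : ℕ → ℝ[X]}

lemma exists_integral_jacobiHeat_mul_bound (hα : -1 < α) (hβ : -1 < β) : ∃ Q > 0,
    ∀ {p : ℕ → ℝ[X]} (_ : JacobiSystem α β p) (κ t x : ℝ) (g : ℝ → ℝ), 0 < t →
      x ∈ Icc (-1 : ℝ) 1 → ContinuousOn g (Icc (-1) 1) →
      (∫ y, jacobiHeat α β p t x y * g y ∂(jacobiMeasure α β)) ^ 2 *
        (jacobiVol α β x √t * expWeight κ x) ≤
        Q * exp (4 * κ ^ 2 * t) * ∫ y, g y ^ 2 * expWeight κ y ∂(jacobiMeasure α β) := by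
  obtain ⟨Q, hQ, H⟩ := exists_heat_pointwise_bound hα hβ
  refine ⟨Q, hQ, fun {p} h κ t x g ht hx hg => ?_⟩
  obtain ⟨f, hf1, hf2, hf3⟩ := exists_polynomial_approx hg
  have hK := h.continuousOn_jacobiHeat ht hx
  have hw := continuous_expWeight κ
  obtain ⟨A, hA⟩ := isCompact_Icc.exists_bound_of_continuousOn hK
  obtain ⟨G, hG⟩ := isCompact_Icc.exists_bound_of_continuousOn hg
  obtain ⟨W, hW⟩ := isCompact_Icc.exists_bound_of_continuousOn
    (hw.continuousOn (s := Icc (-1) 1))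
  have hfb (n : ℕ) (y : ℝ) (hy : y ∈ Icc (-1 : ℝ) 1) : |(f n).eval y| ≤ G + 2 := by
    have h1 := hf1 n y hy
    have h2 := hf2 n y hy
    have h3 := abs_le.1 (hG y hy)
    rw [abs_le]; constructor <;> linarith
  have l1 := tendsto_integral_jacobiMeasure hα hβ
    (F := fun n y => jacobiHeat α β p t x y * (f n).eval y) (M := A * (G + 2))
    (fun n => by fun_prop) (fun n y hy => by
      rw [abs_mul]
      exact mul_le_mul (hA y hy) (hfb n y hy) (abs_nonneg _) ((norm_nonneg _).trans (hA y hy)))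
    fun y hy => (hf3 y hy).const_mul _
  have l2 := tendsto_integral_jacobiMeasure hα hβ
    (F := fun n y => (f n).eval y ^ 2 * expWeight κ y) (M := (G + 2) ^ 2 * W)
    (fun n => by fun_prop) (fun n y hy => by
      rw [abs_mul, abs_pow]
      exact mul_le_mul (pow_le_pow_left₀ (abs_nonneg _) (hfb n y hy) 2) (hW y hy)
        (abs_nonneg _) (sq_nonneg _))
    fun y hy => ((hf3 y hy).pow 2).mul_const _
  refine le_of_tendsto_of_tendsto' ((l1.pow 2).mul_const _) (l2.const_mul _) fun n => ?_
  rw [h.integral_jacobiHeat_mul_eval ht hx]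
  simpa only [expNormSq, ← sq] using H h κ t x (f n) ht hx

/-- The weighted `L²` norm of the heat kernel satisfies a Gaussian-type bound. -/
lemma exists_weighted_norm_jacobiHeat_bound (hα : -1 < α) (hβ : -1 < β) : ∃ Q > 0,
    ∀ {p : ℕ → ℝ[X]} (_ : JacobiSystem α β p) (κ t x : ℝ), 0 < t → x ∈ Icc (-1 : ℝ) 1 →
      (∫ y, jacobiHeat α β p t x y ^ 2 * expWeight κ y ∂(jacobiMeasure α β)) *
        (jacobiVol α β x √t * expWeight (-κ) x) ≤ Q * exp (4 * κ ^ 2 * t) := by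
  obtain ⟨Q, hQ, H⟩ := exists_integral_jacobiHeat_mul_bound hα hβ
  refine ⟨Q, hQ, fun {p} h κ t x ht hx => ?_⟩
  have hK := h.continuousOn_jacobiHeat ht hx
  have hw := continuous_expWeight κ
  have h1 := H h (-κ) t x (fun y => jacobiHeat α β p t x y * expWeight κ y) ht hx (by fun_prop)
  have e1 (y : ℝ) : jacobiHeat α β p t x y * (jacobiHeat α β p t x y * expWeight κ y) =
      jacobiHeat α β p t x y ^ 2 * expWeight κ y := by ring
  have e2 (y : ℝ) : (jacobiHeat α β p t x y * expWeight κ y) ^ 2 * expWeight (-κ) y =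
      jacobiHeat α β p t x y ^ 2 * expWeight κ y := by
    rw [mul_pow, expWeight_sq, mul_assoc, expWeight_mul_expWeight]; ring_nf
  simp only [e1, e2, neg_sq] at h1
  set W := ∫ y, jacobiHeat α β p t x y ^ 2 * expWeight κ y ∂(jacobiMeasure α β) with hW
  have hW0 : 0 ≤ W := integral_nonneg fun y => mul_nonneg (sq_nonneg _) (expWeight_pos κ y).le
  rcases hW0.eq_or_lt with h0 | h0
  · rw [← h0, zero_mul]; positivity
  · refine le_of_mul_le_mul_left ?_ h0
    linarith

/-- The Gaussian upper bound for the Jacobi heat kernel. -/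
lemma exists_jacobiHeat_le (hα : -1 < α) (hβ : -1 < β) : ∃ Q > 0,
    ∀ {p : ℕ → ℝ[X]} (_ : JacobiSystem α β p) (t x y : ℝ), 0 < t → x ∈ Icc (-1 : ℝ) 1 →
      y ∈ Icc (-1 : ℝ) 1 → jacobiHeat α β p t x y * √(jacobiVol α β x √t * jacobiVol α β y √t) ≤
        Q * exp (-(jacobiDist x y) ^ 2 / (32 * t)) := by
  obtain ⟨Q, hQ, H⟩ := exists_weighted_norm_jacobiHeat_bound hα hβ
  obtain ⟨D, hD1, hD⟩ := exists_doubling hα hβ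
  have hD0 : 0 < D := by linarith
  refine ⟨Q * D, by positivity, fun {p} h t x y ht hx hy => ?_⟩
  have hs : 0 < t / 2 := half_pos ht
  set κ := (arccos x - arccos y) / (8 * t) with hκ
  have hvol {z : ℝ} (hz : z ∈ Icc (-1 : ℝ) 1) :
      jacobiVol α β z √t ≤ D * jacobiVol α β z √(t / 2) := by
    refine le_trans (jacobiVol_mono hα hβ z ?_) (hD z hz _ (sqrt_pos.2 hs))
    rw [sqrt_le_left (by positivity), mul_pow, sq_sqrt hs.le]; linarith
  have hKx := h.continuousOn_jacobiHeat hs hx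
  have hKy := h.continuousOn_jacobiHeat hs hy
  have hw := continuous_expWeight (κ / 2)
  have hw' := continuous_expWeight (-(κ / 2))
  have h1 := sq_integral_mul_le hα hβ
    (f := fun z => jacobiHeat α β p (t / 2) x z * expWeight (κ / 2) z)
    (g := fun z => jacobiHeat α β p (t / 2) y z * expWeight (-(κ / 2)) z) (by fun_prop)
    (by fun_prop)
  have e1 (z : ℝ) : jacobiHeat α β p (t / 2) x z * expWeight (κ / 2) z *
      (jacobiHeat α β p (t / 2) y z * expWeight (-(κ / 2)) z) =
      jacobiHeat α β p (t / 2) x z * jacobiHeat α β p (t / 2) y z := by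
    rw [mul_mul_mul_comm, expWeight_mul_expWeight, add_neg_cancel, expWeight_zero, mul_one]
  simp only [e1, mul_pow, expWeight_sq] at h1
  rw [h.integral_jacobiHeat_mul_jacobiHeat hs hs hx hy, add_halves,
    show 2 * (κ / 2) = κ by ring, show 2 * -(κ / 2) = -κ by ring] at h1
  have h2 := H h κ (t / 2) x hs hx
  have h3 := H h (-κ) (t / 2) y hs hy
  rw [neg_neg, neg_sq] at h3
  set Wx := ∫ z, jacobiHeat α β p (t / 2) x z ^ 2 * expWeight κ z ∂(jacobiMeasure α β)
  set Wy := ∫ z, jacobiHeat α β p (t / 2) y z ^ 2 * expWeight (-κ) z ∂(jacobiMeasure α β)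
  have hWy0 : 0 ≤ Wy := integral_nonneg fun z => mul_nonneg (sq_nonneg _) (expWeight_pos _ z).le
  have hφ : expWeight (-κ) x * expWeight κ y = exp (κ * (arccos x - arccos y)) := by
    rw [expWeight, expWeight, ← exp_add]; ring_nf
  have hV0 (z r : ℝ) : 0 ≤ jacobiVol α β z r := measureReal_nonneg
  have h4 := mul_le_mul h2 h3 (mul_nonneg hWy0 (mul_nonneg (hV0 _ _) (expWeight_pos _ _).le))
    (by positivity)
  have h5 : jacobiHeat α β p t x y ^ 2 *
      (jacobiVol α β x √(t / 2) * jacobiVol α β y √(t / 2)) * exp (κ * (arccos x - arccos y)) ≤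
      (Q * exp (4 * κ ^ 2 * (t / 2))) ^ 2 := by
    rw [← hφ]
    calc _ ≤ Wx * Wy * (jacobiVol α β x √(t / 2) * jacobiVol α β y √(t / 2)) *
          (expWeight (-κ) x * expWeight κ y) := by
          have := mul_nonneg (hV0 x √(t / 2)) (hV0 y √(t / 2))
          have := mul_pos (expWeight_pos (-κ) x) (expWeight_pos κ y)
          gcongr
      _ ≤ _ := by rw [sq]; refine le_trans (le_of_eq ?_) h4; ring
  have hexp : exp (4 * κ ^ 2 * (t / 2)) ^ 2 * exp (-(κ * (arccos x - arccos y))) =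
      exp (-(jacobiDist x y) ^ 2 / (32 * t)) ^ 2 := by
    rw [← exp_nat_mul, ← exp_nat_mul, ← exp_add, jacobiDist, sq_abs, hκ]
    congr 1
    push_cast
    field_simp
    ring
  refine abs_le_of_sq_le_sq' ?_ (by positivity) |>.2
  rw [mul_pow, sq_sqrt (mul_nonneg (hV0 _ _) (hV0 _ _)), mul_pow, ← hexp]
  have h6 := mul_le_mul_of_nonneg_right h5 (exp_pos (-(κ * (arccos x - arccos y)))).le
  rw [mul_assoc, ← exp_add, add_neg_cancel, exp_zero, mul_one] at h6
  have h7 := mul_le_mul (hvol hx) (hvol hy) (hV0 _ _) (mul_nonneg hD0.le (hV0 _ _))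
  calc _ ≤ jacobiHeat α β p t x y ^ 2 *
        (D * jacobiVol α β x √(t / 2) * (D * jacobiVol α β y √(t / 2))) := by gcongr
    _ = D ^ 2 * (jacobiHeat α β p t x y ^ 2 *
        (jacobiVol α β x √(t / 2) * jacobiVol α β y √(t / 2))) := by ring
    _ ≤ D ^ 2 * ((Q * exp (4 * κ ^ 2 * (t / 2))) ^ 2 *
        exp (-(κ * (arccos x - arccos y)))) := by gcongr
    _ = _ := by ring

end JacobiSystem

end UpperBound

section DiagonalBound

variable {α β : ℝ}

lemma sin_le_two_mul_sin_half_add {a b : ℝ} (ha : 0 ≤ a) (hab : a ≤ b) (hb : b ≤ π) :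
    sin ((b - a) / 2) ≤ sin ((a + b) / 2) ∧ sin a ≤ 2 * sin ((a + b) / 2) ∧
      sin b ≤ 2 * sin ((a + b) / 2) := by
  set m := (a + b) / 2 with hm
  set d := (b - a) / 2 with hd
  have hD : 0 ≤ sin d := sin_nonneg_of_nonneg_of_le_pi (by linarith) (by linarith)
  have hS : 0 ≤ sin m := sin_nonneg_of_nonneg_of_le_pi (by linarith) (by linarith)
  have h1 : sin d ≤ sin m := by
    have h2 := sin_sub_sin m d
    have h3 : 0 ≤ sin ((m - d) / 2) :=
      sin_nonneg_of_nonneg_of_le_pi (by linarith) (by linarith)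
    have h4 : 0 ≤ cos ((m + d) / 2) := cos_nonneg_of_neg_pi_div_two_le_of_le (by linarith)
      (by linarith)
    have := mul_nonneg h3 h4
    linarith
  have ea : a = m - d := by rw [hm, hd]; ring
  have eb : b = m + d := by rw [hm, hd]; ring
  have h5 := mul_le_mul_of_nonneg_left (cos_le_one d) hS
  have h6 := mul_le_mul_of_nonneg_left (cos_le_one m) hD
  have h7 := mul_le_mul_of_nonneg_left (neg_one_le_cos m) hD
  refine ⟨h1, ?_, ?_⟩
  · rw [ea, sin_sub]; linarith
  · rw [eb, sin_add]; linarith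

/-- The squared Euclidean distance on `[-1,1]` dominates the angular one. -/
lemma le_sq_sub_of_jacobiDist {x z : ℝ} (hx : x ∈ Icc (-1 : ℝ) 1) (hz : z ∈ Icc (-1 : ℝ) 1) :
    (1 - x ^ 2) / 2 * (jacobiDist x z / π) ^ 2 + 2 * (jacobiDist x z / π) ^ 4 ≤ (z - x) ^ 2 := by
  have key {a b σ : ℝ} (ha : 0 ≤ a) (hab : a ≤ b) (hb : b ≤ π) (hσ0 : 0 ≤ σ)
      (hσ : σ ≤ 2 * sin ((a + b) / 2)) :
      σ ^ 2 / 2 * (|b - a| / π) ^ 2 + 2 * (|b - a| / π) ^ 4 ≤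
        4 * sin ((a + b) / 2) ^ 2 * sin ((b - a) / 2) ^ 2 := by
    obtain ⟨h1, -, -⟩ := sin_le_two_mul_sin_half_add ha hab hb
    have h2 := mul_le_sin (x := (b - a) / 2) (by linarith) (by linarith)
    rw [abs_of_nonneg (by linarith), show (b - a) / π = 2 / π * ((b - a) / 2) by ring]
    set u := 2 / π * ((b - a) / 2)
    have hu : 0 ≤ u := mul_nonneg (by positivity) (by linarith)
    set S := sin ((a + b) / 2)
    set D := sin ((b - a) / 2)
    have h3 : u ^ 2 ≤ D ^ 2 := pow_le_pow_left₀ hu h2 2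
    have h4 : u ^ 2 ≤ S ^ 2 := pow_le_pow_left₀ hu (h2.trans h1) 2
    have h5 : σ ^ 2 ≤ (2 * S) ^ 2 := pow_le_pow_left₀ hσ0 hσ 2
    have h6 := mul_le_mul h5 h3 (sq_nonneg _) (sq_nonneg _)
    have h7 := mul_le_mul h4 h3 (sq_nonneg _) (sq_nonneg _)
    nlinarith
  have e1 : (z - x) ^ 2 = 4 * sin ((arccos x + arccos z) / 2) ^ 2 *
      sin ((arccos z - arccos x) / 2) ^ 2 := by
    have := cos_sub_cos (arccos z) (arccos x)
    rw [cos_arccos hz.1 hz.2, cos_arccos hx.1 hx.2, add_comm (arccos z)] at this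
    rw [this]; ring
  have e2 : 1 - x ^ 2 = sin (arccos x) ^ 2 := by rw [sin_sq, cos_arccos hx.1 hx.2]
  have hs : 0 ≤ sin (arccos x) :=
    sin_nonneg_of_nonneg_of_le_pi (arccos_nonneg x) (arccos_le_pi x)
  rw [e1, e2, jacobiDist]
  rcases le_total (arccos x) (arccos z) with hxz | hxz
  · rw [abs_sub_comm]
    exact key (arccos_nonneg x) hxz (arccos_le_pi z) hs
      (sin_le_two_mul_sin_half_add (arccos_nonneg x) hxz (arccos_le_pi z)).2.1
  · have h1 := (sin_le_two_mul_sin_half_add (arccos_nonneg z) hxz (arccos_le_pi x)).2.2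
    have h2 := key (arccos_nonneg z) hxz (arccos_le_pi x) hs h1
    rw [add_comm (arccos x), ← neg_sub (arccos x), neg_div, sin_neg, neg_sq]
    exact h2

namespace JacobiSystem

variable {p : ℕ → ℝ[X]}

lemma eval_heat_le (h : JacobiSystem α β p) (f : ℝ[X]) {t x M : ℝ} (ht : 0 ≤ t)
    (hM : ∀ s ∈ Icc 0 t, (h.heat s (jacobiOp α β f)).eval x ≤ M) :
    (h.heat t f).eval x ≤ f.eval x + M * t := by
  have hd (s : ℝ) := h.hasDerivAt_eval_heat s x f
  have := (convex_Icc 0 t).image_sub_le_mul_sub_of_deriv_le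
    (f := fun s => (h.heat s f).eval x) (C := M)
    (fun s _ => (hd s).continuousAt.continuousWithinAt)
    (fun s _ => (hd s).differentiableAt.differentiableWithinAt)
    (fun s hs => by rw [(hd s).deriv]; exact hM s (interior_subset hs))
    0 ⟨le_rfl, ht⟩ t ⟨ht, le_rfl⟩ ht
  rw [h.heat_zero, sub_zero] at this
  linarith

lemma eval_heat_le_of_forall_le (h : JacobiSystem α β p) (f : ℝ[X]) {t x M : ℝ} (ht : 0 ≤ t)
    (hx : x ∈ Icc (-1 : ℝ) 1) (hM : ∀ z ∈ Icc (-1 : ℝ) 1, (jacobiOp α β f).eval z ≤ M) :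
    (h.heat t f).eval x ≤ f.eval x + M * t :=
  h.eval_heat_le f ht fun s hs => by
    have := h.heat_mono (f := jacobiOp α β f) (g := C M) (fun z hz => by simpa using hM z hz)
      hs.1 hx
    rwa [h.heat_C, eval_C] at this

/-- A second moment bound for the Jacobi heat semigroup. -/
lemma exists_second_moment_bound (hα : -1 < α) (hβ : -1 < β) : ∃ M ≥ 0,
    ∀ {p : ℕ → ℝ[X]} (h : JacobiSystem α β p) (t x : ℝ), 0 ≤ t → x ∈ Icc (-1 : ℝ) 1 →
      (h.heat t ((X - C x) ^ 2)).eval x ≤ 2 * t * (1 - x ^ 2) + M * t ^ 2 := by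
  set B := |β - α| + |α + β + 2| with hB
  have hB0 : 0 ≤ B := by positivity
  have hb {z : ℝ} (hz : z ∈ Icc (-1 : ℝ) 1) : |β - α - (α + β + 2) * z| ≤ B := by
    refine (abs_sub _ _).trans (add_le_add_right ?_ _)
    rw [abs_mul]
    exact mul_le_of_le_one_right (abs_nonneg _) (abs_le.2 hz)
  refine ⟨4 * B + 2 * B ^ 2, by positivity, fun {p} h t x ht hx => ?_⟩
  set b := β - α - (α + β + 2) * x with hbx
  set f : ℝ[X] := C 2 * (1 - X ^ 2) + C (2 * b) * (X - C x) with hf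
  have h1 (s : ℝ) (hs : 0 ≤ s) : (h.heat s f).eval x ≤ 2 * (1 - x ^ 2) +
      (4 * B + 2 * B ^ 2) * s := by
    have := h.eval_heat_le_of_forall_le f (M := 4 * B + 2 * B ^ 2) hs hx fun z hz => by
      rw [eval_jacobiOp, hf]
      simp only [derivative_add, derivative_mul, derivative_C, derivative_sub, derivative_one,
        derivative_X_pow, derivative_X, eval_add, eval_mul, eval_C, eval_X, zero_mul, zero_add,
        zero_sub,
        derivative_neg, eval_neg, Nat.cast_ofNat, Nat.add_one_sub_one, pow_one, sub_zero, mul_one,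
        add_zero]
      have h2 := abs_le.1 (hb hz)
      have h3 : b * (β - α - (α + β + 2) * z) ≤ B * B := by
        refine (le_abs_self _).trans ?_
        rw [abs_mul]
        exact mul_le_mul (hb hx) (hb hz) (abs_nonneg _) hB0
      have h4 : -(z * (β - α - (α + β + 2) * z)) ≤ B := by
        refine (neg_le_abs _).trans ?_
        rw [abs_mul]
        exact (mul_le_of_le_one_left (abs_nonneg _) (abs_le.2 hz)).trans (hb hz)
      have h5 : 0 ≤ 1 - z ^ 2 := by nlinarith [hz.1, hz.2]
      nlinarith
    refine this.trans (le_of_eq ?_)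
    simp [hf]
  have h2 (s : ℝ) (hs : s ∈ Icc 0 t) : (h.heat s (jacobiOp α β ((X - C x) ^ 2))).eval x ≤
      2 * (1 - x ^ 2) + (4 * B + 2 * B ^ 2) * t := by
    refine (h.heat_mono (g := f) (fun z hz => ?_) hs.1 hx).trans ((h1 s hs.1).trans ?_)
    · rw [eval_jacobiOp, hf, hbx]
      simp only [derivative_pow, derivative_mul, derivative_C, derivative_sub, derivative_X,
        eval_add, eval_mul, eval_C, eval_sub, eval_pow, eval_X, eval_one,
        Nat.cast_ofNat, Nat.add_one_sub_one, pow_one, sub_zero, mul_one, zero_mul, zero_add]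
      have : 0 ≤ (α + β + 2) * (z - x) ^ 2 := mul_nonneg (by linarith) (sq_nonneg _)
      nlinarith
    · have := mul_le_mul_of_nonneg_left hs.2 (show 0 ≤ 4 * B + 2 * B ^ 2 by positivity)
      linarith
  refine (h.eval_heat_le _ ht h2).trans (le_of_eq ?_)
  simp; ring

/-- The on-diagonal lower bound for the Jacobi heat kernel. -/
lemma exists_le_jacobiHeat_self (hα : -1 < α) (hβ : -1 < β) : ∃ c > 0,
    ∀ {p : ℕ → ℝ[X]} (_ : JacobiSystem α β p) (t x : ℝ), 0 < t → x ∈ Icc (-1 : ℝ) 1 →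
      c ≤ jacobiHeat α β p t x x * jacobiVol α β x √t := by
  have := isFiniteMeasure_jacobiMeasure hα hβ
  obtain ⟨M, hM0, hM⟩ := exists_second_moment_bound hα hβ
  set A := π * (3 + M) with hA
  have hA0 : 0 < A := by positivity
  obtain ⟨D, hD0, hD⟩ := exists_jacobiVol_mul_le hα hβ (ε := 1 / A) (by positivity)
  refine ⟨1 / (4 * D), by positivity, fun {p} h t' x ht' hx => ?_⟩
  obtain ⟨t, rfl⟩ : ∃ t, t' = t + t := ⟨t' / 2, (add_halves t').symm⟩
  have ht : 0 < t := by linarith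
  have hs := sqrt_pos.2 ht
  set V := jacobiVol α β x (A * √t) with hV
  have hV0 : 0 < V := jacobiVol_pos hα hβ hx (by positivity)
  have hVD : V ≤ D * jacobiVol α β x √(t + t) := by
    refine (hD x hx (A * √t) (by positivity)).trans (mul_le_mul_of_nonneg_left ?_ hD0.le)
    rw [← mul_assoc, one_div_mul_cancel hA0.ne', one_mul]
    exact jacobiVol_mono hα hβ x (sqrt_le_sqrt (by linarith))
  set K := jacobiHeat α β p t x with hKdef
  have hK := h.continuousOn_jacobiHeat ht hx
  rw [← hKdef] at hK
  set S := {z | jacobiDist x z < A * √t} with hS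
  have hSm : MeasurableSet S := measurableSet_jacobiBall x _
  set m := 2 * t * (1 - x ^ 2) + (M + 1) * t ^ 2 with hm
  have hx2 : 0 ≤ 1 - x ^ 2 := by nlinarith [hx.1, hx.2]
  have hm0 : 0 < m := by positivity
  have hq : ∀ z ∈ Icc (-1 : ℝ) 1, z ∉ S → 2 * m ≤ (z - x) ^ 2 := by
    intro z hz hzS
    have h1 : (3 + M) * √t ≤ jacobiDist x z / π := by
      rw [le_div_iff₀ pi_pos]
      have : A * √t ≤ jacobiDist x z := not_lt.1 hzS
      rw [hA] at this; linarith
    refine le_trans ?_ (le_sq_sub_of_jacobiDist hx hz)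
    have h2 := pow_le_pow_left₀ (by positivity) h1 2
    rw [mul_pow, sq_sqrt ht.le] at h2
    have h4 : ((3 + M) ^ 2 * t) ^ 2 ≤ (jacobiDist x z / π) ^ 4 := by
      have := pow_le_pow_left₀ (by positivity) h2 2
      rwa [← pow_mul] at this
    have h5 : 8 * t ≤ (3 + M) ^ 2 * t := mul_le_mul_of_nonneg_right (by nlinarith) ht.le
    have h6 : (1 - x ^ 2) / 2 * (8 * t) ≤ (1 - x ^ 2) / 2 * (jacobiDist x z / π) ^ 2 :=
      mul_le_mul_of_nonneg_left (h5.trans h2) (by positivity)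
    have h7 : (M + 1) * t ^ 2 ≤ ((3 + M) ^ 2 * t) ^ 2 := by
      rw [mul_pow]
      have h8 : M + 1 ≤ (3 + M) ^ 2 := by nlinarith
      have : M + 1 ≤ ((3 + M) ^ 2) ^ 2 := by nlinarith
      exact mul_le_mul_of_nonneg_right this (sq_nonneg t)
    rw [hm]; linarith
  have hpt (z : ℝ) (hz : z ∈ Icc (-1 : ℝ) 1) : K z ≤ V * (K z * K z) +
      S.indicator (fun _ => 1 / (4 * V)) z +
        K z * ((X - C x) ^ 2 : ℝ[X]).eval z * (1 / (2 * m)) := by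
    have hK0 : 0 ≤ K z := h.jacobiHeat_nonneg ht hx hz
    have e : ((X - C x) ^ 2 : ℝ[X]).eval z = (z - x) ^ 2 := by simp
    rw [e]
    by_cases hzS : z ∈ S
    · rw [indicator_of_mem hzS]
      have h1 : V * (K z * K z) + 1 / (4 * V) - K z = (2 * V * K z - 1) ^ 2 / (4 * V) := by
        field_simp; ring
      have h2 : 0 ≤ (2 * V * K z - 1) ^ 2 / (4 * V) := by positivity
      have h3 : 0 ≤ K z * (z - x) ^ 2 * (1 / (2 * m)) := by positivity
      linarith
    · rw [indicator_of_notMem hzS]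
      have h1 : K z * (2 * m) * (1 / (2 * m)) ≤ K z * (z - x) ^ 2 * (1 / (2 * m)) := by
        have := hq z hz hzS
        gcongr
      rw [mul_assoc, mul_one_div_cancel (by positivity), mul_one] at h1
      have : 0 ≤ V * (K z * K z) := by positivity
      linarith
  have i1 : Integrable K (jacobiMeasure α β) := integrable_jacobiMeasure hα hβ hK
  have i2 : Integrable (fun z => V * (K z * K z)) (jacobiMeasure α β) :=
    integrable_jacobiMeasure hα hβ (by fun_prop)
  have i3 : Integrable (S.indicator fun _ => 1 / (4 * V)) (jacobiMeasure α β) :=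
    (integrable_const _).indicator hSm
  have i4 : Integrable (fun z => K z * ((X - C x) ^ 2 : ℝ[X]).eval z * (1 / (2 * m)))
      (jacobiMeasure α β) := integrable_jacobiMeasure hα hβ (by fun_prop)
  have h1 := integral_mono_ae i1 ((i2.add i3).add i4) (by
    filter_upwards [ae_jacobiMeasure_mem α β] with z hz using hpt z hz)
  have h2 := integral_add (i2.add i3) i4
  have h3 := integral_add i2 i3
  simp only [Pi.add_apply] at h1 h2 h3
  rw [h2, h3, h.integral_jacobiHeat ht hx, integral_const_mul, integral_mul_const,
    h.integral_jacobiHeat_mul_jacobiHeat ht ht hx hx, h.integral_jacobiHeat_mul_eval ht hx,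
    integral_indicator_const _ hSm, smul_eq_mul,
    show (jacobiMeasure α β).real S = V from rfl] at h1
  have h4 : V * (1 / (4 * V)) = 1 / 4 := by field_simp
  have h5 : (h.heat t ((X - C x) ^ 2)).eval x * (1 / (2 * m)) ≤ 1 / 2 := by
    have : (h.heat t ((X - C x) ^ 2)).eval x ≤ m := (hM h t x ht.le hx).trans (by
      rw [hm]; nlinarith [sq_nonneg t])
    rw [mul_one_div, div_le_iff₀ (by positivity)]
    linarith
  have h6 : 0 ≤ jacobiHeat α β p (t + t) x x := h.jacobiHeat_nonneg ht' hx hx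
  have h7 := mul_le_mul_of_nonneg_right hVD h6
  rw [div_le_iff₀ (by positivity)]
  linarith

end JacobiSystem

end DiagonalBound

section LowerBound

open Filter Topology

variable {α β : ℝ}

/-- A point dividing the arc from `x` to `y` into pieces of lengths `n * r` and `2 * r`. -/
lemma exists_intermediate_point (x y : ℝ) {r : ℝ} (n : ℕ) (h : jacobiDist x y ≤ (n + 2) * r) :
    ∃ w ∈ Icc (-1 : ℝ) 1, jacobiDist x w ≤ n * r ∧ jacobiDist w y ≤ 2 * r := by
  set a := arccos x with ha
  set b := arccos y with hb
  set l : ℝ := 2 / (n + 2) with hl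
  have hn : (0 : ℝ) < n + 2 := by positivity
  have hl0 : 0 ≤ l := by positivity
  have hl1 : l ≤ 1 := by
    rw [hl, div_le_one hn]
    linarith [n.cast_nonneg (α := ℝ)]
  have hr : |a - b| / (n + 2) ≤ r := by rw [div_le_iff₀ hn, mul_comm]; exact h
  have hθ0 : 0 ≤ (1 - l) * b + l * a := add_nonneg
    (mul_nonneg (by linarith) (arccos_nonneg y)) (mul_nonneg hl0 (arccos_nonneg x))
  have hθ1 : (1 - l) * b + l * a ≤ π := by
    have h1 := mul_le_mul_of_nonneg_left (arccos_le_pi y) (show 0 ≤ 1 - l by linarith)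
    have h2 := mul_le_mul_of_nonneg_left (arccos_le_pi x) hl0
    linarith
  refine ⟨cos ((1 - l) * b + l * a), cos_mem_Icc _, ?_, ?_⟩
  · rw [jacobiDist, arccos_cos hθ0 hθ1, ← ha,
      show a - ((1 - l) * b + l * a) = (1 - l) * (a - b) by ring, abs_mul,
      abs_of_nonneg (by linarith)]
    have e : (1 - l) * |a - b| = n * (|a - b| / (n + 2)) := by rw [hl]; field_simp; ring
    rw [e]
    gcongr
  · rw [jacobiDist, arccos_cos hθ0 hθ1, ← hb,
      show (1 - l) * b + l * a - b = l * (a - b) by ring, abs_mul, abs_of_nonneg hl0]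
    have e : l * |a - b| = 2 * (|a - b| / (n + 2)) := by rw [hl]; field_simp
    rw [e]
    gcongr

namespace JacobiSystem

variable {p : ℕ → ℝ[X]}

lemma sum_abs_le (h : JacobiSystem α β p) {t x z : ℝ} (ht : 0 < t) (hx : x ∈ Icc (-1 : ℝ) 1)
    (hz : z ∈ Icc (-1 : ℝ) 1) (n : ℕ) :
    ∑ k ∈ Finset.range n, exp (-jacobiEig α β k * t) * |(p k).eval x * (p k).eval z| ≤
      (jacobiHeat α β p t x x + jacobiHeat α β p t z z) / 2 := by
  have key {y : ℝ} (hy : y ∈ Icc (-1 : ℝ) 1) :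
      ∑ k ∈ Finset.range n, exp (-jacobiEig α β k * t) * ((p k).eval y * (p k).eval y) ≤
        jacobiHeat α β p t y y :=
    sum_le_hasSum _ (fun k _ => mul_nonneg (exp_pos _).le (mul_self_nonneg _))
      (h.hasSum_jacobiHeat ht hy hy)
  refine le_trans ?_ (div_le_div_of_nonneg_right (add_le_add (key hx) (key hz)) zero_le_two)
  rw [← Finset.sum_add_distrib, Finset.sum_div]
  refine Finset.sum_le_sum fun k _ => ?_
  rw [abs_mul, ← mul_add, mul_div_assoc]
  refine mul_le_mul_of_nonneg_left ?_ (exp_pos _).le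
  have := sq_nonneg (|(p k).eval x| - |(p k).eval z|)
  have := abs_mul_abs_self ((p k).eval x)
  have := abs_mul_abs_self ((p k).eval z)
  linarith

lemma mul_exp_neg_le {l t : ℝ} (ht : 0 < t) :
    l * exp (-l * t) ≤ 2 / t * exp (-l * (t / 2)) := by
  have h1 := add_one_le_exp (l * (t / 2))
  have h2 : l ≤ 2 / t * exp (l * (t / 2)) := by
    rw [div_mul_eq_mul_div, le_div_iff₀ ht]; linarith
  calc _ ≤ 2 / t * exp (l * (t / 2)) * exp (-l * t) := by gcongr
    _ = _ := by rw [mul_assoc, ← exp_add]; ring_nf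

/-- The near-diagonal lower bound for the Jacobi heat kernel. -/
lemma exists_le_jacobiHeat_near (hα : -1 < α) (hβ : -1 < β) : ∃ ε > 0, ∃ c > 0,
    ∀ {p : ℕ → ℝ[X]} (_ : JacobiSystem α β p) (t x y : ℝ), 0 < t → x ∈ Icc (-1 : ℝ) 1 →
      y ∈ Icc (-1 : ℝ) 1 → jacobiDist x y ≤ ε * √t →
      c ≤ jacobiHeat α β p t x y * jacobiVol α β x √t := by
  obtain ⟨c, hc, hdiag⟩ := exists_le_jacobiHeat_self hα hβ
  obtain ⟨Q, hQ, hup⟩ := exists_jacobiHeat_le hα hβ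
  obtain ⟨D, hD1, hD⟩ := exists_doubling hα hβ
  obtain ⟨K, hK, hosc⟩ := exists_oscillation_bound hα hβ
  have hD0 : 0 < D := by linarith
  set E := D ^ 2 * Q with hE
  have hE0 : 0 < E := by positivity
  set ε := min (1 / 2) (c / (6 * K * E)) with hε
  have hε0 : 0 < ε := by positivity
  have hε1 : ε ≤ 1 / 2 := min_le_left _ _
  have hε2 : 3 * K * E * ε ≤ c / 2 := by
    have : ε ≤ c / (6 * K * E) := min_le_right _ _
    rw [le_div_iff₀ (by positivity)] at this
    linarith
  refine ⟨ε, hε0, c / 2, by positivity, fun {p} h t x y ht hx hy hxy => ?_⟩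
  have hs := sqrt_pos.2 ht
  set V := jacobiVol α β x √t with hV
  have hV0 : 0 < V := jacobiVol_pos hα hβ hx hs
  have hself {s z : ℝ} (hst : t / 4 ≤ s) (hz : z ∈ Icc (-1 : ℝ) 1) (hxz : jacobiDist x z ≤ √t) :
      jacobiHeat α β p s z z ≤ E / V := by
    have hs0 : 0 < s := by linarith
    have h1 := hup h s z z hs0 hz hz
    rw [sqrt_mul_self (show 0 ≤ jacobiVol α β z √s from measureReal_nonneg), jacobiDist_self] at h1
    simp only [ne_eq, OfNat.ofNat_ne_zero, not_false_eq_true, zero_pow, neg_zero, zero_div,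
      exp_zero, mul_one] at h1
    have h2 : V ≤ jacobiVol α β z (2 * √t) := jacobiVol_le_of_subset hα hβ (by linarith)
    have h3 := hD z hz √t hs
    have h4 : jacobiVol α β z √t ≤ jacobiVol α β z (2 * √s) :=
      jacobiVol_mono hα hβ z (by
        rw [sqrt_le_left (by positivity), mul_pow, sq_sqrt hs0.le]; linarith)
    have h5 := hD z hz √s (sqrt_pos.2 hs0)
    have h6 : V ≤ D ^ 2 * jacobiVol α β z √s := by nlinarith
    have h7 := mul_le_mul_of_nonneg_left h6 (h.jacobiHeat_nonneg hs0 hz hz)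
    rw [le_div_iff₀ hV0, hE]
    have h8 := mul_le_mul_of_nonneg_left h1 (sq_nonneg D)
    linarith
  have hsum {s z : ℝ} (hst : t / 4 ≤ s) (hz : z ∈ Icc (-1 : ℝ) 1) (hxz : jacobiDist x z ≤ √t)
      (n : ℕ) : ∑ k ∈ Finset.range n, exp (-jacobiEig α β k * s) *
        |(p k).eval x * (p k).eval z| ≤ E / V := by
    have h1 := h.sum_abs_le (t := s) (by linarith) hx hz n
    have h2 := hself hst hz hxz
    have h3 := hself hst hx (by rw [jacobiDist_self]; exact hs.le)
    linarith
  set f : ℕ → ℝ[X] := fun n =>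
    ∑ k ∈ Finset.range n, (exp (-jacobiEig α β k * t) * (p k).eval x) • p k with hf
  have hfe (n : ℕ) (z : ℝ) : (f n).eval z =
      ∑ k ∈ Finset.range n, exp (-jacobiEig α β k * t) * ((p k).eval x * (p k).eval z) := by
    rw [hf, eval_finsetSum]
    refine Finset.sum_congr rfl fun k _ => ?_
    rw [eval_smul, smul_eq_mul, mul_assoc]
  have hfA (n : ℕ) (z : ℝ) (hz : z ∈ Icc (-1 : ℝ) 1) (hxz : jacobiDist x z ≤ 2 * (√t / 2)) :
      |(f n).eval z| ≤ E / V := by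
    rw [hfe]
    refine (Finset.abs_sum_le_sum_abs _ _).trans (le_trans (le_of_eq ?_)
      (hsum (s := t) (by linarith) hz (by linarith) n))
    exact Finset.sum_congr rfl fun k _ => by rw [abs_mul, abs_exp]
  have hfG (n : ℕ) (z : ℝ) (hz : z ∈ Icc (-1 : ℝ) 1) (hxz : jacobiDist x z ≤ 2 * (√t / 2)) :
      |(jacobiOp α β (f n)).eval z| ≤ 2 / t * (E / V) := by
    have e : (jacobiOp α β (f n)).eval z = ∑ k ∈ Finset.range n,
        -(jacobiEig α β k * exp (-jacobiEig α β k * t)) * ((p k).eval x * (p k).eval z) := by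
      rw [hf, map_sum, eval_finsetSum]
      refine Finset.sum_congr rfl fun k _ => ?_
      rw [map_smul, h.jacobiOp_self, eval_smul, eval_smul, smul_eq_mul, smul_eq_mul]
      ring
    rw [e]
    refine (Finset.abs_sum_le_sum_abs _ _).trans (le_trans ?_
      (mul_le_mul_of_nonneg_left (hsum (s := t / 2) (by linarith) hz (by linarith) n)
        (by positivity : 0 ≤ 2 / t)))
    rw [Finset.mul_sum]
    refine Finset.sum_le_sum fun k _ => ?_
    rw [abs_mul, abs_neg, abs_of_nonneg (mul_nonneg (h.jacobiEig_nonneg k) (exp_pos _).le),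
      ← mul_assoc]
    exact mul_le_mul_of_nonneg_right (mul_exp_neg_le ht) (abs_nonneg _)
  have hlim {z : ℝ} (hz : z ∈ Icc (-1 : ℝ) 1) :
      Tendsto (fun n => (f n).eval z) atTop (𝓝 (jacobiHeat α β p t x z)) := by
    simp only [hfe]
    exact (h.hasSum_jacobiHeat ht hx hz).tendsto_sum_nat
  have hxy' : jacobiDist x y ≤ √t / 2 := hxy.trans (by nlinarith)
  have h1 := le_of_tendsto' ((hlim hx).sub (hlim hy)).abs fun n =>
    hosc (f n) (E / V) (2 / t * (E / V)) (√t / 2) x y (by positivity) hx hy (hfA n) (hfG n) hxy'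
  have e : E / V / (√t / 2) + √t / 2 * (2 / t * (E / V)) = 3 * E / (V * √t) := by
    have key (s : ℝ) (hs : 0 < s) :
        E / V / (s / 2) + s / 2 * (2 / (s * s) * (E / V)) = 3 * E / (V * s) := by
      field_simp; ring
    have := key √t hs
    rwa [mul_self_sqrt ht.le] at this
  rw [e] at h1
  have h2 : K * (3 * E / (V * √t)) * jacobiDist x y ≤ K * (3 * E / (V * √t)) * (ε * √t) := by
    gcongr
  have h3 : K * (3 * E / (V * √t)) * (ε * √t) * V = 3 * K * E * ε := by field_simp
  have h4 := mul_le_mul_of_nonneg_right ((le_abs_self _).trans (h1.trans h2)) hV0.le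
  have h5 := hdiag h t x ht hx
  rw [h3, sub_mul] at h4
  linarith

lemma exists_pow_le_jacobiHeat (hα : -1 < α) (hβ : -1 < β) : ∃ η > 0, ∃ c > 0, c < 1 ∧
    ∀ {p : ℕ → ℝ[X]} (_ : JacobiSystem α β p) (n : ℕ) (s x y : ℝ), 0 < s →
      x ∈ Icc (-1 : ℝ) 1 → y ∈ Icc (-1 : ℝ) 1 → jacobiDist x y ≤ (n + 1) * (η * √s) →
      c ^ (n + 1) ≤ jacobiHeat α β p ((n + 1) * s) x y * jacobiVol α β x √s := by
  obtain ⟨ε, hε, c₀, hc₀, H⟩ := exists_le_jacobiHeat_near hα hβ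
  have hη : 0 < min (ε / 3) 1 := by positivity
  obtain ⟨D, hD0, hD⟩ := exists_jacobiVol_mul_le hα hβ (ε := min (ε / 3) 1 / 3) (by positivity)
  set η := min (ε / 3) 1 with hηdef
  have hη1 : η ≤ ε / 3 := min_le_left _ _
  have hη2 : η ≤ 1 := min_le_right _ _
  set c := min (1 / 2) (min c₀ (c₀ / D)) with hc
  have hc0 : 0 < c := by positivity
  have hc1 : c ≤ c₀ := (min_le_right _ _).trans (min_le_left _ _)
  have hc2 : c * D ≤ c₀ := by
    rw [← le_div_iff₀ hD0]
    exact (min_le_right _ _).trans (min_le_right _ _)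
  refine ⟨η, hη, c, hc0, (min_le_left _ _).trans_lt (by norm_num), fun {p} h n => ?_⟩
  have := isFiniteMeasure_jacobiMeasure hα hβ
  induction n with
  | zero =>
    intro s x y hs hx hy hxy
    have h1 := mul_pos hη (sqrt_pos.2 hs)
    simp only [Nat.cast_zero, zero_add, pow_one, one_mul] at hxy ⊢
    refine hc1.trans (H h s x y hs hx hy (hxy.trans ?_))
    exact mul_le_mul_of_nonneg_right (by linarith) (sqrt_nonneg s)
  | succ n ih =>
    intro s x y hs hx hy hxy
    have hr := sqrt_pos.2 hs
    push_cast at hxy ⊢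
    obtain ⟨w, hw, hxw, hwy⟩ := exists_intermediate_point x y (r := η * √s) n (by linarith)
    set B := {z | jacobiDist w z < η * √s} with hB
    have hBm : MeasurableSet B := measurableSet_jacobiBall w _
    have hVx : 0 < jacobiVol α β x √s := jacobiVol_pos hα hβ hx hr
    have hVy : 0 < jacobiVol α β y √s := jacobiVol_pos hα hβ hy hr
    have hns : 0 < ((n : ℝ) + 1) * s := by positivity
    set m := c ^ (n + 1) / jacobiVol α β x √s * (c₀ / jacobiVol α β y √s) with hm
    have hpt (z : ℝ) (hz : z ∈ Icc (-1 : ℝ) 1) : B.indicator (fun _ => m) z ≤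
        jacobiHeat α β p ((n + 1) * s) x z * jacobiHeat α β p s y z := by
      by_cases hzB : z ∈ B
      · rw [indicator_of_mem hzB]
        have hwz : jacobiDist w z < η * √s := hzB
        have h1 := ih s x z hs hx hz (by linarith [jacobiDist_triangle x w z])
        have h2 := H h s y z hs hy hz (by
          have h3 := jacobiDist_triangle y w z
          rw [jacobiDist_comm y w] at h3
          have h4 := mul_le_mul_of_nonneg_right hη1 hr.le
          linarith)
        rw [← div_le_iff₀ hVx] at h1
        rw [← div_le_iff₀ hVy] at h2
        exact mul_le_mul h1 h2 (by positivity) (h.jacobiHeat_nonneg hns hx hz)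
      · rw [indicator_of_notMem hzB]
        exact mul_nonneg (h.jacobiHeat_nonneg hns hx hz) (h.jacobiHeat_nonneg hs hy hz)
    have i1 := h.continuousOn_jacobiHeat hns hx
    have i2 := h.continuousOn_jacobiHeat hs hy
    have h1 := integral_mono_ae ((integrable_const m).indicator hBm)
      (integrable_jacobiMeasure hα hβ (i1.mul i2)) (by
        filter_upwards [ae_jacobiMeasure_mem α β] with z hz using hpt z hz)
    rw [integral_indicator_const _ hBm, smul_eq_mul] at h1
    have h2 := h.integral_jacobiHeat_mul_jacobiHeat hns hs hx hy
    rw [show ((n : ℝ) + 1) * s + s = (n + 1 + 1) * s by ring] at h2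
    have h3 := h1.trans h2.le
    have h4 : jacobiVol α β y √s ≤ D * (jacobiMeasure α β).real B := by
      have h5 : jacobiVol α β y √s ≤ jacobiVol α β w (3 * √s) :=
        jacobiVol_le_of_subset hα hβ (by
          rw [jacobiDist_comm]
          have := mul_le_mul_of_nonneg_right hη2 hr.le
          linarith)
      have h6 := hD w hw (3 * √s) (by positivity)
      rw [show η / 3 * (3 * √s) = η * √s by ring] at h6
      exact h5.trans h6
    have h7 : c * jacobiVol α β y √s ≤ (jacobiMeasure α β).real B * c₀ := by
      have h8 := mul_le_mul_of_nonneg_left h4 hc0.le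
      have h9 := mul_le_mul_of_nonneg_right hc2 (measureReal_nonneg (μ := jacobiMeasure α β)
        (s := B))
      linarith
    rw [← div_le_iff₀ hVx]
    refine le_trans ?_ h3
    rw [hm, pow_succ, div_le_iff₀ hVx]
    have e : (jacobiMeasure α β).real B * (c ^ (n + 1) / jacobiVol α β x √s *
        (c₀ / jacobiVol α β y √s)) * jacobiVol α β x √s =
        c ^ (n + 1) * ((jacobiMeasure α β).real B * c₀ / jacobiVol α β y √s) := by
      field_simp
    rw [e]
    refine mul_le_mul_of_nonneg_left ?_ (by positivity)
    rwa [le_div_iff₀ hVy]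

/-- The Gaussian lower bound for the Jacobi heat kernel. -/
lemma exists_le_jacobiHeat (hα : -1 < α) (hβ : -1 < β) : ∃ c > 0, ∃ b > 0,
    ∀ {p : ℕ → ℝ[X]} (_ : JacobiSystem α β p) (t x y : ℝ), 0 < t → x ∈ Icc (-1 : ℝ) 1 →
      y ∈ Icc (-1 : ℝ) 1 → c * exp (-(jacobiDist x y) ^ 2 / (b * t)) ≤
        jacobiHeat α β p t x y * √(jacobiVol α β x √t * jacobiVol α β y √t) := by
  obtain ⟨η, hη, c, hc, hc1, H⟩ := exists_pow_le_jacobiHeat hα hβ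
  set L := -log c with hL
  have hL0 : 0 < L := neg_pos.2 (log_neg hc hc1)
  refine ⟨exp (-(2 * L)), exp_pos _, η ^ 2 / L, by positivity, fun {p} h t x y ht hx hy => ?_⟩
  set a := jacobiDist x y ^ 2 / (η ^ 2 * t) with ha
  have ha0 : 0 ≤ a := by positivity
  set n := ⌈a⌉₊ with hn
  have hn1 : a ≤ n := Nat.le_ceil a
  have hn2 : (n : ℝ) < a + 1 := Nat.ceil_lt_add_one ha0
  have hnp : (0 : ℝ) < n + 1 := by positivity
  have hs : 0 < t / (n + 1) := by positivity
  have hdist : jacobiDist x y ≤ (n + 1) * (η * √(t / (n + 1))) := by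
    refine abs_le_of_sq_le_sq' ?_ (by positivity) |>.2
    rw [mul_pow, mul_pow, sq_sqrt hs.le]
    have h1 : jacobiDist x y ^ 2 = a * (η ^ 2 * t) := by rw [ha]; field_simp
    have h2 : ((n : ℝ) + 1) ^ 2 * (η ^ 2 * (t / (n + 1))) = (n + 1) * (η ^ 2 * t) := by
      field_simp
    rw [h1, h2]
    exact mul_le_mul_of_nonneg_right (by linarith) (by positivity)
  have hmono (z : ℝ) : jacobiVol α β z √(t / (n + 1)) ≤ jacobiVol α β z √t :=
    jacobiVol_mono hα hβ z (sqrt_le_sqrt (div_le_self ht.le (by linarith)))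
  have hK := h.jacobiHeat_nonneg ht hx hy
  have h1 := H h n _ x y hs hx hy hdist
  have h2 := H h n _ y x hs hy hx (by rwa [jacobiDist_comm])
  rw [mul_div_cancel₀ _ hnp.ne'] at h1 h2
  rw [jacobiHeat_comm] at h2
  replace h1 := h1.trans (mul_le_mul_of_nonneg_left (hmono x) hK)
  replace h2 := h2.trans (mul_le_mul_of_nonneg_left (hmono y) hK)
  have h3 : c ^ (n + 1) ≤ jacobiHeat α β p t x y * √(jacobiVol α β x √t * jacobiVol α β y √t) := by
    refine abs_le_of_sq_le_sq' ?_ (mul_nonneg hK (sqrt_nonneg _)) |>.2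
    have hV0 (z r : ℝ) : 0 ≤ jacobiVol α β z r := measureReal_nonneg
    rw [mul_pow, sq_sqrt (mul_nonneg (hV0 _ _) (hV0 _ _))]
    have := mul_le_mul h1 h2 (by positivity) (mul_nonneg hK measureReal_nonneg)
    refine le_trans (le_of_eq (sq _)) (this.trans (le_of_eq ?_))
    ring
  refine le_trans ?_ h3
  have h4 : c = exp (-L) := by rw [hL, neg_neg, exp_log hc]
  rw [h4, ← exp_nat_mul, ← exp_add, exp_le_exp]
  have h5 : -jacobiDist x y ^ 2 / (η ^ 2 / L * t) = -(L * a) := by rw [ha]; field_simp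
  rw [h5]
  push_cast
  nlinarith

end JacobiSystem

end LowerBound

end HeatKernel

/-- Two-sided Gaussian bounds for the Jacobi heat kernel on `[-1,1]`. -/
theorem stmt2 (α β : ℝ) (hα : -1 < α) (hβ : -1 < β) (p : ℕ → Polynomial ℝ)
    (hdeg : ∀ k, (p k).natDegree = k)
    (horth : ∀ k l : ℕ,
      ∫ x, (p k).eval x * (p l).eval x ∂(jacobiMeasure α β) = if k = l then 1 else 0) :
    ∃ c₁ > (0 : ℝ), ∃ c₂ > (0 : ℝ), ∃ c₃ > (0 : ℝ), ∃ c₄ > (0 : ℝ),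
      ∀ x ∈ Set.Icc (-1 : ℝ) 1, ∀ y ∈ Set.Icc (-1 : ℝ) 1, ∀ t : ℝ, 0 < t →
        c₁ * Real.exp (-(jacobiDist x y) ^ 2 / (c₂ * t)) /
            Real.sqrt (jacobiVol α β x (Real.sqrt t) * jacobiVol α β y (Real.sqrt t))
          ≤ jacobiHeat α β p t x y ∧
        jacobiHeat α β p t x y ≤
          c₃ * Real.exp (-(jacobiDist x y) ^ 2 / (c₄ * t)) /
            Real.sqrt (jacobiVol α β x (Real.sqrt t) * jacobiVol α β y (Real.sqrt t)) := by
  have h : JacobiSystem α β p := ⟨hα, hβ, hdeg, horth⟩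
  obtain ⟨c₁, hc₁, c₂, hc₂, hlower⟩ := JacobiSystem.exists_le_jacobiHeat hα hβ
  obtain ⟨c₃, hc₃, hupper⟩ := JacobiSystem.exists_jacobiHeat_le hα hβ
  refine ⟨c₁, hc₁, c₂, hc₂, c₃, hc₃, 32, by norm_num, fun x hx y hy t ht => ?_⟩
  have hV : 0 < √(jacobiVol α β x √t * jacobiVol α β y √t) :=
    sqrt_pos.2 (mul_pos (jacobiVol_pos hα hβ hx (sqrt_pos.2 ht))
      (jacobiVol_pos hα hβ hy (sqrt_pos.2 ht)))
  rw [div_le_iff₀ hV, le_div_iff₀ hV]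
  exact ⟨hlower h t x y ht hx hy, hupper h t x y ht hx hy⟩

end
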